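/- Borel Jordan–Schoenflies theorem: Let S¹ = {v ∈ ℝ² : ‖v‖ = 1} be the unit circle and let Emb(S¹, ℝ²) ⊆ C(S¹, ℝ²) be the set of injective continuous maps S¹ → ℝ², with the subspace topology of the compact-open topology. There exists a Borel measurable map H : Emb(S¹, ℝ²) → C(ℝ², ℝ²) such that for every γ ∈ Emb(S¹, ℝ²), H(γ) is a homeomorphism of ℝ² onto itself (a continuous bijection with continuous inverse), and H(γ)(v) = γ(v) for every v ∈ S¹. -/

import Mathlib

/-- The unit circle `S¹ = {v ∈ ℝ² : ‖v‖ = 1}`. -/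
abbrev unitCircle : Set (EuclideanSpace ℝ (Fin 2)) := {v | ‖v‖ = 1}

section

open Set Filter Topology TopologicalSpace MeasureTheory

/-- A continuous surjection from a Polish space whose saturations of open sets are open has a Borel
section. -/
theorem exists_measurable_section {G Y : Type*} [TopologicalSpace G] [PolishSpace G]
    [TopologicalSpace Y] [T2Space Y] [SecondCountableTopology Y] [MeasurableSpace G] [BorelSpace G]
    [MeasurableSpace Y] [BorelSpace Y] {π : G → Y} (hπ : Continuous π)
    (hsurj : Function.Surjective π)
    (hsat : ∀ U : Set G, IsOpen U → IsOpen (π ⁻¹' (π '' U))) :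
    ∃ s : Y → G, Measurable s ∧ ∀ y, π (s y) = y := by
  have himg : ∀ U : Set G, IsOpen U → MeasurableSet (π '' U) := by
    intro U hU
    refine AnalyticSet.measurableSet_of_compl (hU.analyticSet_image hπ) ?_
    have h2 : (π '' U)ᶜ = π '' (π ⁻¹' (π '' U))ᶜ := by
      rw [← preimage_compl, image_preimage_eq _ hsurj]
    rw [h2]
    exact (hsat U hU).isClosed_compl.analyticSet.image_of_continuous hπ
  rcases isEmpty_or_nonempty G with hG | hG
  · exact ⟨fun y => hG.elim (hsurj y).choose, measurable_of_empty_codomain _,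
      fun y => hG.elim (hsurj y).choose⟩
  let := upgradeIsCompletelyMetrizable G
  let d := denseSeq G
  have hd : DenseRange d := denseRange_denseSeq G
  let r : ℕ → ℝ := fun k => (1 / 2) ^ k
  have hr : ∀ k, 0 < r k := fun k => by positivity
  let P : ℕ → (Y → ℕ) → Prop := fun k c =>
    Measurable c ∧ ∀ y, ∃ x ∈ Metric.ball (d (c y)) (r k), π x = y
  have hstep : ∀ k c, P k c → ∃ c', P (k + 1) c' ∧
      ∀ y, dist (d (c y)) (d (c' y)) < r k + r (k + 1) := by
    intro k c hc
    classical
    let V : ℕ → ℕ → Set G := fun i j => Metric.ball (d i) (r (k + 1)) ∩ Metric.ball (d j) (r k)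
    have hex : ∀ y, ∃ i, y ∈ π '' V i (c y) := by
      intro y
      obtain ⟨x, hx, hxy⟩ := hc.2 y
      obtain ⟨i, hi⟩ := hd.exists_dist_lt x (hr (k + 1))
      exact ⟨i, x, ⟨hi, hx⟩, hxy⟩
    refine ⟨fun y => Nat.find (hex y), ⟨measurable_find hex fun i => ?_, fun y => ?_⟩, fun y => ?_⟩
    · have : {y | y ∈ π '' V i (c y)} = ⋃ j, (c ⁻¹' {j} ∩ π '' V i j) := by
        ext y
        simp only [mem_ofPred_eq, mem_iUnion, mem_inter_iff, mem_preimage, mem_singleton_iff]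
        constructor
        · exact fun h => ⟨_, rfl, h⟩
        · rintro ⟨j, rfl, h⟩
          exact h
      rw [this]
      exact MeasurableSet.iUnion fun j => (hc.1 (measurableSet_singleton j)).inter
        (himg _ (Metric.isOpen_ball.inter Metric.isOpen_ball))
    · obtain ⟨x, hx, hxy⟩ := Nat.find_spec (hex y)
      exact ⟨x, hx.1, hxy⟩
    · obtain ⟨x, hx, hxy⟩ := Nat.find_spec (hex y)
      have h1 := Metric.mem_ball.1 hx.1
      have h2 := Metric.mem_ball'.1 hx.2
      linarith [dist_triangle (d (c y)) x (d (Nat.find (hex y)))]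
  have h0 : ∃ c, P 0 c := by
    classical
    have hex : ∀ y, ∃ i, y ∈ π '' Metric.ball (d i) (r 0) := by
      intro y
      obtain ⟨x, hxy⟩ := hsurj y
      obtain ⟨i, hi⟩ := hd.exists_dist_lt x (hr 0)
      exact ⟨i, x, hi, hxy⟩
    refine ⟨fun y => Nat.find (hex y), measurable_find hex fun i => himg _ Metric.isOpen_ball,
      fun y => ?_⟩
    obtain ⟨x, hx, hxy⟩ := Nat.find_spec (hex y)
    exact ⟨x, hx, hxy⟩
  choose! nxt hnxt using hstep
  obtain ⟨c0, hc0⟩ := h0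
  let c : ℕ → Y → ℕ := fun k => Nat.rec c0 (fun k c => nxt k c) k
  have hc : ∀ k, P k (c k) := by
    intro k
    induction k with
    | zero => exact hc0
    | succ k ih => exact (hnxt k _ ih).1
  have hdist : ∀ y k, dist (d (c k y)) (d (c (k + 1) y)) ≤ 2 * (1 / 2) ^ k := by
    intro y k
    have h1 := (hnxt k _ (hc k)).2 y
    have h2 : r (k + 1) = (1 / 2) * r k := by simp only [r]; ring
    have h3 := hr k
    change dist (d (c k y)) (d (nxt k (c k) y)) ≤ 2 * r k
    linarith
  have hlim : ∀ y, ∃ x, Tendsto (fun k => d (c k y)) atTop (𝓝 x) := fun y =>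
    cauchySeq_tendsto_of_complete (cauchySeq_of_le_geometric _ _ (by norm_num) (hdist y))
  choose s hs using hlim
  refine ⟨s, measurable_of_tendsto_metrizable (f := fun k y => d (c k y)) (fun k => ?_)
    (tendsto_pi_nhds.2 hs), fun y => ?_⟩
  · exact (measurable_from_top (f := d)).comp (hc k).1
  · have := fun k => (hc k).2 y
    choose x hx hxy using this
    have hr0 : Tendsto r atTop (𝓝 0) := tendsto_pow_atTop_nhds_zero_of_lt_one (by norm_num)
      (by norm_num)
    have hxs : Tendsto x atTop (𝓝 (s y)) := by
      refine (hs y).congr_dist ?_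
      exact squeeze_zero (fun _ => dist_nonneg) (fun k => (Metric.mem_ball'.1 (hx k)).le) hr0
    have := (hπ.tendsto (s y)).comp hxs
    refine tendsto_nhds_unique this ?_
    simp only [Function.comp_def, hxy]
    exact tendsto_const_nhds

section Selection

/-- Self-homeomorphisms of the plane as pairs of mutually inverse continuous maps. -/
def planeHomeoPairs : Set (C((EuclideanSpace ℝ (Fin 2)), (EuclideanSpace ℝ (Fin 2))) × C((EuclideanSpace ℝ (Fin 2)), (EuclideanSpace ℝ (Fin 2)))) :=
  {p | p.1.comp p.2 = ContinuousMap.id _ ∧ p.2.comp p.1 = ContinuousMap.id _}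

theorem isClosed_planeHomeoPairs : IsClosed planeHomeoPairs := by
  refine IsClosed.inter ?_ ?_
  · exact isClosed_eq (continuous_fst.compCM continuous_snd) continuous_const
  · exact isClosed_eq (continuous_snd.compCM continuous_fst) continuous_const

instance : PolishSpace C((EuclideanSpace ℝ (Fin 2)), (EuclideanSpace ℝ (Fin 2))) where
  toIsCompletelyMetrizableSpace := inferInstance

theorem planeHomeoPairs.apply_apply {p : C((EuclideanSpace ℝ (Fin 2)), (EuclideanSpace ℝ (Fin 2))) × C((EuclideanSpace ℝ (Fin 2)), (EuclideanSpace ℝ (Fin 2)))} (hp : p ∈ planeHomeoPairs) (x : (EuclideanSpace ℝ (Fin 2))) :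
    p.1 (p.2 x) = x := congrArg (fun f : C((EuclideanSpace ℝ (Fin 2)), (EuclideanSpace ℝ (Fin 2))) => f x) hp.1

theorem planeHomeoPairs.symm_apply_apply {p : C((EuclideanSpace ℝ (Fin 2)), (EuclideanSpace ℝ (Fin 2))) × C((EuclideanSpace ℝ (Fin 2)), (EuclideanSpace ℝ (Fin 2)))} (hp : p ∈ planeHomeoPairs)
    (x : (EuclideanSpace ℝ (Fin 2))) : p.2 (p.1 x) = x := congrArg (fun f : C((EuclideanSpace ℝ (Fin 2)), (EuclideanSpace ℝ (Fin 2))) => f x) hp.2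

theorem exists_measurable_homeo_extension
    (hJS : ∀ γ : C(↥unitCircle, (EuclideanSpace ℝ (Fin 2))), Function.Injective ⇑γ →
      ∃ e : (EuclideanSpace ℝ (Fin 2)) ≃ₜ (EuclideanSpace ℝ (Fin 2)), ∀ v : ↥unitCircle, e v = γ v) :
    ∃ H : {γ : C(↥unitCircle, (EuclideanSpace ℝ (Fin 2))) // Function.Injective ⇑γ} → C((EuclideanSpace ℝ (Fin 2)), (EuclideanSpace ℝ (Fin 2))),
      @Measurable _ _ (borel _) (borel _) H ∧
      ∀ γ, (∃ e : (EuclideanSpace ℝ (Fin 2)) ≃ₜ (EuclideanSpace ℝ (Fin 2)), ∀ x, e x = H γ x) ∧ ∀ v : ↥unitCircle, H γ (v : (EuclideanSpace ℝ (Fin 2))) = γ.1 v := by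
  have hK : IsCompact unitCircle := by
    have : unitCircle = Metric.sphere 0 1 := by ext; simp
    rw [this]; exact isCompact_sphere _ _
  have : CompactSpace unitCircle := isCompact_iff_compactSpace.1 hK
  let Y := {γ : C(↥unitCircle, (EuclideanSpace ℝ (Fin 2))) // Function.Injective ⇑γ}
  have : PolishSpace planeHomeoPairs := isClosed_planeHomeoPairs.polishSpace
  let : MeasurableSpace planeHomeoPairs := borel _
  have : BorelSpace planeHomeoPairs := ⟨rfl⟩
  let : MeasurableSpace Y := borel _
  have : BorelSpace Y := ⟨rfl⟩
  let : MeasurableSpace C((EuclideanSpace ℝ (Fin 2)), (EuclideanSpace ℝ (Fin 2))) := borel _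
  have : BorelSpace C((EuclideanSpace ℝ (Fin 2)), (EuclideanSpace ℝ (Fin 2))) := ⟨rfl⟩
  let π : planeHomeoPairs → Y := fun p => ⟨p.1.1.restrict unitCircle, by
    intro x y hxy
    have h : p.1.1 x = p.1.1 y := hxy
    have := congrArg p.1.2 h
    rw [planeHomeoPairs.symm_apply_apply p.2, planeHomeoPairs.symm_apply_apply p.2] at this
    exact Subtype.ext this⟩
  have hπ : Continuous π := by
    refine Continuous.subtype_mk ?_ _
    exact (ContinuousMap.continuous_restrict _).comp (continuous_fst.comp continuous_subtype_val)
  have hsurj : Function.Surjective π := by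
    rintro ⟨γ, hγ⟩
    obtain ⟨e, he⟩ := hJS γ hγ
    refine ⟨⟨(⟨e, e.continuous⟩, ⟨e.symm, e.symm.continuous⟩), ?_, ?_⟩, ?_⟩
    · ext1 x; simp
    · ext1 x; simp
    · apply Subtype.ext
      ext1 v
      exact he v
  have hsat : ∀ U : Set planeHomeoPairs, IsOpen U → IsOpen (π ⁻¹' (π '' U)) := by
    intro U hU
    rw [isOpen_iff_mem_nhds]
    rintro p ⟨q, hqU, hqp⟩
    have hfix : ∀ v : unitCircle, q.1.1 v = p.1.1 v := fun v =>
      congrArg (fun γ : Y => γ.1 v) hqp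
    let h : C((EuclideanSpace ℝ (Fin 2)), (EuclideanSpace ℝ (Fin 2))) := p.1.2.comp q.1.1
    let h' : C((EuclideanSpace ℝ (Fin 2)), (EuclideanSpace ℝ (Fin 2))) := q.1.2.comp p.1.1
    have hh' : ∀ x, h (h' x) = x := fun x => by
      simp only [h, h', ContinuousMap.comp_apply, planeHomeoPairs.apply_apply q.2,
        planeHomeoPairs.symm_apply_apply p.2]
    have hh : ∀ x, h' (h x) = x := fun x => by
      simp only [h, h', ContinuousMap.comp_apply, planeHomeoPairs.apply_apply p.2,
        planeHomeoPairs.symm_apply_apply q.2]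
    let T : planeHomeoPairs → planeHomeoPairs := fun s => ⟨(s.1.1.comp h, h'.comp s.1.2), by
      constructor
      · ext1 x
        simp only [ContinuousMap.comp_apply, hh', planeHomeoPairs.apply_apply s.2,
          ContinuousMap.id_apply]
      · ext1 x
        simp only [ContinuousMap.comp_apply, hh, planeHomeoPairs.symm_apply_apply s.2,
          ContinuousMap.id_apply]⟩
    have hT : Continuous T := by
      refine Continuous.subtype_mk ?_ _
      refine Continuous.prodMk ?_ ?_
      · exact (continuous_fst.comp continuous_subtype_val).compCM continuous_const
      · exact continuous_const.compCM (continuous_snd.comp continuous_subtype_val)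
    have hTp : T p = q := by
      apply Subtype.ext
      refine Prod.ext ?_ ?_
      · ext1 x
        simp only [T, h, ContinuousMap.comp_apply, planeHomeoPairs.apply_apply p.2]
      · ext1 x
        simp only [T, h', ContinuousMap.comp_apply, planeHomeoPairs.apply_apply p.2]
    refine mem_of_superset ((hU.preimage hT).mem_nhds (by rwa [mem_preimage, hTp])) ?_
    intro s hs
    refine ⟨T s, hs, ?_⟩
    apply Subtype.ext
    ext1 v
    change s.1.1 (h v) = s.1.1 v
    have : h v = v := by
      simp only [h, ContinuousMap.comp_apply, hfix, planeHomeoPairs.symm_apply_apply p.2]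
    rw [this]
  obtain ⟨s, hs, hsπ⟩ := exists_measurable_section hπ hsurj hsat
  refine ⟨fun γ => (s γ).1.1, ?_, fun γ => ⟨⟨⟨⟨(s γ).1.1, (s γ).1.2,
    planeHomeoPairs.symm_apply_apply (s γ).2, planeHomeoPairs.apply_apply (s γ).2⟩,
    (s γ).1.1.continuous, (s γ).1.2.continuous⟩, fun x => rfl⟩, fun v => ?_⟩⟩
  · exact (continuous_fst.comp continuous_subtype_val).measurable.comp hs
  · exact congrArg (fun γ : Y => γ.1 v) (hsπ γ)

end Selection

section Logarithms

/-- `f` has a continuous logarithm on `K`. -/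
def HasLog {X : Type*} [TopologicalSpace X] (K : Set X) (f : X → ℂ) : Prop :=
  ∃ g : X → ℂ, ContinuousOn g K ∧ ∀ z ∈ K, Complex.exp (g z) = f z

variable {X : Type*} [TopologicalSpace X] {K K' : Set X} {f f' : X → ℂ}

theorem HasLog.mono (h : HasLog K f) (hK : K' ⊆ K) : HasLog K' f := by
  obtain ⟨g, hg, hf⟩ := h
  exact ⟨g, hg.mono hK, fun z hz => hf z (hK hz)⟩

theorem HasLog.congr (h : HasLog K f) (hf : ∀ z ∈ K, f' z = f z) : HasLog K f' := by
  obtain ⟨g, hg, hgf⟩ := h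
  exact ⟨g, hg, fun z hz => (hgf z hz).trans (hf z hz).symm⟩

theorem HasLog.mul (h : HasLog K f) (h' : HasLog K f') : HasLog K fun z => f z * f' z := by
  obtain ⟨g, hg, hgf⟩ := h
  obtain ⟨g', hg', hgf'⟩ := h'
  exact ⟨fun z => g z + g' z, hg.add hg', fun z hz => by
    rw [Complex.exp_add, hgf z hz, hgf' z hz]⟩

theorem HasLog.inv (h : HasLog K f) : HasLog K fun z => (f z)⁻¹ := by
  obtain ⟨g, hg, hgf⟩ := h
  exact ⟨fun z => -g z, hg.neg, fun z hz => by rw [Complex.exp_neg, hgf z hz]⟩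

theorem HasLog.div (h : HasLog K f) (h' : HasLog K f') : HasLog K fun z => f z / f' z := by
  simpa only [div_eq_mul_inv] using h.mul h'.inv

theorem HasLog.of_slitPlane (hf : ContinuousOn f K) (h : ∀ z ∈ K, f z ∈ Complex.slitPlane) :
    HasLog K f :=
  ⟨fun z => Complex.log (f z), hf.clog h, fun z hz =>
    Complex.exp_log (Complex.slitPlane_ne_zero (h z hz))⟩

theorem HasLog.const {c : ℂ} (hc : c ≠ 0) : HasLog K fun _ => c :=
  ⟨fun _ => Complex.log c, continuousOn_const, fun _ _ => Complex.exp_log hc⟩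

theorem HasLog.comp {Z : Type*} [TopologicalSpace Z] {L : Set Z} {φ : Z → X} (h : HasLog K f)
    (hφ : ContinuousOn φ L) (hL : MapsTo φ L K) : HasLog L fun z => f (φ z) := by
  obtain ⟨g, hg, hgf⟩ := h
  exact ⟨fun z => g (φ z), hg.comp hφ hL, fun z hz => hgf _ (hL hz)⟩

theorem exists_continuous_log {V : Type*} [NormedAddCommGroup V] [NormedSpace ℝ V] {f : V → ℂ}
    (hf : Continuous f) (h0 : ∀ z, f z ≠ 0) :
    ∃ g : V → ℂ, Continuous g ∧ ∀ z, Complex.exp (g z) = f z := by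
  obtain ⟨F, ⟨-, hF⟩, -⟩ := Complex.isCoveringMapOn_exp.existsUnique_continuousMap_lifts ⟨f, hf⟩
    (a₀ := 0) (e₀ := Complex.log (f 0)) (Complex.exp_log (h0 0)) h0
  exact ⟨F, F.continuous, fun z => congrFun hF z⟩

/-- Retracts of normed spaces carry continuous logarithms of nonvanishing functions. -/
theorem HasLog.of_retract {V : Type*} [NormedAddCommGroup V] [NormedSpace ℝ V] {K : Set V}
    {f : V → ℂ} {ρ : V → V} (hρ : Continuous ρ) (hρK : ∀ z, ρ z ∈ K) (hρid : ∀ z ∈ K, ρ z = z)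
    (hf : ContinuousOn f K) (h0 : ∀ z ∈ K, f z ≠ 0) : HasLog K f := by
  obtain ⟨g, hg, hgf⟩ := exists_continuous_log (f := fun z => f (ρ z))
    (hf.comp_continuous hρ hρK) fun z => h0 _ (hρK z)
  exact ⟨g, hg.continuousOn, fun z hz => by rw [hgf, hρid z hz]⟩

theorem HasLog.of_Icc {a b : ℝ} (hab : a ≤ b) {f : ℝ → ℂ} (hf : ContinuousOn f (Icc a b))
    (h0 : ∀ z ∈ Icc a b, f z ≠ 0) : HasLog (Icc a b) f :=
  HasLog.of_retract (ρ := fun x => (projIcc a b hab x : ℝ))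
    (continuous_subtype_val.comp continuous_projIcc) (fun z => (projIcc a b hab z).2)
    (fun z hz => by simp [projIcc_of_mem hab hz]) hf h0

/-- The radial retraction of the plane onto the closed unit disc. -/
noncomputable def discRetract (z : ℂ) : ℂ := z / (max 1 ‖z‖ : ℝ)

theorem max_one_norm_ne_zero (z : ℂ) : ((max 1 ‖z‖ : ℝ) : ℂ) ≠ 0 := by
  have : (0 : ℝ) < max 1 ‖z‖ := lt_max_of_lt_left one_pos
  exact_mod_cast this.ne'

theorem continuous_discRetract : Continuous discRetract := by
  unfold discRetract
  exact continuous_id.div (by fun_prop) max_one_norm_ne_zero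

theorem norm_discRetract_le (z : ℂ) : ‖discRetract z‖ ≤ 1 := by
  have h : (0 : ℝ) < max 1 ‖z‖ := lt_max_of_lt_left one_pos
  rw [discRetract, norm_div, Complex.norm_real, Real.norm_of_nonneg h.le, div_le_one h]
  exact le_max_right _ _

theorem discRetract_of_norm_le {z : ℂ} (hz : ‖z‖ ≤ 1) : discRetract z = z := by
  simp [discRetract, max_eq_left hz]

theorem HasLog.of_closedBall {f : ℂ → ℂ} (hf : ContinuousOn f (Metric.closedBall 0 1))
    (h0 : ∀ z ∈ Metric.closedBall (0 : ℂ) 1, f z ≠ 0) : HasLog (Metric.closedBall 0 1) f :=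
  HasLog.of_retract continuous_discRetract
    (fun z => by simpa using norm_discRetract_le z)
    (fun z hz => discRetract_of_norm_le (by simpa using hz)) hf h0

/-- Two continuous logarithms of the same function on a preconnected set differ by a constant. -/
theorem eqOn_sub_of_exp_eq {S : Set X} (hS : IsPreconnected S) {g h : X → ℂ}
    (hg : ContinuousOn g S) (hh : ContinuousOn h S)
    (hexp : ∀ x ∈ S, Complex.exp (g x) = Complex.exp (h x)) {x y : X} (hx : x ∈ S) (hy : y ∈ S) :
    g x - h x = g y - h y := by
  have hint : ∀ x ∈ S, ∃ n : ℤ, (g x - h x) / (2 * Real.pi * Complex.I) = n := by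
    intro x hx
    obtain ⟨n, hn⟩ := Complex.exp_eq_exp_iff_exists_int.1 (hexp x hx)
    refine ⟨n, ?_⟩
    rw [div_eq_iff Complex.two_pi_I_ne_zero, hn]
    ring
  have hpi := Complex.two_pi_I_ne_zero
  have hc : ContinuousOn (fun x => ((g x - h x) / (2 * Real.pi * Complex.I)).re) S :=
    Complex.continuous_re.comp_continuousOn ((hg.sub hh).div_const _)
  obtain ⟨n, hn⟩ := hint x hx
  obtain ⟨m, hm⟩ := hint y hy
  have hconn := (hS.image _ hc).ordConnected
  have hnm : n = m := by
    by_contra hne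
    have key : ∀ n m : ℤ, n < m → (n : ℝ) ∈ (fun x => ((g x - h x) /
        (2 * Real.pi * Complex.I)).re) '' S → (m : ℝ) ∈ (fun x => ((g x - h x) /
        (2 * Real.pi * Complex.I)).re) '' S → False := by
      intro n m hnm h1 h2
      have hle : (n : ℝ) + 1 ≤ m := by exact_mod_cast hnm
      obtain ⟨w, hw, hw2⟩ := hconn.out h1 h2
        (show (n : ℝ) + 1 / 2 ∈ Icc (n : ℝ) m from ⟨by linarith, by linarith⟩)
      obtain ⟨k, hk⟩ := hint w hw
      simp only [hk, Complex.intCast_re] at hw2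
      have h3 : (2 * k : ℝ) = 2 * n + 1 := by linarith
      have h4 : 2 * k = 2 * n + 1 := by exact_mod_cast h3
      omega
    have h1 : (n : ℝ) ∈ (fun x => ((g x - h x) / (2 * Real.pi * Complex.I)).re) '' S :=
      ⟨x, hx, by simp [hn]⟩
    have h2 : (m : ℝ) ∈ (fun x => ((g x - h x) / (2 * Real.pi * Complex.I)).re) '' S :=
      ⟨y, hy, by simp [hm]⟩
    rcases lt_or_gt_of_ne hne with h | h
    · exact key n m h h1 h2
    · exact key m n h h2 h1
  rw [div_eq_iff hpi] at hn hm
  rw [hn, hm, hnm]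

theorem not_hasLog_sphere (p : ℂ) {R : ℝ} (hR : 0 < R) :
    ¬ HasLog (Metric.sphere p R) fun z => z - p := by
  rintro ⟨g, hg, hgf⟩
  have hmem : ∀ t : ℝ, circleMap p R t ∈ Metric.sphere p R := fun t =>
    circleMap_mem_sphere p hR.le t
  have h1 := eqOn_sub_of_exp_eq (S := univ) isPreconnected_univ
    (g := fun t : ℝ => g (circleMap p R t))
    (h := fun t : ℝ => Complex.log R + t * Complex.I)
    (hg.comp (by fun_prop) fun t _ => hmem t)
    (by fun_prop) (fun t _ => by
      rw [hgf _ (hmem t), Complex.exp_add, Complex.exp_log (by exact_mod_cast hR.ne')]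
      simp [circleMap]) (mem_univ 0) (mem_univ (2 * Real.pi))
  have h2 : circleMap p R (2 * Real.pi) = circleMap p R 0 := by
    simp [circleMap]
  simp only [h2] at h1
  have h3 : (2 * Real.pi * Complex.I : ℂ) = 0 := by
    push_cast at h1
    linear_combination h1
  exact Complex.two_pi_I_ne_zero h3

/-- If `p` and `q` lie in the same connected subset of the complement of a closed set `K`, then
`(z - p) / (z - q)` has a continuous logarithm on `K`. -/
theorem hasLog_div_of_isPreconnected {K C : Set ℂ} (hK : IsClosed K) (hC : IsPreconnected C)
    (hCK : C ⊆ Kᶜ) {p q : ℂ} (hp : p ∈ C) (hq : q ∈ C) :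
    HasLog K fun z => (z - p) / (z - q) := by
  have hne : ∀ z ∈ K, ∀ p ∈ C, z - p ≠ 0 := fun z hz p hp h =>
    hCK hp (by rwa [sub_eq_zero.1 h] at hz)
  refine hC.induction₂ (fun p q => HasLog K fun z => (z - p) / (z - q)) ?_ ?_ ?_ hp hq
  · intro x hx
    obtain ⟨ε, hε, hεK⟩ := Metric.isOpen_iff.1 hK.isOpen_compl x (hCK hx)
    filter_upwards [mem_nhdsWithin_of_mem_nhds (Metric.ball_mem_nhds x hε), self_mem_nhdsWithin]
      with y hy hyC
    have : HasLog K fun z => (z - y) / (z - x) := by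
      refine HasLog.of_slitPlane (ContinuousOn.div (by fun_prop) (by fun_prop)
        fun z hz => hne z hz x hx) fun z hz => ?_
      have hzx : ε ≤ ‖z - x‖ := by
        by_contra h
        exact hεK (mem_ball_iff_norm.2 (not_le.1 h)) hz
      have heq : (z - y) / (z - x) = 1 + -((y - x) / (z - x)) := by
        field_simp [hne z hz x hx]
        ring
      rw [heq]
      refine Complex.mem_slitPlane_of_norm_lt_one ?_
      rw [norm_neg, norm_div, div_lt_one (hε.trans_le hzx)]
      exact (mem_ball_iff_norm.1 hy).trans_le hzx
    exact this.inv.congr fun z hz => by rw [inv_div]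
  · intro x y z hx hy hz hxy hyz
    exact (hxy.mul hyz).congr fun w hw => by
      rw [div_mul_div_cancel₀ (hne w hw y hy)]
  · intro x y hx hy hxy
    exact hxy.inv.congr fun w hw => by rw [inv_div]

/-- Points far away from a bounded set. -/
theorem hasLog_sub_of_norm_lt {K : Set ℂ} {q : ℂ} (hq : ∀ z ∈ K, ‖z‖ < ‖q‖) :
    HasLog K fun z => z - q := by
  have h1 : HasLog K fun z => 1 + -(z / q) := by
    refine HasLog.of_slitPlane (by fun_prop) fun z hz => Complex.mem_slitPlane_of_norm_lt_one ?_
    have := hq z hz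
    rw [norm_neg, norm_div, div_lt_one ((norm_nonneg _).trans_lt this)]
    exact this
  by_cases hq0 : q = 0
  · refine h1.congr fun z hz => ?_
    have := hq z hz
    rw [hq0, norm_zero] at this
    exact absurd this (norm_nonneg _).not_gt
  · exact ((HasLog.const (neg_ne_zero.2 hq0)).mul h1).congr fun z _ => by field_simp; ring

theorem hasLog_sub_of_unbounded {K C : Set ℂ} (hK : IsCompact K) (hC : IsPreconnected C)
    (hCK : C ⊆ Kᶜ) (hub : ¬ Bornology.IsBounded C) {p : ℂ} (hp : p ∈ C) :
    HasLog K fun z => z - p := by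
  obtain ⟨R, hR⟩ := hK.isBounded.exists_norm_le
  obtain ⟨q, hq, hqR⟩ : ∃ q ∈ C, R < ‖q‖ := by
    by_contra! h
    exact hub (isBounded_iff_forall_norm_le.2 ⟨R, h⟩)
  refine ((hasLog_div_of_isPreconnected hK.isClosed hC hCK hp hq).mul
    (hasLog_sub_of_norm_lt fun z hz => (hR z hz).trans_lt hqR)).congr fun z hz => ?_
  rw [div_mul_cancel₀]
  intro h
  exact hCK hq (by rwa [sub_eq_zero.1 h] at hz)

theorem not_hasLog_frontier {U : Set ℂ} (hb : Bornology.IsBounded U) {p : ℂ}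
    (hp : p ∈ U) : ¬ HasLog (frontier U) fun z => z - p := by
  classical
  rintro ⟨g, hg, hgf⟩
  obtain ⟨G, hG⟩ := ContinuousMap.exists_restrict_eq (isClosed_frontier (s := U))
    ⟨(frontier U).domRestrict g, continuousOn_iff_continuous_domRestrict.1 hg⟩
  have hGg : ∀ z ∈ frontier U, G z = g z := fun z hz => congrArg (fun f => f ⟨z, hz⟩) hG
  let F : ℂ → ℂ := fun z => if z ∈ closure U then Complex.exp (G z) else z - p
  have hF : Continuous F := by
    refine Continuous.if (fun z hz => ?_) (by fun_prop) (by fun_prop)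
    have hz' : z ∈ frontier U := frontier_closure_subset hz
    rw [hGg z hz', hgf z hz']
  have hF0 : ∀ z, F z ≠ 0 := by
    intro z
    by_cases hz : z ∈ closure U
    · simp only [F, if_pos hz]
      exact Complex.exp_ne_zero _
    · simp only [F, if_neg hz]
      exact sub_ne_zero.2 fun h => hz (h ▸ subset_closure hp)
  obtain ⟨L, hL, hLF⟩ := exists_continuous_log hF hF0
  obtain ⟨R, hR⟩ := (hb.closure.union (Bornology.isBounded_singleton (x := p))).subset_ball p
  have hR0 : 0 < R := by simpa using hR (Or.inr rfl)
  refine not_hasLog_sphere p hR0 ⟨L, hL.continuousOn, fun z hz => ?_⟩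
  have : z ∉ closure U := fun h => by
    have h1 := hR (Or.inl h)
    rw [Metric.mem_ball, Metric.mem_sphere.1 hz] at h1
    exact lt_irrefl _ h1
  rw [hLF]
  simp only [F, if_neg this]

theorem frontier_connectedComponentIn_subset {K : Set ℂ} (hK : IsClosed K) (p : ℂ) :
    frontier (connectedComponentIn Kᶜ p) ⊆ K := by
  intro z hz
  by_contra hzK
  have hop : IsOpen (connectedComponentIn Kᶜ z) := hK.isOpen_compl.connectedComponentIn
  have hz1 : z ∈ connectedComponentIn Kᶜ z := mem_connectedComponentIn hzK
  have hop' : IsOpen (connectedComponentIn Kᶜ p) := hK.isOpen_compl.connectedComponentIn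
  rw [hop'.frontier_eq] at hz
  obtain ⟨w, hw1, hw2⟩ := mem_closure_iff.1 hz.1 _ hop hz1
  have h : connectedComponentIn Kᶜ p = connectedComponentIn Kᶜ z :=
    (connectedComponentIn_eq hw2).trans (connectedComponentIn_eq hw1).symm
  exact hz.2 (h ▸ hz1)

theorem not_isBounded_component_of_hasLog {K : Set ℂ} (hK : IsClosed K) {p : ℂ} (hp : p ∉ K)
    (h : HasLog K fun z => z - p) : ¬ Bornology.IsBounded (connectedComponentIn Kᶜ p) := fun hb =>
  not_hasLog_frontier hb (mem_connectedComponentIn hp)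
    (h.mono (frontier_connectedComponentIn_subset hK p))

end Logarithms

section Poisson

open Metric Real

/-- The Poisson integral of `f` over the circle with centre `c` and radius `r`. -/
noncomputable def poisInt (f : ℂ → ℝ) (c : ℂ) (r : ℝ) (w : ℂ) : ℝ :=
  circleAverage (fun z => poissonKernel c w z * f z) c r

theorem continuousOn_poissonKernel {c w : ℂ} {r : ℝ} (hr : 0 ≤ r) (hw : w ∈ ball c r) :
    ContinuousOn (poissonKernel c w) (sphere c r) := by
  rw [poissonKernel_eq_re_herglotzRieszKernel]
  have := continuousOn_herglotzRieszKernel_sphere hw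
  rw [abs_of_nonneg hr] at this
  exact Complex.continuous_re.comp_continuousOn this

theorem circleIntegrable_poissonKernel_mul {f : ℂ → ℝ} {c w : ℂ} {r : ℝ}
    (hw : w ∈ ball c r) (hf : CircleIntegrable f c r) :
    CircleIntegrable (fun z => poissonKernel c w z * f z) c r := by
  have hr : 0 ≤ r := (pos_of_mem_ball hw).le
  have h := continuousOn_poissonKernel hr hw
  rw [← abs_of_nonneg hr] at h
  exact hf.continuousOn_smul h

theorem poissonKernel_nonneg {c w z : ℂ} {r : ℝ} (hw : w ∈ ball c r) (hz : z ∈ sphere c r) :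
    0 ≤ poissonKernel c w z := by
  have h1 : ‖w - c‖ < r := mem_ball_iff_norm.1 hw
  have h2 : ‖z - c‖ = r := mem_sphere_iff_norm.1 hz
  rw [poissonKernel_def, h2]
  have := norm_nonneg (w - c)
  have : 0 ≤ r ^ 2 - ‖w - c‖ ^ 2 := by nlinarith
  positivity

theorem poissonKernel_le {c w z : ℂ} {r : ℝ} (hw : w ∈ ball c r) (hz : z ∈ sphere c r) :
    poissonKernel c w z ≤ (r + ‖w - c‖) / (r - ‖w - c‖) := by
  rw [poissonKernel_eq_re_herglotzRieszKernel]
  exact re_herglotzRieszKernel_le hz hw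

theorem poisInt_re {G : ℂ → ℂ} {c w : ℂ} {r : ℝ} (hw : w ∈ ball c r)
    (hG : DiffContOnCl ℂ G (ball c r)) : poisInt (fun z => (G z).re) c r w = (G w).re := by
  have hr := pos_of_mem_ball hw
  rw [← hG.circleAverage_poissonKernel_smul hw, ← Complex.reCLM_apply,
    ← Complex.reCLM.circleAverage_comp_comm]
  · refine congrArg (fun F => circleAverage F c r) (funext fun z => ?_)
    simp
  · have h1 : ContinuousOn G (sphere c |r|) := by
      rw [abs_of_pos hr]
      exact hG.continuousOn.mono (by rw [closure_ball c hr.ne']; exact sphere_subset_closedBall)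
    have h2 := continuousOn_poissonKernel hr.le hw
    rw [← abs_of_pos hr] at h2
    exact (h1.circleIntegrable').continuousOn_smul h2

theorem poisInt_const {a : ℝ} {c w : ℂ} {r : ℝ} (hw : w ∈ ball c r) :
    poisInt (fun _ => a) c r w = a := by
  simpa using poisInt_re (G := fun _ => (a : ℂ)) hw diffContOnCl_const

theorem poisInt_mono {f g : ℂ → ℝ} {c w : ℂ} {r : ℝ} (hw : w ∈ ball c r)
    (hf : CircleIntegrable f c r) (hg : CircleIntegrable g c r)
    (hfg : ∀ z ∈ sphere c r, f z ≤ g z) : poisInt f c r w ≤ poisInt g c r w := by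
  have hr := pos_of_mem_ball hw
  refine circleAverage_mono (circleIntegrable_poissonKernel_mul hw hf)
    (circleIntegrable_poissonKernel_mul hw hg) fun z hz => ?_
  rw [abs_of_pos hr] at hz
  exact mul_le_mul_of_nonneg_left (hfg z hz) (poissonKernel_nonneg hw hz)

theorem poisInt_add {f g : ℂ → ℝ} {c w : ℂ} {r : ℝ} (hw : w ∈ ball c r)
    (hf : CircleIntegrable f c r) (hg : CircleIntegrable g c r) :
    poisInt (fun z => f z + g z) c r w = poisInt f c r w + poisInt g c r w := by
  simp only [poisInt, mul_add]
  exact circleAverage_fun_add (circleIntegrable_poissonKernel_mul hw hf)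
    (circleIntegrable_poissonKernel_mul hw hg)

theorem poisInt_const_mul {f : ℂ → ℝ} {c w : ℂ} {r : ℝ} (a : ℝ) :
    poisInt (fun z => a * f z) c r w = a * poisInt f c r w := by
  rw [poisInt, poisInt, ← smul_eq_mul, ← circleAverage_fun_smul]
  congr 1
  ext z
  simp only [smul_eq_mul]
  ring

/-- The Poisson integral is the real part of a holomorphic function. -/
theorem exists_re_eq_poisInt {f : ℂ → ℝ} {c : ℂ} {r : ℝ} (hf : CircleIntegrable f c r) :
    ∃ F : ℂ → ℂ, DifferentiableOn ℂ F (ball c r) ∧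
      ∀ w ∈ ball c r, poisInt f c r w = (F w).re := by
  let g : ℂ → ℝ := fun z => f (z + c)
  have hg : CircleIntegrable g 0 r := by
    have : (fun θ => g (circleMap 0 r θ)) = fun θ => f (circleMap c r θ) := by
      ext θ
      simp only [g, circleMap]
      congr 1
      ring
    rw [CircleIntegrable, this]
    exact hf
  have hgc : CircleIntegrable (fun ζ ↦ (g ζ : ℂ)) 0 r := by
    simp only [CircleIntegrable, intervalIntegrable_iff] at hg ⊢
    exact Complex.ofRealCLM.integrable_comp hg
  refine ⟨fun w => circleAverage (fun ζ ↦ herglotzRieszKernel 0 (w - c) ζ • (g ζ : ℂ)) 0 r,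
    (differentiableOn_circleAverage_herglotzRieszKernel_smul hgc).comp (by fun_prop) ?_, ?_⟩
  · intro w hw
    simpa [dist_eq_norm] using hw
  · intro w hw
    have hw' : w - c ∈ ball (0 : ℂ) r := by simpa [dist_eq_norm] using hw
    rw [re_circleAverage_herglotzRieszKernel_smul hg hw', poisInt, ← circleAverage_map_add_const]
    congr 1
    ext z
    simp only [poissonKernel_eq_re_herglotzRieszKernel, Function.comp_apply,
      herglotzRieszKernel_add_const, g]
    rfl

theorem continuousOn_poisInt {f : ℂ → ℝ} {c : ℂ} {r : ℝ} (hf : CircleIntegrable f c r) :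
    ContinuousOn (poisInt f c r) (ball c r) := by
  obtain ⟨F, hF, hFf⟩ := exists_re_eq_poisInt hf
  exact (Complex.continuous_re.comp_continuousOn hF.continuousOn).congr hFf

open Classical in
/-- Replace a function on a disc by the Poisson integral of its boundary values. -/
noncomputable def poisMod (f : ℂ → ℝ) (c : ℂ) (r : ℝ) (w : ℂ) : ℝ :=
  if w ∈ ball c r then poisInt f c r w else f w

theorem poisMod_of_mem {f : ℂ → ℝ} {c w : ℂ} {r : ℝ} (hw : w ∈ ball c r) :
    poisMod f c r w = poisInt f c r w := if_pos hw

theorem poisMod_of_notMem {f : ℂ → ℝ} {c w : ℂ} {r : ℝ} (hw : w ∉ ball c r) :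
    poisMod f c r w = f w := if_neg hw

theorem circleIntegrable_of_continuousOn {f : ℂ → ℝ} {c : ℂ} {r : ℝ} (hr : 0 ≤ r)
    (hf : ContinuousOn f (sphere c r)) : CircleIntegrable f c r := by
  rw [← abs_of_nonneg hr] at hf
  exact hf.circleIntegrable'

theorem tendsto_poisInt {f : ℂ → ℝ} {c ζ : ℂ} {r : ℝ} (hr : 0 < r)
    (hf : ContinuousOn f (sphere c r)) (hζ : ζ ∈ sphere c r) :
    Tendsto (poisInt f c r) (𝓝[ball c r] ζ) (𝓝 (f ζ)) := by
  have hfi := circleIntegrable_of_continuousOn hr.le hf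
  obtain ⟨M, hM⟩ := (isCompact_sphere c r).exists_bound_of_continuousOn hf
  have hM0 : 0 ≤ M := (norm_nonneg _).trans (hM ζ hζ)
  let q : ℂ → ℂ := fun z => ((2 * r ^ 2 : ℝ) : ℂ) - 2 * ((z - c) * (starRingEnd ℂ) (ζ - c))
  have hζr : Complex.normSq (ζ - c) = r ^ 2 := by
    rw [Complex.normSq_eq_norm_sq, mem_sphere_iff_norm.1 hζ]
  have hq : ∀ z ∈ sphere c r, (q z).re = ‖z - ζ‖ ^ 2 := by
    intro z hz
    have h1 : Complex.normSq (z - c) = r ^ 2 := by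
      rw [Complex.normSq_eq_norm_sq, mem_sphere_iff_norm.1 hz]
    have h2 : z - ζ = (z - c) - (ζ - c) := by ring
    rw [h2, ← Complex.normSq_eq_norm_sq, Complex.normSq_sub, h1, hζr]
    simp only [q, Complex.sub_re, Complex.ofReal_re, Complex.mul_re, Complex.re_ofNat,
      Complex.im_ofNat]
    ring
  have hqζ : (q ζ).re = 0 := by rw [hq ζ hζ]; simp
  have hqc : Continuous fun z => (q z).re := by fun_prop
  have hqd : DiffContOnCl ℂ q (ball c r) := by
    apply Differentiable.diffContOnCl
    fun_prop
  have hqi : CircleIntegrable (fun z => (q z).re) c r :=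
    circleIntegrable_of_continuousOn hr.le hqc.continuousOn
  rw [Metric.tendsto_nhds]
  intro ε hε
  obtain ⟨δ, hδ, hfδ⟩ := Metric.continuousOn_iff.1 hf ζ hζ (ε / 2) (half_pos hε)
  have hC : 0 ≤ 2 * M / δ ^ 2 := by positivity
  have hbound : ∀ z ∈ sphere c r, |f z - f ζ| ≤ ε / 2 + 2 * M / δ ^ 2 * (q z).re := by
    intro z hz
    rw [hq z hz]
    by_cases h : dist z ζ < δ
    · have := hfδ z hz h
      rw [Real.dist_eq] at this
      have h3 : 0 ≤ 2 * M / δ ^ 2 * ‖z - ζ‖ ^ 2 := by positivity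
      linarith
    · rw [not_lt, dist_eq_norm] at h
      have h3 : 2 * M ≤ 2 * M / δ ^ 2 * ‖z - ζ‖ ^ 2 := by
        rw [div_mul_eq_mul_div, le_div_iff₀ (by positivity)]
        gcongr
      have h4 := abs_sub (f z) (f ζ)
      have h5 := hM z hz
      have h6 := hM ζ hζ
      rw [Real.norm_eq_abs] at h5 h6
      linarith
  have hlim : Tendsto (fun w => 2 * M / δ ^ 2 * (q w).re) (𝓝[ball c r] ζ) (𝓝 0) := by
    have : Tendsto (fun w => 2 * M / δ ^ 2 * (q w).re) (𝓝 ζ) (𝓝 (2 * M / δ ^ 2 * (q ζ).re)) :=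
      (continuous_const.mul hqc).tendsto ζ
    rw [hqζ, mul_zero] at this
    exact this.mono_left nhdsWithin_le_nhds
  filter_upwards [hlim.eventually (gt_mem_nhds (half_pos hε)), self_mem_nhdsWithin] with w hw hwb
  have hP : poisInt (fun z => 2 * M / δ ^ 2 * (q z).re) c r w = 2 * M / δ ^ 2 * (q w).re := by
    rw [poisInt_const_mul, poisInt_re hwb hqd]
  have hi : CircleIntegrable (fun z => 2 * M / δ ^ 2 * (q z).re) c r :=
    circleIntegrable_of_continuousOn hr.le (hqc.const_mul _).continuousOn
  have hup : poisInt f c r w ≤ f ζ + ε / 2 + 2 * M / δ ^ 2 * (q w).re := by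
    have := poisInt_mono (g := fun z => (f ζ + ε / 2) + 2 * M / δ ^ 2 * (q z).re) hwb hfi
      ((circleIntegrable_const _ _ _).add hi)
      fun z hz => by have := (abs_le.1 (hbound z hz)).2; linarith
    rwa [poisInt_add hwb (circleIntegrable_const _ _ _) hi, poisInt_const hwb, hP] at this
  have hlo : f ζ - ε / 2 - 2 * M / δ ^ 2 * (q w).re ≤ poisInt f c r w := by
    have hi' : CircleIntegrable (fun z => -1 * (2 * M / δ ^ 2 * (q z).re)) c r :=
      circleIntegrable_of_continuousOn hr.le ((hqc.const_mul _).const_mul _).continuousOn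
    have := poisInt_mono (f := fun z => (f ζ - ε / 2) + -1 * (2 * M / δ ^ 2 * (q z).re)) hwb
      ((circleIntegrable_const _ _ _).add hi') hfi
      fun z hz => by have := (abs_le.1 (hbound z hz)).1; linarith
    rw [poisInt_add hwb (circleIntegrable_const _ _ _) hi', poisInt_const hwb,
      poisInt_const_mul, hP] at this
    linarith
  rw [Real.dist_eq, abs_lt]
  constructor <;> linarith

theorem continuousOn_poisMod {f : ℂ → ℝ} {c : ℂ} {r : ℝ} (hr : 0 < r) {S : Set ℂ}
    (hf : ContinuousOn f S) (hS : closedBall c r ⊆ S) : ContinuousOn (poisMod f c r) S := by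
  have hfs : ContinuousOn f (sphere c r) := hf.mono (sphere_subset_closedBall.trans hS)
  have hfi := circleIntegrable_of_continuousOn hr.le hfs
  intro z hz
  by_cases hzb : z ∈ ball c r
  · have h1 : ContinuousAt (poisInt f c r) z :=
      (continuousOn_poisInt hfi).continuousAt (isOpen_ball.mem_nhds hzb)
    refine (h1.congr ?_).continuousWithinAt
    filter_upwards [isOpen_ball.mem_nhds hzb] with w hw
    rw [poisMod_of_mem hw]
  · have hval := poisMod_of_notMem (f := f) hzb
    have h2 : Tendsto (poisMod f c r) (𝓝[S ∩ (ball c r)ᶜ] z) (𝓝 (f z)) := by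
      refine ((hf z hz).mono_left (nhdsWithin_mono z inter_subset_left)).congr' ?_
      filter_upwards [self_mem_nhdsWithin] with w hw
      rw [poisMod_of_notMem hw.2]
    have h3 : Tendsto (poisMod f c r) (𝓝[ball c r] z) (𝓝 (f z)) := by
      by_cases hzs : z ∈ closedBall c r
      · have hzs' : z ∈ sphere c r := by
          rw [mem_closedBall] at hzs
          rw [mem_ball, not_lt] at hzb
          exact le_antisymm hzs hzb
        refine (tendsto_poisInt hr hfs hzs').congr' ?_
        filter_upwards [self_mem_nhdsWithin] with w hw
        rw [poisMod_of_mem hw]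
      · have : 𝓝[ball c r] z = ⊥ := by
          rw [← notMem_closure_iff_nhdsWithin_eq_bot, closure_ball c hr.ne']
          exact hzs
        rw [this]
        exact tendsto_bot
    have h4 := h2.sup h3
    rw [← nhdsWithin_union] at h4
    rw [ContinuousWithinAt, hval]
    refine h4.mono_left (nhdsWithin_mono z fun w hw => ?_)
    by_cases hwb : w ∈ ball c r
    · exact Or.inr hwb
    · exact Or.inl ⟨hw, hwb⟩

end Poisson

section Subharmonic

open Metric Real

/-- `u` is, near `z`, the real part of a holomorphic function. -/
def HarmAt (u : ℂ → ℝ) (z : ℂ) : Prop :=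
  ∃ r > 0, ∃ F : ℂ → ℂ, DifferentiableOn ℂ F (ball z r) ∧ ∀ w ∈ ball z r, u w = (F w).re

/-- The submean value property on small circles. -/
def SubM (v : ℂ → ℝ) (z : ℂ) : Prop := ∀ᶠ r in 𝓝[>] (0 : ℝ), v z ≤ circleAverage v z r

theorem HarmAt.congr {u v : ℂ → ℝ} {z : ℂ} (hu : HarmAt u z) (h : v =ᶠ[𝓝 z] u) : HarmAt v z := by
  obtain ⟨r, hr, F, hF, hFu⟩ := hu
  obtain ⟨s, hs, hsub⟩ := Metric.eventually_nhds_iff_ball.1 h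
  refine ⟨min r s, lt_min hr hs, F, hF.mono (ball_subset_ball (min_le_left _ _)), fun w hw => ?_⟩
  rw [hsub w (ball_subset_ball (min_le_right _ _) hw),
    hFu w (ball_subset_ball (min_le_left _ _) hw)]

theorem harmAt_of_differentiableOn {F : ℂ → ℂ} {U : Set ℂ} (hU : IsOpen U)
    (hF : DifferentiableOn ℂ F U) {z : ℂ} (hz : z ∈ U) : HarmAt (fun w => (F w).re) z := by
  obtain ⟨r, hr, hrU⟩ := Metric.isOpen_iff.1 hU z hz
  exact ⟨r, hr, F, hF.mono hrU, fun _ _ => rfl⟩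

theorem HarmAt.add {u v : ℂ → ℝ} {z : ℂ} (hu : HarmAt u z) (hv : HarmAt v z) :
    HarmAt (fun w => u w + v w) z := by
  obtain ⟨r, hr, F, hF, hFu⟩ := hu
  obtain ⟨s, hs, G, hG, hGv⟩ := hv
  refine ⟨min r s, lt_min hr hs, fun w => F w + G w,
    (hF.mono (ball_subset_ball (min_le_left _ _))).add
      (hG.mono (ball_subset_ball (min_le_right _ _))), fun w hw => ?_⟩
  simp only [hFu w (ball_subset_ball (min_le_left _ _) hw),
    hGv w (ball_subset_ball (min_le_right _ _) hw), Complex.add_re]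

theorem HarmAt.const_mul {u : ℂ → ℝ} {z : ℂ} (hu : HarmAt u z) (a : ℝ) :
    HarmAt (fun w => a * u w) z := by
  obtain ⟨r, hr, F, hF, hFu⟩ := hu
  refine ⟨r, hr, fun w => a * F w, hF.const_mul _, fun w hw => ?_⟩
  simp only [hFu w hw, Complex.re_ofReal_mul]

theorem HarmAt.continuousAt {u : ℂ → ℝ} {z : ℂ} (hu : HarmAt u z) : ContinuousAt u z := by
  obtain ⟨r, hr, F, hF, hFu⟩ := hu
  have h1 : ContinuousAt (fun w => (F w).re) z := Complex.continuous_re.continuousAt.comp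
    (hF.continuousOn.continuousAt (ball_mem_nhds z hr))
  exact h1.congr ((eventually_of_mem (ball_mem_nhds z hr) hFu).mono fun _ h => h.symm)

theorem circleAverage_re {G : ℂ → ℂ} {c : ℂ} {r : ℝ} (hr : 0 < r)
    (hG : DiffContOnCl ℂ G (ball c r)) : circleAverage (fun z => (G z).re) c r = (G c).re := by
  have h := poisInt_re (mem_ball_self hr) hG
  rw [← h, poisInt]
  refine circleAverage_congr_sphere fun z hz => ?_
  rw [abs_of_pos hr, mem_sphere_iff_norm] at hz
  have : poissonKernel c c z = 1 := by
    rw [poissonKernel_def, hz]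
    simp only [sub_self, norm_zero, sub_zero]
    rw [hz]
    field_simp
    simp
  simp only [this, one_mul]

theorem HarmAt.circleAverage_eq {u : ℂ → ℝ} {z : ℂ} (hu : HarmAt u z) :
    ∀ᶠ r in 𝓝[>] (0 : ℝ), circleAverage u z r = u z := by
  obtain ⟨r, hr, F, hF, hFu⟩ := hu
  filter_upwards [Ioo_mem_nhdsGT hr] with s hs
  have hsub : closedBall z s ⊆ ball z r := closedBall_subset_ball hs.2
  have hG : DiffContOnCl ℂ F (ball z s) := by
    refine ⟨hF.mono (ball_subset_closedBall.trans hsub), ?_⟩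
    rw [closure_ball z hs.1.ne']
    exact hF.continuousOn.mono hsub
  rw [hFu z (mem_ball_self hr), ← circleAverage_re hs.1 hG]
  refine circleAverage_congr_sphere fun w hw => ?_
  rw [abs_of_pos hs.1] at hw
  exact hFu w (hsub (sphere_subset_closedBall hw))

theorem HarmAt.subM {u : ℂ → ℝ} {z : ℂ} (hu : HarmAt u z) : SubM u z :=
  hu.circleAverage_eq.mono fun _ h => h.ge

theorem eventually_sphere_subset {U : Set ℂ} {z : ℂ} (hU : U ∈ 𝓝 z) :
    ∀ᶠ r in 𝓝[>] (0 : ℝ), 0 < r ∧ sphere z r ⊆ U := by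
  obtain ⟨r, hr, hrU⟩ := Metric.mem_nhds_iff.1 hU
  filter_upwards [Ioo_mem_nhdsGT hr] with s hs
  exact ⟨hs.1, (sphere_subset_closedBall.trans (closedBall_subset_ball hs.2)).trans hrU⟩

theorem SubM.add {v w : ℂ → ℝ} {z : ℂ} (hv : SubM v z) (hw : SubM w z)
    {U : Set ℂ} (hU : U ∈ 𝓝 z) (hvc : ContinuousOn v U) (hwc : ContinuousOn w U) :
    SubM (fun x => v x + w x) z := by
  filter_upwards [hv, hw, eventually_sphere_subset hU] with r h1 h2 ⟨h3, h4⟩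
  rw [circleAverage_fun_add (circleIntegrable_of_continuousOn h3.le (hvc.mono h4))
    (circleIntegrable_of_continuousOn h3.le (hwc.mono h4))]
  exact add_le_add h1 h2

theorem SubM.mono {v w : ℂ → ℝ} {z : ℂ} (hv : SubM v z) {U : Set ℂ} (hU : U ∈ 𝓝 z)
    (hvc : ContinuousOn v U) (hwc : ContinuousOn w U) (hz : v z = w z)
    (h : ∀ x ∈ U, v x ≤ w x) : SubM w z := by
  filter_upwards [hv, eventually_sphere_subset hU] with r h1 ⟨h3, h4⟩
  rw [← hz]
  refine h1.trans (circleAverage_mono (circleIntegrable_of_continuousOn h3.le (hvc.mono h4))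
    (circleIntegrable_of_continuousOn h3.le (hwc.mono h4)) fun x hx => ?_)
  rw [abs_of_pos h3] at hx
  exact h x (h4 hx)

theorem le_of_subM_of_isCompact {L D : Set ℂ} (hL : IsCompact L) {v : ℂ → ℝ}
    (hv : ContinuousOn v L) (hD : ∀ z ∈ D, ∃ r > 0, sphere z r ⊆ L ∧ v z ≤ circleAverage v z r)
    {a : ℝ} (hbd : ∀ z ∈ L \ D, v z ≤ a) : ∀ z ∈ L, v z ≤ a := by
  obtain ⟨R, hR⟩ := hL.isBounded.exists_norm_le
  have key : ∀ ε > 0, ∀ z ∈ L, v z ≤ a + ε * R ^ 2 := by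
    intro ε hε z hz
    have hcont : ContinuousOn (fun z => v z + ε * ‖z‖ ^ 2) L := hv.add (by fun_prop)
    obtain ⟨m, hm, hmax⟩ := hL.exists_isMaxOn ⟨z, hz⟩ hcont
    by_cases hmD : m ∈ D
    · exfalso
      obtain ⟨r, hr, hrL, hle⟩ := hD m hmD
      let F : ℂ → ℂ := fun w => ((ε * (r ^ 2 + ‖m‖ ^ 2) : ℝ) : ℂ)
        + (2 * ε : ℝ) * ((starRingEnd ℂ) m * (w - m))
      have hF : DiffContOnCl ℂ F (ball m r) := by
        apply Differentiable.diffContOnCl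
        fun_prop
      have hFs : ∀ w ∈ sphere m r, (F w).re = ε * ‖w‖ ^ 2 := by
        intro w hw
        rw [mem_sphere_iff_norm] at hw
        have h1 : ‖w‖ ^ 2 = ‖w - m‖ ^ 2 + ‖m‖ ^ 2 + 2 * ((starRingEnd ℂ) m * (w - m)).re := by
          simp only [← Complex.normSq_eq_norm_sq, Complex.normSq_apply, Complex.mul_re,
            Complex.conj_re, Complex.conj_im, Complex.sub_re, Complex.sub_im]
          ring
        rw [h1, hw]
        simp only [F, Complex.add_re, Complex.ofReal_re, Complex.re_ofReal_mul]
        ring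
      have hFm : (F m).re = ε * (r ^ 2 + ‖m‖ ^ 2) := by
        simp only [F, sub_self, mul_zero, add_zero, Complex.ofReal_re]
      have hav := circleAverage_re hr hF
      have hvi := circleIntegrable_of_continuousOn hr.le (hv.mono hrL)
      have hFi : CircleIntegrable (fun z => (F z).re) m r :=
        circleIntegrable_of_continuousOn hr.le (by fun_prop)
      have h2 : circleAverage (fun z => v z + (F z).re) m r ≤ v m + ε * ‖m‖ ^ 2 := by
        rw [← circleAverage_const (v m + ε * ‖m‖ ^ 2) m r]
        refine circleAverage_mono (hvi.add hFi) (circleIntegrable_const _ _ _) fun w hw => ?_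
        rw [abs_of_pos hr] at hw
        rw [hFs w hw]
        exact hmax (hrL hw)
      rw [circleAverage_fun_add hvi hFi, hav, hFm] at h2
      have : 0 < ε * r ^ 2 := by positivity
      linarith
    · have h1 := hbd m ⟨hm, hmD⟩
      have h2 : v z + ε * ‖z‖ ^ 2 ≤ v m + ε * ‖m‖ ^ 2 := hmax hz
      have h3 : ε * ‖m‖ ^ 2 ≤ ε * R ^ 2 := by
        gcongr
        exact hR m hm
      have h4 : 0 ≤ ε * ‖z‖ ^ 2 := by positivity
      linarith
  intro z hz
  have hlim : Tendsto (fun ε : ℝ => a + ε * R ^ 2) (𝓝[>] 0) (𝓝 (a + 0 * R ^ 2)) :=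
    ((continuous_const.add (continuous_id.mul continuous_const)).tendsto 0).mono_left
      nhdsWithin_le_nhds
  rw [zero_mul, add_zero] at hlim
  exact ge_of_tendsto hlim (eventually_mem_nhdsWithin.mono fun ε hε => key ε hε z hz)

/-- The maximum principle for subharmonic functions on a bounded open set. -/
theorem le_of_subM {U : Set ℂ} (hU : IsOpen U) (hb : Bornology.IsBounded U) {v : ℂ → ℝ}
    (hv : ContinuousOn v (closure U)) (hs : ∀ z ∈ U, SubM v z) {a : ℝ}
    (hbd : ∀ z ∈ frontier U, v z ≤ a) : ∀ z ∈ closure U, v z ≤ a := by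
  refine le_of_subM_of_isCompact hb.isCompact_closure hv (D := U) (fun z hz => ?_) ?_
  · obtain ⟨r, h1, h2, h3⟩ := ((hs z hz).and (eventually_sphere_subset (hU.mem_nhds hz))).exists
    exact ⟨r, h2, h3.trans subset_closure, h1⟩
  · intro z hz
    rw [← hU.frontier_eq] at hz
    exact hbd z hz

theorem harmAt_poisInt {f : ℂ → ℝ} {c w : ℂ} {r : ℝ} (hf : CircleIntegrable f c r)
    (hw : w ∈ ball c r) : HarmAt (poisInt f c r) w := by
  obtain ⟨F, hF, hFf⟩ := exists_re_eq_poisInt hf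
  exact (harmAt_of_differentiableOn isOpen_ball hF hw).congr
    (eventually_of_mem (isOpen_ball.mem_nhds hw) hFf)

theorem harmAt_poisMod {f : ℂ → ℝ} {c w : ℂ} {r : ℝ} (hf : CircleIntegrable f c r)
    (hw : w ∈ ball c r) : HarmAt (poisMod f c r) w :=
  (harmAt_poisInt hf hw).congr
    (eventually_of_mem (isOpen_ball.mem_nhds hw) fun _ h => poisMod_of_mem h)

theorem le_poisMod_of_subM {v : ℂ → ℝ} {c : ℂ} {r : ℝ} (hr : 0 < r)
    (hv : ContinuousOn v (closedBall c r)) (hs : ∀ z ∈ ball c r, SubM v z) (w : ℂ) :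
    v w ≤ poisMod v c r w := by
  by_cases hw : w ∈ ball c r
  swap
  · rw [poisMod_of_notMem hw]
  have hfi := circleIntegrable_of_continuousOn hr.le (hv.mono sphere_subset_closedBall)
  have hc := continuousOn_poisMod hr hv Subset.rfl
  have hc' : ContinuousOn (fun z => -1 * poisMod v c r z) (closedBall c r) := hc.const_mul _
  have h := le_of_subM (U := ball c r) isOpen_ball isBounded_ball
    (v := fun z => v z + -1 * poisMod v c r z) (a := 0)
    (by rw [closure_ball c hr.ne']; exact hv.add hc')
    (fun z hz => (hs z hz).add ((harmAt_poisMod hfi hz).const_mul _).subM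
      (isOpen_ball.mem_nhds hz) (hv.mono ball_subset_closedBall)
      (hc'.mono ball_subset_closedBall)) ?_ w (subset_closure hw)
  · linarith
  · intro z hz
    rw [frontier_ball c hr.ne'] at hz
    rw [poisMod_of_notMem]
    · simp
    · simp only [mem_ball, not_lt]
      exact hz.ge

theorem subM_poisMod {v : ℂ → ℝ} {c : ℂ} {r : ℝ} (hr : 0 < r) {U : Set ℂ} (hU : IsOpen U)
    (hcU : closedBall c r ⊆ U) (hv : ContinuousOn v U) (hs : ∀ z ∈ U, SubM v z) :
    ∀ z ∈ U, SubM (poisMod v c r) z := by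
  intro z hz
  by_cases hzb : z ∈ ball c r
  · exact (harmAt_poisMod (circleIntegrable_of_continuousOn hr.le
      (hv.mono (sphere_subset_closedBall.trans hcU))) hzb).subM
  · exact (hs z hz).mono (hU.mem_nhds hz) hv (continuousOn_poisMod hr hv hcU)
      (poisMod_of_notMem hzb).symm fun w _ => le_poisMod_of_subM hr (hv.mono hcU)
        (fun x hx => hs x (hcU (ball_subset_closedBall hx))) w

theorem HarmAt.eq_poisInt {u : ℂ → ℝ} {c : ℂ} {r : ℝ} (hr : 0 < r)
    (hu : ContinuousOn u (closedBall c r)) (hs : ∀ z ∈ ball c r, HarmAt u z) :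
    ∀ w ∈ ball c r, u w = poisInt u c r w := by
  intro w hw
  apply le_antisymm
  · rw [← poisMod_of_mem hw]
    exact le_poisMod_of_subM hr hu (fun z hz => (hs z hz).subM) w
  · have h := le_poisMod_of_subM hr (v := fun z => -1 * u z) (hu.const_mul _)
      (fun z hz => ((hs z hz).const_mul _).subM) w
    rw [poisMod_of_mem hw, poisInt_const_mul] at h
    linarith

/-- The maximum principle for the difference of two harmonic functions. -/
theorem HarmAt.abs_sub_le {U : Set ℂ} (hU : IsOpen U) (hb : Bornology.IsBounded U) {u v : ℂ → ℝ}
    (hu : ContinuousOn u (closure U)) (hv : ContinuousOn v (closure U))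
    (hus : ∀ z ∈ U, HarmAt u z) (hvs : ∀ z ∈ U, HarmAt v z) {a : ℝ}
    (hbd : ∀ z ∈ frontier U, |u z - v z| ≤ a) : ∀ z ∈ closure U, |u z - v z| ≤ a := by
  intro z hz
  have h1 := le_of_subM hU hb (v := fun z => u z + -1 * v z) (hu.add (hv.const_mul _))
    (fun z hz => ((hus z hz).add ((hvs z hz).const_mul _)).subM) (a := a)
    (fun z hz => by have := (abs_le.1 (hbd z hz)).2; linarith) z hz
  have h2 := le_of_subM hU hb (v := fun z => v z + -1 * u z) (hv.add (hu.const_mul _))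
    (fun z hz => ((hvs z hz).add ((hus z hz).const_mul _)).subM) (a := a)
    (fun z hz => by have := (abs_le.1 (hbd z hz)).1; linarith) z hz
  rw [abs_le]
  constructor <;> linarith

end Subharmonic

section Balayage

open Metric Real

theorem exists_seq_balls {U : Set ℂ} (hU : IsOpen U) (hne : U.Nonempty) :
    ∃ (c : ℕ → ℂ) (r : ℕ → ℝ), (∀ k, 0 < r k) ∧ (∀ k, closedBall (c k) (r k) ⊆ U) ∧
      ∀ z ∈ U, ∃ k, z ∈ ball (c k) (r k) := by
  have h : ∀ z ∈ U, ∃ r > 0, closedBall z r ⊆ U := fun z hz =>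
    nhds_basis_closedBall.mem_iff.1 (hU.mem_nhds hz)
  choose! ρ hρ hρU using h
  obtain ⟨t, htU, htc, ht⟩ := TopologicalSpace.countable_cover_nhdsWithin
    (f := fun z => ball z (ρ z)) (s := U)
    fun z hz => mem_nhdsWithin_of_mem_nhds (ball_mem_nhds z (hρ z hz))
  have htn : t.Nonempty := by
    obtain ⟨z, hz⟩ := hne
    obtain ⟨x, hx, -⟩ := mem_iUnion₂.1 (ht hz)
    exact ⟨x, hx⟩
  obtain ⟨c, rfl⟩ := htc.exists_eq_range htn
  refine ⟨c, fun k => ρ (c k), fun k => hρ _ (htU (mem_range_self k)),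
    fun k => hρU _ (htU (mem_range_self k)), fun z hz => ?_⟩
  obtain ⟨x, ⟨k, rfl⟩, hx⟩ := mem_iUnion₂.1 (ht hz)
  exact ⟨k, hx⟩

theorem circleIntegrable_of_tendsto {v : ℕ → ℂ → ℝ} {u : ℂ → ℝ} {c : ℂ} {r M : ℝ} (hr : 0 ≤ r)
    (hv : ∀ n, CircleIntegrable (v n) c r) (hM : ∀ n, ∀ z ∈ sphere c r, |v n z| ≤ M)
    (hlim : ∀ z ∈ sphere c r, Tendsto (fun n => v n z) atTop (𝓝 (u z))) :
    CircleIntegrable u c r := by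
  have hmem := fun θ => circleMap_mem_sphere c hr θ
  refine IntervalIntegrable.mono_fun (g := fun θ => u (circleMap c r θ))
    (intervalIntegrable_const (c := M)) ?_ ?_
  · exact aestronglyMeasurable_of_tendsto_ae atTop
      (fun n => (hv n).aestronglyMeasurable_restrict_uIoc)
      (Eventually.of_forall fun θ => hlim _ (hmem θ))
  · refine Eventually.of_forall fun θ => ?_
    have : |u (circleMap c r θ)| ≤ M :=
      le_of_tendsto (hlim _ (hmem θ)).abs (Eventually.of_forall fun n => hM n _ (hmem θ))
    exact this.trans (le_abs_self M)

theorem tendsto_poisInt_of_tendsto {v : ℕ → ℂ → ℝ} {u : ℂ → ℝ} {c w : ℂ} {r M : ℝ}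
    (hw : w ∈ ball c r)
    (hv : ∀ n, CircleIntegrable (v n) c r) (hM : ∀ n, ∀ z ∈ sphere c r, |v n z| ≤ M)
    (hlim : ∀ z ∈ sphere c r, Tendsto (fun n => v n z) atTop (𝓝 (u z))) :
    Tendsto (fun n => poisInt (v n) c r w) atTop (𝓝 (poisInt u c r w)) := by
  have hr := pos_of_mem_ball hw
  have hmem := fun θ => circleMap_mem_sphere c hr.le θ
  simp only [poisInt, circleAverage]
  refine Tendsto.const_smul ?_ _
  refine intervalIntegral.tendsto_integral_filter_of_dominated_convergence
    (fun _ => (r + ‖w - c‖) / (r - ‖w - c‖) * M) ?_ ?_ intervalIntegrable_const ?_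
  · exact Eventually.of_forall fun n =>
      (circleIntegrable_poissonKernel_mul hw (hv n)).aestronglyMeasurable_restrict_uIoc
  · refine Eventually.of_forall fun n => Eventually.of_forall fun θ _ => ?_
    have h1 := poissonKernel_nonneg hw (hmem θ)
    rw [norm_mul, Real.norm_eq_abs, Real.norm_eq_abs, abs_of_nonneg h1]
    exact mul_le_mul (poissonKernel_le hw (hmem θ)) (hM n _ (hmem θ)) (abs_nonneg _)
      (h1.trans (poissonKernel_le hw (hmem θ)))
  · exact Eventually.of_forall fun θ _ => (hlim _ (hmem θ)).const_mul _

/-- Balayage: a continuous subharmonic function is swept to a harmonic one, as an increasing limit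
of continuous subharmonic functions with the same boundary values. -/
theorem exists_balayage {U : Set ℂ} (hU : IsOpen U) (hb : Bornology.IsBounded U) {f : ℂ → ℝ}
    (hf : ContinuousOn f (closure U)) (hs : ∀ z ∈ U, SubM f z) :
    ∃ (V : ℕ → ℂ → ℝ) (u : ℂ → ℝ), (∀ n, ContinuousOn (V n) (closure U)) ∧
      (∀ n, ∀ z ∈ U, SubM (V n) z) ∧ (∀ n, ∀ z ∈ frontier U, V n z = f z) ∧
      (∀ n, ∀ z ∈ closure U, f z ≤ V n z) ∧
      (∀ z ∈ closure U, Tendsto (fun n => V n z) atTop (𝓝 (u z))) ∧ ∀ z ∈ U, HarmAt u z := by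
  obtain rfl | hne := U.eq_empty_or_nonempty
  · exact ⟨fun _ => f, f, by simp⟩
  obtain ⟨c, r, hr, hcU, hcov⟩ := exists_seq_balls hU hne
  let V : ℕ → ℂ → ℝ := fun n =>
    Nat.rec f (fun n v => poisMod v (c n.unpair.1) (r n.unpair.1)) n
  have hV0 : V 0 = f := rfl
  have hVs : ∀ n, V (n + 1) = poisMod (V n) (c n.unpair.1) (r n.unpair.1) := fun n => rfl
  have hcont : ∀ n, ContinuousOn (V n) (closure U) := by
    intro n
    induction n with
    | zero => exact hf
    | succ n ih => exact continuousOn_poisMod (hr _) ih ((hcU _).trans subset_closure)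
  have hsub : ∀ n, ∀ z ∈ U, SubM (V n) z := by
    intro n
    induction n with
    | zero => exact hs
    | succ n ih => exact subM_poisMod (hr _) hU (hcU _) ((hcont n).mono subset_closure) ih
  have hfr : ∀ n, ∀ z ∈ frontier U, V n z = f z := by
    intro n z hz
    induction n with
    | zero => rfl
    | succ n ih =>
      rw [hVs, poisMod_of_notMem, ih]
      intro h
      rw [hU.frontier_eq] at hz
      exact hz.2 (hcU _ (ball_subset_closedBall h))
  have hstep : ∀ n z, V n z ≤ V (n + 1) z := fun n z =>
    le_poisMod_of_subM (hr _) ((hcont n).mono ((hcU _).trans subset_closure))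
      (fun x hx => hsub n x (hcU _ (ball_subset_closedBall hx))) z
  have hmono : ∀ z, Monotone fun n => V n z := fun z => monotone_nat_of_le_succ fun n => hstep n z
  obtain ⟨M, hM⟩ := hb.isCompact_closure.exists_bound_of_continuousOn hf
  have hVM : ∀ n, ∀ z ∈ closure U, |V n z| ≤ M := by
    intro n z hz
    rw [abs_le]
    constructor
    · exact (abs_le.1 (hM z hz)).1.trans (hmono z (Nat.zero_le n))
    · refine le_of_subM hU hb (hcont n) (hsub n) (fun z hz => ?_) z hz
      rw [hfr n z hz]
      exact (abs_le.1 (hM z (frontier_subset_closure hz))).2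
  have hlim : ∀ z ∈ closure U, Tendsto (fun n => V n z) atTop (𝓝 (⨆ n, V n z)) := fun z hz =>
    tendsto_atTop_ciSup (hmono z) ⟨M, by
      rintro _ ⟨n, rfl⟩
      exact (abs_le.1 (hVM n z hz)).2⟩
  refine ⟨V, fun z => ⨆ n, V n z, hcont, hsub, hfr, fun n z _ => hmono z (Nat.zero_le n), hlim,
    fun z hz => ?_⟩
  obtain ⟨k, hk⟩ := hcov z hz
  have hsph : sphere (c k) (r k) ⊆ closure U :=
    (sphere_subset_closedBall.trans (hcU k)).trans subset_closure
  have hint : ∀ n, CircleIntegrable (V n) (c k) (r k) := fun n =>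
    circleIntegrable_of_continuousOn (hr k).le ((hcont n).mono hsph)
  have hint' := circleIntegrable_of_tendsto (hr k).le hint (fun n z hz => hVM n z (hsph hz))
    fun z hz => hlim z (hsph hz)
  refine (harmAt_poisInt hint' hk).congr ?_
  filter_upwards [isOpen_ball.mem_nhds hk] with w hw
  have hsubseq : Tendsto (fun j : ℕ => Nat.pair k j) atTop atTop :=
    tendsto_atTop_mono (fun j => Nat.right_le_pair k j) tendsto_id
  have h1 : Tendsto (fun j => V (Nat.pair k j + 1) w) atTop (𝓝 (⨆ n, V n w)) :=
    (hlim w (subset_closure (hcU k (ball_subset_closedBall hw)))).comp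
      (tendsto_atTop_mono (fun j => Nat.le_succ _) hsubseq)
  have h2 := (tendsto_poisInt_of_tendsto hw hint (fun n z hz => hVM n z (hsph hz))
    fun z hz => hlim z (hsph hz)).comp hsubseq
  refine tendsto_nhds_unique h1 (h2.congr fun j => ?_)
  rw [hVs, Nat.unpair_pair, poisMod_of_mem hw]
  rfl

end Balayage

section Barrier

open Metric Real

/-- Logarithms on all compact subsets of a connected open set glue to a global logarithm. -/
theorem HasLog.of_isCompact {U : Set ℂ} (hU : IsOpen U) (hUc : IsConnected U) {f : ℂ → ℂ}
    (h : ∀ K ⊆ U, IsCompact K → HasLog K f) : HasLog U f := by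
  obtain ⟨z₀, hz₀⟩ := hUc.nonempty
  obtain ⟨g₀, -, hg₀⟩ := h {z₀} (by simpa using hz₀) isCompact_singleton
  have hc₀ : Complex.exp (g₀ z₀) = f z₀ := hg₀ z₀ rfl
  have h1 : ∀ K : Set ℂ, K ⊆ U → IsCompact K → z₀ ∈ K → ∃ g : ℂ → ℂ, ContinuousOn g K ∧
      (∀ z ∈ K, Complex.exp (g z) = f z) ∧ g z₀ = g₀ z₀ := by
    intro K hK hKc hzK
    obtain ⟨g, hg, hgf⟩ := h K hK hKc
    refine ⟨fun z => g z - g z₀ + g₀ z₀, (hg.sub continuousOn_const).add continuousOn_const,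
      fun z hz => ?_, by ring⟩
    rw [Complex.exp_add, Complex.exp_sub, hgf z hz, hgf z₀ hzK, hc₀, div_mul_cancel₀]
    rw [← hc₀]
    exact Complex.exp_ne_zero _
  choose! G hGc hGf hG0 using h1
  have huniq : ∀ K L : Set ℂ, K ⊆ L → L ⊆ U → IsCompact K → IsCompact L → z₀ ∈ K →
      IsPreconnected K → ∀ z ∈ K, G K z = G L z := by
    intro K L hKL hLU hK hL hzK hKp z hz
    have := eqOn_sub_of_exp_eq hKp (hGc K (hKL.trans hLU) hK hzK)
      ((hGc L hLU hL (hKL hzK)).mono hKL)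
      (fun x hx => (hGf K (hKL.trans hLU) hK hzK x hx).trans
        (hGf L hLU hL (hKL hzK) x (hKL hx)).symm) hz hzK
    rw [hG0 K (hKL.trans hLU) hK hzK, hG0 L hLU hL (hKL hzK), sub_self, sub_eq_zero] at this
    exact this
  have hpath : ∀ z ∈ U, ∃ K ⊆ U, IsCompact K ∧ IsPreconnected K ∧ z₀ ∈ K ∧ z ∈ K := by
    intro z hz
    obtain ⟨γ, hγ⟩ := ((hU.isConnected_iff_isPathConnected).1 hUc).joinedIn z₀ hz₀ z hz
    refine ⟨range γ, ?_, isCompact_range γ.continuous, isPreconnected_range γ.continuous,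
      ⟨0, γ.source⟩, ⟨1, γ.target⟩⟩
    rintro _ ⟨t, rfl⟩
    exact hγ t
  choose! K hKU hKc hKp hK0 hKz using hpath
  have hval : ∀ L ⊆ U, IsCompact L → IsPreconnected L → z₀ ∈ L → ∀ z ∈ L,
      G (K z) z = G L z := by
    intro L hLU hL hLp hzL z hz
    have hzU := hLU hz
    rw [huniq (K z) (K z ∪ L) subset_union_left (union_subset (hKU z hzU) hLU) (hKc z hzU)
      ((hKc z hzU).union hL) (hK0 z hzU) (hKp z hzU) z (hKz z hzU),
      huniq L (K z ∪ L) subset_union_right (union_subset (hKU z hzU) hLU) hL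
      ((hKc z hzU).union hL) hzL hLp z hz]
  refine ⟨fun z => G (K z) z, fun z hz => ?_, fun z hz =>
    hGf (K z) (hKU z hz) (hKc z hz) (hK0 z hz) z (hKz z hz)⟩
  obtain ⟨r, hr, hrU⟩ := nhds_basis_closedBall.mem_iff.1 (hU.mem_nhds hz)
  have hLU := union_subset (hKU z hz) hrU
  have hLc := (hKc z hz).union (isCompact_closedBall z r)
  have hLp : IsPreconnected (K z ∪ closedBall z r) :=
    IsPreconnected.union z (hKz z hz) (mem_closedBall_self hr.le) (hKp z hz)
      (convex_closedBall z r).isPreconnected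
  have hL0 : z₀ ∈ K z ∪ closedBall z r := Or.inl (hK0 z hz)
  have hnhds : K z ∪ closedBall z r ∈ 𝓝 z :=
    mem_of_superset (closedBall_mem_nhds z hr) subset_union_right
  refine (((hGc _ hLU hLc hL0).continuousAt hnhds).congr ?_).continuousWithinAt
  filter_upwards [hnhds] with w hw
  exact (hval _ hLU hLc hLp hL0 w hw).symm

theorem differentiableOn_of_exp_eq_sub {U : Set ℂ} (hU : IsOpen U) {g : ℂ → ℂ} {p : ℂ}
    (hg : ContinuousOn g U) (hgf : ∀ z ∈ U, Complex.exp (g z) = z - p) :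
    DifferentiableOn ℂ g U := by
  intro z hz
  have h1 : HasDerivAt (fun w => Complex.exp w + p) (Complex.exp (g z)) (g z) :=
    (Complex.hasDerivAt_exp _).add_const p
  refine (HasDerivAt.of_local_left_inverse (hg.continuousAt (hU.mem_nhds hz)) h1
    (Complex.exp_ne_zero _) ?_).differentiableAt.differentiableWithinAt
  filter_upwards [hU.mem_nhds hz] with w hw
  rw [hgf w hw, sub_add_cancel]

theorem poisInt_le_three_mul {χ : ℂ → ℝ} {p z : ℂ} {R : ℝ} (hR : 0 < R)
    (hχ : Continuous χ) (h0 : ∀ z, 0 ≤ χ z) (hz : dist z p ≤ R / 2) :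
    poisInt χ p R z ≤ 3 * circleAverage χ p R := by
  have hzR : z ∈ ball p R := by rw [mem_ball]; linarith
  have hi := circleIntegrable_of_continuousOn (c := p) hR.le hχ.continuousOn
  have hi3 : CircleIntegrable (fun z => 3 * χ z) p R :=
    circleIntegrable_of_continuousOn (c := p) hR.le (hχ.const_mul 3).continuousOn
  have : 3 * circleAverage χ p R = circleAverage (fun z => 3 * χ z) p R := by
    rw [← smul_eq_mul, ← circleAverage_fun_smul]
    rfl
  rw [this]
  refine circleAverage_mono (circleIntegrable_poissonKernel_mul hzR hi) hi3 fun w hw => ?_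
  rw [abs_of_pos hR] at hw
  refine mul_le_mul_of_nonneg_right ((poissonKernel_le hzR hw).trans ?_) (h0 w)
  rw [dist_eq_norm] at hz
  rw [div_le_iff₀ (by linarith)]
  linarith

theorem exists_barrier {U : Set ℂ} (hU : IsOpen U) (hb : Bornology.IsBounded U) {p : ℂ}
    (hp : p ∈ frontier U) (hlog : HasLog U fun z => z - p) {f : ℂ → ℝ}
    (hf : ContinuousWithinAt f (frontier U) p) (M : ℝ) {δ : ℝ} (hδ : 0 < δ) :
    ∃ s > 0, ∀ v : ℂ → ℝ, ContinuousOn v (closure U) → (∀ z ∈ U, SubM v z) →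
      (∀ z ∈ frontier U, v z = f z) → (∀ z ∈ closure U, v z ≤ M) →
      ∀ z ∈ U, dist z p < s → v z ≤ f p + δ := by
  obtain ⟨g, hg, hgf⟩ := hlog
  have hgd := differentiableOn_of_exp_eq_sub hU hg hgf
  have hpU : p ∈ Uᶜ := by
    rw [hU.frontier_eq] at hp
    exact hp.2
  have hne : (Uᶜ).Nonempty := ⟨p, hpU⟩
  obtain ⟨R, hR, hfR⟩ : ∃ R > 0, ∀ z ∈ frontier U, dist z p ≤ R → f z < f p + δ / 2 := by
    obtain ⟨r, hr, h⟩ := Metric.continuousWithinAt_iff.1 hf (δ / 2) (half_pos hδ)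
    refine ⟨r / 2, half_pos hr, fun z hz hd => ?_⟩
    have h2 := h hz (by linarith)
    rw [Real.dist_eq] at h2
    linarith [(abs_lt.1 h2).2]
  let M' : ℝ := max (M - f p) 0 + 1
  have hM' : 0 < M' := by positivity
  have hMM' : M ≤ f p + M' := by
    have := le_max_left (M - f p) 0
    simp only [M']
    linarith
  have hnormexp : ∀ z ∈ U, Real.exp (g z).re = dist z p := fun z hz => by
    rw [dist_eq_norm, ← Complex.norm_exp, hgf z hz]
  let ℓ : ℂ → ℂ := fun z => g z - (Real.log (2 * R) : ℝ)
  have hℓre : ∀ z ∈ U, (ℓ z).re = Real.log (dist z p) - Real.log (2 * R) := fun z hz => by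
    simp only [ℓ, Complex.sub_re, Complex.ofReal_re]
    rw [← hnormexp z hz, Real.log_exp]
  have hdpos : ∀ z ∈ U, 0 < dist z p := fun z hz => by
    rw [← hnormexp z hz]
    exact Real.exp_pos _
  have hℓneg : ∀ z ∈ U, dist z p ≤ R → (ℓ z).re < 0 := fun z hz hd => by
    rw [hℓre z hz, sub_neg]
    exact Real.log_lt_log (hdpos z hz) (by linarith)
  have hℓ0 : ∀ z ∈ U, dist z p ≤ R → ℓ z ≠ 0 := fun z hz hd h => by
    have := hℓneg z hz hd
    rw [h] at this
    simp at this
  let h : ℂ → ℝ := fun z => (-(ℓ z)⁻¹).re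
  have hheq : ∀ z, h z = -(ℓ z).re / Complex.normSq (ℓ z) := fun z => by
    simp only [h, Complex.neg_re, Complex.inv_re, neg_div]
  have hhpos : ∀ z ∈ U, dist z p ≤ R → 0 < h z := fun z hz hd => by
    rw [hheq]
    exact div_pos (neg_pos.2 (hℓneg z hz hd)) (Complex.normSq_pos.2 (hℓ0 z hz hd))
  have hhle : ∀ z ∈ U, dist z p ≤ R → h z ≤ (-(ℓ z).re)⁻¹ := fun z hz hd => by
    have hn := neg_pos.2 (hℓneg z hz hd)
    rw [hheq, div_le_iff₀ (Complex.normSq_pos.2 (hℓ0 z hz hd)), inv_mul_eq_div,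
      le_div_iff₀ hn, Complex.normSq_apply]
    nlinarith [mul_self_nonneg (ℓ z).im]
  have hhcont : ContinuousOn h (U ∩ closedBall p R) :=
    Complex.continuous_re.comp_continuousOn
      (((hg.mono inter_subset_left).sub continuousOn_const).inv₀
        fun z hz => hℓ0 z hz.1 hz.2).neg
  have hhharm : ∀ z ∈ U ∩ ball p R, HarmAt h z := by
    refine fun z hz => harmAt_of_differentiableOn (F := fun z => -(ℓ z)⁻¹) (hU.inter isOpen_ball)
      ?_ hz
    exact (((hgd.mono inter_subset_left).sub_const _).inv
      fun z hz => hℓ0 z hz.1 (le_of_lt hz.2)).neg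
  let ψ : ℕ → ℂ → ℝ := fun n z => min 1 (n * infDist z Uᶜ)
  have hψc : ∀ n, Continuous (ψ n) := fun n => by
    have := continuous_infDist_pt (Uᶜ)
    fun_prop
  have hψmono : ∀ z, Monotone fun n => ψ n z := fun z m n hmn => by
    have := infDist_nonneg (x := z) (s := Uᶜ)
    simp only [ψ]
    gcongr
  have hψi : ∀ n, CircleIntegrable (ψ n) p R := fun n =>
    circleIntegrable_of_continuousOn hR.le (hψc n).continuousOn
  have hamono : Monotone fun n => circleAverage (ψ n) p R := fun m n hmn =>
    circleAverage_mono (hψi m) (hψi n) fun z _ => hψmono z hmn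
  let ε : ℝ := δ / (24 * M')
  have hε : 0 < ε := by positivity
  obtain ⟨n, hn⟩ : ∃ n, ∀ m ≥ n, circleAverage (ψ m) p R - circleAverage (ψ n) p R < ε := by
    have hbd : BddAbove (range fun n => circleAverage (ψ n) p R) := by
      refine ⟨1, ?_⟩
      rintro _ ⟨n, rfl⟩
      rw [← circleAverage_const (1 : ℝ) p R]
      exact circleAverage_mono (hψi n) (circleIntegrable_const _ _ _) fun z _ => min_le_left _ _
    obtain ⟨n, hn⟩ := exists_lt_of_lt_ciSup
      (sub_lt_self (⨆ n, circleAverage (ψ n) p R) hε)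
    refine ⟨n, fun m _ => ?_⟩
    have := le_ciSup hbd m
    linarith
  let K₂ : Set ℂ := sphere p R ∩ {z | 1 / 2 ≤ ψ n z}
  have hK₂ : IsCompact K₂ :=
    (isCompact_sphere p R).inter_right (isClosed_le continuous_const (hψc n))
  have hK₂U : K₂ ⊆ U := by
    intro z hz
    by_contra hzU
    have h1 : (1 : ℝ) / 2 ≤ ψ n z := hz.2
    have h2 : ψ n z ≤ 0 := by
      simp only [ψ]
      rw [infDist_zero_of_mem (show z ∈ Uᶜ from hzU)]
      simp
    linarith
  obtain ⟨m₀, hm₀, hm₀h⟩ : ∃ m₀ > 0, ∀ z ∈ K₂, m₀ ≤ h z := by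
    obtain h0 | h0 := K₂.eq_empty_or_nonempty
    · exact ⟨1, one_pos, by simp [h0]⟩
    · obtain ⟨z, hz, hmin⟩ := hK₂.exists_isMinOn h0
        (hhcont.mono fun z hz => ⟨hK₂U hz, sphere_subset_closedBall hz.1⟩)
      exact ⟨h z, hhpos z (hK₂U hz) (le_of_eq hz.1), fun w hw => hmin hw⟩
  let Q : ℝ := 4 * M' / (m₀ * δ)
  have hQ : 0 < Q := by positivity
  refine ⟨min (R / 2) (2 * R * Real.exp (-Q)), by positivity, fun v hv hvs hvf hvM z hz hzs => ?_⟩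
  have hzR : dist z p ≤ R / 2 := (hzs.trans_le (min_le_left _ _)).le
  have hhz : M' * (h z / m₀) ≤ δ / 4 := by
    have h1 := hhle z hz (by linarith)
    have h2 : Q ≤ -(ℓ z).re := by
      rw [hℓre z hz]
      have h3 := Real.log_le_log (hdpos z hz) (hzs.trans_le (min_le_right _ _)).le
      rw [Real.log_mul (by positivity) (Real.exp_pos _).ne', Real.log_exp] at h3
      linarith
    have h3 : h z ≤ Q⁻¹ := h1.trans (inv_anti₀ hQ h2)
    calc M' * (h z / m₀) ≤ M' * (Q⁻¹ / m₀) := by gcongr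
      _ = δ / 4 := by
        simp only [Q]
        field_simp
  by_cases hvz : v z ≤ f p + δ / 2
  · linarith
  rw [not_le] at hvz
  let W : Set ℂ := (U ∩ ball p R) ∩ v ⁻¹' Ioi (f p + δ / 2)
  have hW : IsOpen W := ((hv.mono subset_closure).mono inter_subset_left).isOpen_inter_preimage
    (hU.inter isOpen_ball) isOpen_Ioi
  have hWb : Bornology.IsBounded W := hb.subset (inter_subset_left.trans inter_subset_left)
  have hWcl : closure W ⊆ U ∩ closedBall p R := by
    have hcl : IsClosed ((closure U ∩ closedBall p R) ∩ v ⁻¹' Ici (f p + δ / 2)) :=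
      (hv.mono inter_subset_left).preimage_isClosed_of_isClosed
        (isClosed_closure.inter isClosed_closedBall) isClosed_Ici
    have hsub : closure W ⊆ (closure U ∩ closedBall p R) ∩ v ⁻¹' Ici (f p + δ / 2) :=
      closure_minimal (fun x hx => ⟨⟨subset_closure hx.1.1, ball_subset_closedBall hx.1.2⟩,
        (show f p + δ / 2 < v x from hx.2).le⟩) hcl
    intro x hx
    obtain ⟨⟨hx1, hx2⟩, hx3⟩ := hsub hx
    refine ⟨?_, hx2⟩
    by_contra hxU
    have hxf : x ∈ frontier U := by
      rw [hU.frontier_eq]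
      exact ⟨hx1, hxU⟩
    have h1 := hfR x hxf hx2
    have h2 : f p + δ / 2 ≤ v x := hx3
    rw [hvf x hxf] at h2
    linarith
  obtain ⟨m, hmn, hm⟩ : ∃ m ≥ n, ∀ x ∈ closure W, ψ m x = 1 := by
    have hWn : (closure W).Nonempty := ⟨z, subset_closure ⟨⟨hz, by rw [mem_ball]; linarith⟩, hvz⟩⟩
    obtain ⟨x, hx, hmin⟩ := hWb.isCompact_closure.exists_isMinOn hWn
      (continuous_infDist_pt (Uᶜ)).continuousOn
    have hd : 0 < infDist x Uᶜ := (hU.isClosed_compl.notMem_iff_infDist_pos hne).1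
      (fun h => h (hWcl hx).1)
    obtain ⟨m, hm⟩ := exists_nat_ge (1 / infDist x Uᶜ)
    refine ⟨max m n, le_max_right _ _, fun y hy => min_eq_left ?_⟩
    have h1 : infDist x Uᶜ ≤ infDist y Uᶜ := hmin hy
    have h2 : (m : ℝ) ≤ (max m n : ℕ) := by exact_mod_cast le_max_left m n
    rw [div_le_iff₀ hd] at hm
    have h3 : (0 : ℝ) ≤ m := by positivity
    nlinarith
  let χ : ℂ → ℝ := fun x => ψ m x - ψ n x
  have hχc : Continuous χ := (hψc m).sub (hψc n)
  have hχ0 : ∀ x, 0 ≤ χ x := fun x => sub_nonneg.2 (hψmono x hmn)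
  have hχi : CircleIntegrable χ p R := circleIntegrable_of_continuousOn hR.le hχc.continuousOn
  have hPc := continuousOn_poisMod hR (c := p) hχc.continuousOn Subset.rfl
  have hP0 : ∀ x, 0 ≤ poisMod χ p R x := by
    intro x
    by_cases hx : x ∈ ball p R
    · rw [poisMod_of_mem hx, ← poisInt_const (a := 0) hx]
      exact poisInt_mono hx (circleIntegrable_const _ _ _) hχi fun y _ => hχ0 y
    · rw [poisMod_of_notMem hx]
      exact hχ0 x
  let B : ℂ → ℝ := fun x => m₀⁻¹ * h x + 2 * poisMod χ p R x
  have hB0 : ∀ x ∈ U ∩ closedBall p R, 0 ≤ B x := fun x hx => by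
    have := (hhpos x hx.1 hx.2).le
    have := hP0 x
    positivity
  have hBc : ContinuousOn (fun x => -M' * B x) (closure W) :=
    (((hhcont.mono hWcl).const_mul _).add
      ((hPc.mono (hWcl.trans inter_subset_right)).const_mul _)).const_mul _
  have hBh : ∀ x ∈ W, HarmAt (fun x => -M' * B x) x := fun x hx =>
    (((hhharm x hx.1).const_mul _).add ((harmAt_poisMod hχi hx.1.2).const_mul _)).const_mul _
  have hvW : ContinuousOn v (closure W) := hv.mono fun x hx => subset_closure (hWcl hx).1
  have hfin := le_of_subM hW hWb (v := fun x => v x + -M' * B x) (hvW.add hBc)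
    (fun x hx => (hvs x hx.1.1).add (hBh x hx).subM (hW.mem_nhds hx) (hvW.mono subset_closure)
      (hBc.mono subset_closure)) (a := f p + δ / 2) ?_ z
    (subset_closure ⟨⟨hz, by rw [mem_ball]; linarith⟩, hvz⟩)
  · have hav : circleAverage χ p R < ε := by
      simp only [χ]
      rw [circleAverage_fun_sub (hψi m) (hψi n)]
      exact hn m hmn
    have hPz : poisMod χ p R z ≤ 3 * ε := by
      rw [poisMod_of_mem (by rw [mem_ball]; linarith)]
      have := poisInt_le_three_mul hR hχc hχ0 hzR
      linarith
    have h6 : M' * (2 * poisMod χ p R z) ≤ δ / 4 := by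
      calc M' * (2 * poisMod χ p R z) ≤ M' * (2 * (3 * ε)) := by gcongr
        _ = δ / 4 := by
          simp only [ε]
          field_simp
          norm_num
    simp only [B] at hfin
    rw [div_eq_inv_mul] at hhz
    linarith
  · intro x hx
    have hxc := hWcl (frontier_subset_closure hx)
    have hB0x := hB0 x hxc
    by_cases hxb : x ∈ ball p R
    · have hxv : v x ≤ f p + δ / 2 := by
        by_contra hxv
        rw [hW.frontier_eq] at hx
        exact hx.2 ⟨⟨hxc.1, hxb⟩, not_le.1 hxv⟩
      have : 0 ≤ M' * B x := by positivity
      linarith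
    · have hxs : x ∈ sphere p R := le_antisymm hxc.2 (not_lt.1 hxb)
      have hB1 : 1 ≤ B x := by
        have hψ1 := hm x (frontier_subset_closure hx)
        by_cases hψn : 1 / 2 ≤ ψ n x
        · have h1 := hm₀h x ⟨hxs, hψn⟩
          have h2 : 1 ≤ m₀⁻¹ * h x := by
            rw [inv_mul_eq_div, le_div_iff₀ hm₀]
            linarith
          have h3 := hP0 x
          simp only [B]
          linarith
        · have h1 : poisMod χ p R x = 1 - ψ n x := by
            rw [poisMod_of_notMem hxb]
            simp only [χ, hψ1]
          have h2 : 0 ≤ m₀⁻¹ * h x := by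
            have := (hhpos x hxc.1 hxc.2).le
            positivity
          simp only [B]
          rw [h1]
          rw [not_le] at hψn
          linarith
      have h1 := hvM x (subset_closure hxc.1)
      have h2 : M' ≤ M' * B x := le_mul_of_one_le_right hM'.le hB1
      linarith

end Barrier

section Dirichlet

open Metric

theorem exists_harmonic_of_subM {U : Set ℂ} (hU : IsOpen U) (hb : Bornology.IsBounded U)
    (hlog : ∀ p ∈ frontier U, HasLog U fun z => z - p) {f : ℂ → ℝ}
    (hf : ContinuousOn f (closure U)) (hs : ∀ z ∈ U, SubM f z) :
    ∃ u : ℂ → ℝ, ContinuousOn u (closure U) ∧ (∀ z ∈ U, HarmAt u z) ∧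
      ∀ z ∈ frontier U, u z = f z := by
  obtain ⟨V, u, hVc, hVs, hVf, hfV, hlim, hharm⟩ := exists_balayage hU hb hf hs
  have huf : ∀ z ∈ frontier U, u z = f z := fun z hz =>
    tendsto_nhds_unique (hlim z (frontier_subset_closure hz))
      (tendsto_const_nhds.congr fun n => (hVf n z hz).symm)
  obtain ⟨M, hM⟩ := hb.isCompact_closure.exists_bound_of_continuousOn hf
  have hVM : ∀ n, ∀ z ∈ closure U, V n z ≤ M := fun n z hz =>
    le_of_subM hU hb (hVc n) (hVs n) (fun z hz => by
      rw [hVf n z hz]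
      exact (abs_le.1 (hM z (frontier_subset_closure hz))).2) z hz
  refine ⟨u, fun p hp => ?_, hharm, huf⟩
  by_cases hpU : p ∈ U
  · exact (hharm p hpU).continuousAt.continuousWithinAt
  have hpf : p ∈ frontier U := by
    rw [hU.frontier_eq]
    exact ⟨hp, hpU⟩
  rw [Metric.continuousWithinAt_iff]
  intro ε hε
  obtain ⟨s, hs0, hsb⟩ := exists_barrier hU hb hpf (hlog p hpf)
    ((hf p hp).mono frontier_subset_closure) M (half_pos hε)
  obtain ⟨r, hr, hfr⟩ := Metric.continuousWithinAt_iff.1 (hf p hp) ε hε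
  refine ⟨min r s, lt_min hr hs0, fun z hz hd => ?_⟩
  have h1 := hfr hz (hd.trans_le (min_le_left _ _))
  rw [Real.dist_eq, abs_lt] at h1
  have hpe := huf p hpf
  rw [Real.dist_eq, abs_lt, hpe]
  by_cases hzU : z ∈ U
  · have h2 : f z ≤ u z := ge_of_tendsto' (hlim z hz) fun n => hfV n z hz
    have h3 : u z ≤ f p + ε / 2 := le_of_tendsto' (hlim z hz) fun n =>
      hsb (V n) (hVc n) (hVs n) (hVf n) (hVM n) z hzU (hd.trans_le (min_le_right _ _))
    constructor <;> linarith
  · rw [huf z (by rw [hU.frontier_eq]; exact ⟨hz, hzU⟩)]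
    exact h1

theorem subM_exp_re (c z : ℂ) : SubM (fun w => Real.exp (c * w).re) z := by
  let F : ℂ → ℂ := fun w => (Real.exp (c * z).re : ℝ) * (1 + c * (w - z))
  have hF : Differentiable ℂ F := by fun_prop
  have hH : HarmAt (fun w => (F w).re) z :=
    harmAt_of_differentiableOn isOpen_univ hF.differentiableOn (mem_univ z)
  refine hH.subM.mono univ_mem (by fun_prop) (by fun_prop) (by
    simp only [F, sub_self, mul_zero, add_zero, mul_one, Complex.ofReal_re]) fun w _ => ?_
  have h1 := Real.add_one_le_exp ((c * w).re - (c * z).re)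
  have h2 := Real.exp_pos (c * z).re
  have h3 : Real.exp (c * w).re
      = Real.exp (c * z).re * Real.exp ((c * w).re - (c * z).re) := by
    rw [← Real.exp_add]
    ring_nf
  rw [h3]
  simp only [F, Complex.re_ofReal_mul, mul_sub, Complex.add_re, Complex.sub_re, Complex.one_re]
  gcongr
  linarith

/-- The boundary data on the frontier of `U` for which the Dirichlet problem is solvable. -/
def dirichletData (U : Set ℂ) : Submodule ℝ C(↥(frontier U), ℝ) where
  carrier := {φ | ∃ u : ℂ → ℝ, ContinuousOn u (closure U) ∧ (∀ z ∈ U, HarmAt u z) ∧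
    ∀ z : ↥(frontier U), u z = φ z}
  zero_mem' := ⟨fun w => (0 : ℂ).re, continuousOn_const, fun z hz =>
    harmAt_of_differentiableOn isOpen_univ (F := fun _ => 0) (by fun_prop) (mem_univ z),
    fun _ => rfl⟩
  add_mem' := by
    rintro φ ψ ⟨u, hu, hu', huφ⟩ ⟨v, hv, hv', hvψ⟩
    exact ⟨fun z => u z + v z, hu.add hv, fun z hz => (hu' z hz).add (hv' z hz), fun z => by
      simp [huφ, hvψ]⟩
  smul_mem' := by
    rintro a φ ⟨u, hu, hu', huφ⟩
    exact ⟨fun z => a * u z, hu.const_mul _, fun z hz => (hu' z hz).const_mul a, fun z => by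
      simp [huφ]⟩

theorem HarmAt.of_tendsto {v : ℕ → ℂ → ℝ} {u : ℂ → ℝ} {U : Set ℂ} (hU : IsOpen U) {M : ℝ}
    (hv : ∀ n, ∀ z ∈ U, HarmAt (v n) z) (hM : ∀ n, ∀ z ∈ U, |v n z| ≤ M)
    (hlim : ∀ z ∈ U, Tendsto (fun n => v n z) atTop (𝓝 (u z))) : ∀ z ∈ U, HarmAt u z := by
  intro z hz
  obtain ⟨r, hr, hrU⟩ := nhds_basis_closedBall.mem_iff.1 (hU.mem_nhds hz)
  have hsph := sphere_subset_closedBall.trans hrU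
  have hc : ∀ n, ContinuousOn (v n) (closedBall z r) := fun n w hw =>
    (hv n w (hrU hw)).continuousAt.continuousWithinAt
  have hi : ∀ n, CircleIntegrable (v n) z r := fun n =>
    circleIntegrable_of_continuousOn hr.le ((hc n).mono sphere_subset_closedBall)
  have hi' := circleIntegrable_of_tendsto hr.le hi (fun n z hz => hM n z (hsph hz))
    fun z hz => hlim z (hsph hz)
  refine (harmAt_poisInt hi' (mem_ball_self hr)).congr ?_
  filter_upwards [ball_mem_nhds z hr] with w hw
  have h1 := tendsto_poisInt_of_tendsto hw hi (fun n z hz => hM n z (hsph hz))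
    fun z hz => hlim z (hsph hz)
  refine tendsto_nhds_unique (hlim w (hrU (ball_subset_closedBall hw))) (h1.congr fun n => ?_)
  exact (HarmAt.eq_poisInt hr (hc n)
    (fun x hx => hv n x (hrU (ball_subset_closedBall hx))) w hw).symm

theorem isClosed_dirichletData {U : Set ℂ} (hU : IsOpen U) (hb : Bornology.IsBounded U) :
    IsClosed (dirichletData U : Set C(↥(frontier U), ℝ)) := by
  have : CompactSpace ↥(frontier U) :=
    isCompact_iff_compactSpace.1 (hb.isCompact_closure.of_isClosed_subset isClosed_frontier
      frontier_subset_closure)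
  rw [← isSeqClosed_iff_isClosed]
  intro φ ψ hφ hlim
  choose u hu hu' huφ using hφ
  have hdiff : ∀ m n, ∀ z ∈ closure U, |u m z - u n z| ≤ dist (φ m) (φ n) := fun m n =>
    HarmAt.abs_sub_le hU hb (hu m) (hu n) (hu' m) (hu' n) fun z hz => by
      rw [huφ m ⟨z, hz⟩, huφ n ⟨z, hz⟩, ← Real.dist_eq]
      exact ContinuousMap.dist_apply_le_dist _
  have hcs : CauchySeq φ := hlim.cauchySeq
  have hucs : UniformCauchySeqOn u atTop (closure U) := by
    rw [Metric.uniformCauchySeqOn_iff]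
    intro ε hε
    obtain ⟨N, hN⟩ := Metric.cauchySeq_iff.1 hcs ε hε
    exact ⟨N, fun m hm n hn x hx => (hdiff m n x hx).trans_lt (hN m hm n hn)⟩
  have hex : ∀ z ∈ closure U, ∃ l, Tendsto (fun n => u n z) atTop (𝓝 l) := fun z hz =>
    cauchySeq_tendsto_of_complete (hucs.cauchySeq hz)
  choose! w hw using hex
  have hunif := hucs.tendstoUniformlyOn_of_tendsto hw
  refine ⟨w, hunif.continuousOn (Frequently.of_forall hu), ?_, fun z => ?_⟩
  · obtain ⟨M₀, hM₀⟩ := hb.isCompact_closure.exists_bound_of_continuousOn (hu 0)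
    obtain ⟨C, hC⟩ := hcs.isBounded_range.exists_norm_le
    have hb' : ∀ n, ∀ z ∈ U, |u n z| ≤ (C + C) + M₀ := fun n z hz => by
      have h1 := hdiff n 0 z (subset_closure hz)
      have h2 := hM₀ z (subset_closure hz)
      have h3 := dist_le_norm_add_norm (φ n) (φ 0)
      have h4 := hC _ (mem_range_self n)
      have h5 := hC _ (mem_range_self 0)
      have h6 := abs_sub_abs_le_abs_sub (u n z) (u 0 z)
      rw [Real.norm_eq_abs] at h2
      linarith
    exact HarmAt.of_tendsto hU hu' hb' fun z hz => hw z (subset_closure hz)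
  · refine tendsto_nhds_unique (hw z (frontier_subset_closure z.2)) ?_
    have h1 : Tendsto (fun n => φ n z) atTop (𝓝 (ψ z)) :=
      ((continuous_eval_const z).tendsto ψ).comp hlim
    exact h1.congr fun n => (huφ n z).symm

theorem dirichletData_eq_top {U : Set ℂ} (hU : IsOpen U) (hb : Bornology.IsBounded U)
    (hlog : ∀ p ∈ frontier U, HasLog U fun z => z - p) : dirichletData U = ⊤ := by
  have : CompactSpace ↥(frontier U) :=
    isCompact_iff_compactSpace.1 (hb.isCompact_closure.of_isClosed_subset isClosed_frontier
      frontier_subset_closure)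
  let e : ℂ → C(↥(frontier U), ℝ) := fun c => ⟨fun z => Real.exp (c * z).re, by fun_prop⟩
  let S : Submonoid C(↥(frontier U), ℝ) :=
    { carrier := range e
      one_mem' := ⟨0, by ext z; simp [e]⟩
      mul_mem' := by
        rintro _ _ ⟨c, rfl⟩ ⟨d, rfl⟩
        refine ⟨c + d, ?_⟩
        ext z
        simp only [e, ContinuousMap.coe_mk, ContinuousMap.mul_apply, ← Real.exp_add, add_mul,
          Complex.add_re] }
  let A : Subalgebra ℝ C(↥(frontier U), ℝ) := Algebra.adjoin ℝ (S : Set C(↥(frontier U), ℝ))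
  have hA : (A : Set C(↥(frontier U), ℝ)) ⊆ dirichletData U := by
    have h1 : A.toSubmodule ≤ dirichletData U := by
      rw [Algebra.adjoin_eq_span, Submonoid.closure_eq, Submodule.span_le]
      rintro _ ⟨c, rfl⟩
      obtain ⟨u, hu, hu', huf⟩ := exists_harmonic_of_subM hU hb hlog
        (f := fun w => Real.exp (c * w).re) (by fun_prop) fun z _ => subM_exp_re c z
      exact ⟨u, hu, hu', fun z => huf z z.2⟩
    exact h1
  have hsep : A.SeparatesPoints := by
    intro z w hzw
    have hne : (z : ℂ) ≠ w := fun h => hzw (Subtype.ext h)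
    have hmem : ∀ c, (e c : ↥(frontier U) → ℝ) ∈ (fun f : C(↥(frontier U), ℝ) =>
        (f : ↥(frontier U) → ℝ)) '' (A : Set C(↥(frontier U), ℝ)) := fun c =>
      ⟨e c, Algebra.subset_adjoin ⟨c, rfl⟩, rfl⟩
    by_cases hre : (z : ℂ).re = (w : ℂ).re
    · have him : (z : ℂ).im ≠ (w : ℂ).im := fun h => hne (Complex.ext hre h)
      refine ⟨_, hmem (-Complex.I), ?_⟩
      simpa [e] using him
    · refine ⟨_, hmem 1, ?_⟩
      simpa [e] using hre
  have htop := ContinuousMap.subalgebra_topologicalClosure_eq_top_of_separatesPoints A hsep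
  rw [eq_top_iff]
  intro φ _
  have h1 : φ ∈ A.topologicalClosure := by rw [htop]; trivial
  exact closure_minimal hA (isClosed_dirichletData hU hb) h1

/-- Solvability of the Dirichlet problem. -/
theorem exists_harmonic {U : Set ℂ} (hU : IsOpen U) (hb : Bornology.IsBounded U)
    (hlog : ∀ p ∈ frontier U, HasLog U fun z => z - p) {f : ℂ → ℝ}
    (hf : ContinuousOn f (frontier U)) :
    ∃ u : ℂ → ℝ, ContinuousOn u (closure U) ∧ (∀ z ∈ U, HarmAt u z) ∧
      ∀ z ∈ frontier U, u z = f z := by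
  have h : (⟨(frontier U).domRestrict f, continuousOn_iff_continuous_domRestrict.1 hf⟩ :
      C(↥(frontier U), ℝ)) ∈ dirichletData U := by
    rw [dirichletData_eq_top hU hb hlog]
    trivial
  obtain ⟨u, hu, hu', huf⟩ := h
  exact ⟨u, hu, hu', fun z hz => huf ⟨z, hz⟩⟩

end Dirichlet

section Crossing

theorem div_mem_slitPlane_of_re_pos {p q : ℂ} (hp : 0 < p.re) (hq : 0 < q.re) :
    p / q ∈ Complex.slitPlane := by
  have hq0 : q ≠ 0 := fun h => by simp [h] at hq
  by_contra h
  rw [Complex.mem_slitPlane_iff_not_le_zero, not_not] at h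
  obtain ⟨h1, h2⟩ := Complex.le_def.1 h
  have h3 : p.re = (p / q).re * q.re := by
    conv_lhs => rw [← div_mul_cancel₀ p hq0, Complex.mul_re, h2]
    simp
  rw [Complex.zero_re] at h1
  nlinarith

theorem sub_div_sub_mem_slitPlane {x y b : ℂ} (hx : ‖x‖ ≤ ‖b‖) (hy : ‖y‖ ≤ ‖b‖) (hxb : x ≠ b)
    (hyb : y ≠ b) : (x - b) / (y - b) ∈ Complex.slitPlane := by
  have hb : b ≠ 0 := fun h => by
    rw [h, norm_zero, norm_le_zero_iff] at hx
    exact hxb (hx.trans h.symm)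
  have key : ∀ x : ℂ, ‖x‖ ≤ ‖b‖ → x ≠ b → 0 < (1 - x / b).re := by
    intro x hx hxb
    have h1 : ‖x / b‖ ≤ 1 := by
      rw [norm_div]
      exact div_le_one_of_le₀ hx (norm_nonneg _)
    have h2 : (x / b).re ≠ 1 := fun h => by
      have h3 := Complex.sq_norm (x / b)
      rw [Complex.normSq_apply, h] at h3
      have h4 : ‖x / b‖ ^ 2 ≤ 1 := pow_le_one₀ (norm_nonneg _) h1
      have h5 : (x / b).im = 0 := by nlinarith [mul_self_nonneg (x / b).im]
      have h6 : x / b = 1 := Complex.ext h h5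
      exact hxb ((div_eq_one_iff_eq hb).1 h6)
    have h3 := ((Complex.re_le_norm _).trans h1).lt_of_ne h2
    simpa using h3
  have : (x - b) / (y - b) = (1 - x / b) / (1 - y / b) := by
    rw [one_sub_div hb, one_sub_div hb, div_div_div_cancel_right₀ hb, ← neg_sub x, ← neg_sub y,
      neg_div_neg_eq]
  rw [this]
  exact div_mem_slitPlane_of_re_pos (key x hx hxb) (key y hy hyb)

/-- Extend a path, parametrized by `[0, 1]`, by exponentially decaying radial ends. -/
noncomputable def expExtend (α : ℝ → ℂ) (s : ℝ) : ℂ :=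
  Real.exp (-(max (-s) 0 + max (s - 1) 0)) * α (max 0 (min s 1))

theorem continuous_expExtend {α : ℝ → ℂ} (hα : Continuous α) : Continuous (expExtend α) := by
  unfold expExtend
  fun_prop

theorem expExtend_of_nonpos {α : ℝ → ℂ} {s : ℝ} (hs : s ≤ 0) :
    expExtend α s = Real.exp s * α 0 := by
  rw [expExtend, max_eq_left (by linarith), max_eq_right (by linarith), min_eq_left (by linarith),
    max_eq_left hs]
  simp

theorem expExtend_of_mem {α : ℝ → ℂ} {s : ℝ} (hs : s ∈ Icc (0 : ℝ) 1) :
    expExtend α s = α s := by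
  have h0 := hs.1
  have h1 := hs.2
  rw [expExtend, max_eq_right (by linarith), max_eq_right (by linarith), min_eq_left h1,
    max_eq_right h0]
  simp

theorem expExtend_of_one_le {α : ℝ → ℂ} {s : ℝ} (hs : 1 ≤ s) :
    expExtend α s = Real.exp (1 - s) * α 1 := by
  rw [expExtend, max_eq_right (by linarith), max_eq_left (by linarith), min_eq_right hs,
    max_eq_right zero_le_one]
  simp

theorem expExtend_cases (α : ℝ → ℂ) (s : ℝ) :
    (s ∈ Icc (0 : ℝ) 1 ∧ expExtend α s = α s) ∨
      ∃ r : ℝ, 0 < r ∧ r ≤ 1 ∧ (expExtend α s = r * α 0 ∨ expExtend α s = r * α 1) := by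
  rcases le_total s 0 with h | h
  · exact Or.inr ⟨Real.exp s, Real.exp_pos _, Real.exp_le_one_iff.2 h,
      Or.inl (expExtend_of_nonpos h)⟩
  rcases le_total s 1 with h1 | h1
  · exact Or.inl ⟨⟨h, h1⟩, expExtend_of_mem ⟨h, h1⟩⟩
  · exact Or.inr ⟨Real.exp (1 - s), Real.exp_pos _, Real.exp_le_one_iff.2 (by linarith),
      Or.inr (expExtend_of_one_le h1)⟩

/-- A path from `α 0` to `α 1`, together with radii to the origin, avoids the radii to the ends of
`β`; then far out in the parameter the norm bound `exp (-S) ≤ ‖expExtend α s‖` holds. -/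
theorem exists_exp_le_norm_expExtend {α : ℝ → ℂ} (hα : Continuous α) (h0 : ‖α 0‖ = 1)
    (h1 : ‖α 1‖ = 1) (hne : ∀ s ∈ Icc (0 : ℝ) 1, α s ≠ 0) :
    ∃ S₀ : ℝ, ∀ S ≥ S₀, ∀ s ∈ Icc (-S) (S + 1), Real.exp (-S) ≤ ‖expExtend α s‖ := by
  obtain ⟨m, hm, hmin⟩ := (isCompact_Icc (a := (0 : ℝ)) (b := 1)).exists_isMinOn
    ⟨0, by simp⟩ hα.norm.continuousOn
  have hmpos : 0 < ‖α m‖ := norm_pos_iff.2 (hne m hm)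
  refine ⟨-Real.log ‖α m‖, fun S hS s hs => ?_⟩
  have hexp : ∀ x : ℝ, ‖(Real.exp x : ℂ)‖ = Real.exp x := fun x => by
    rw [Complex.norm_real, Real.norm_of_nonneg (Real.exp_pos _).le]
  rcases le_total s 0 with h | h
  · rw [expExtend_of_nonpos h, norm_mul, h0, mul_one, hexp]
    exact Real.exp_le_exp.2 hs.1
  rcases le_total s 1 with h' | h'
  · rw [expExtend_of_mem ⟨h, h'⟩]
    calc Real.exp (-S) ≤ Real.exp (Real.log ‖α m‖) := Real.exp_le_exp.2 (by linarith)
      _ = ‖α m‖ := Real.exp_log hmpos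
      _ ≤ ‖α s‖ := hmin ⟨h, h'⟩
  · rw [expExtend_of_one_le h', norm_mul, h1, mul_one, hexp]
    exact Real.exp_le_exp.2 (by linarith [hs.2])

/-- Two paths with interlacing end points on the unit circle, each avoiding the radii at the end
points of the other, must cross. -/
theorem exists_crossing {ω : ℂ} (hω : ‖ω‖ = 1) (him : 0 < ω.im) (hre : 0 ≤ ω.re) {α β : ℝ → ℂ}
    (hα : Continuous α) (hβ : Continuous β) (hα0 : α 0 = 1) (hα1 : α 1 = ω ^ 2) (hβ0 : β 0 = ω)
    (hβ1 : β 1 = ω ^ 3)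
    (hαr : ∀ s ∈ Icc (0 : ℝ) 1, ∀ r ∈ Icc (0 : ℝ) 1, α s ≠ r * ω ∧ α s ≠ r * ω ^ 3)
    (hβr : ∀ s ∈ Icc (0 : ℝ) 1, ∀ r ∈ Icc (0 : ℝ) 1, β s ≠ r * 1 ∧ β s ≠ r * ω ^ 2) :
    ∃ s ∈ Icc (0 : ℝ) 1, ∃ t ∈ Icc (0 : ℝ) 1, α s = β t := by
  by_contra! hαβ
  have hω0 : ω ≠ 0 := fun h => by simp [h] at him
  have hω1 : ω ≠ 1 := fun h => by simp [h] at him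
  have hnsq : ω.re * ω.re + ω.im * ω.im = 1 := by
    rw [← Complex.normSq_apply, Complex.normSq_eq_norm_sq, hω, one_pow]
  have hω3 : ω ^ 3 ≠ 1 := fun h => by
    have h2 : ω ^ 2 + ω + 1 = 0 := by
      have : (ω - 1) * (ω ^ 2 + ω + 1) = 0 := by linear_combination h
      exact (mul_eq_zero.1 this).resolve_left (sub_ne_zero.2 hω1)
    have h3 := congrArg Complex.im h2
    simp [pow_two] at h3
    nlinarith
  have hα0' : ‖α 0‖ = 1 := by simp [hα0]
  have hα1' : ‖α 1‖ = 1 := by simp [hα1, hω]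
  have hβ0' : ‖β 0‖ = 1 := by simp [hβ0, hω]
  have hβ1' : ‖β 1‖ = 1 := by simp [hβ1, hω]
  have hαβ' : α 0 ≠ β 0 ∧ α 0 ≠ β 1 ∧ α 1 ≠ β 0 ∧ α 1 ≠ β 1 := by
    rw [hα0, hα1, hβ0, hβ1]
    refine ⟨hω1.symm, hω3.symm, fun h => hω1 ?_, fun h => hω1 ?_⟩
    · exact mul_left_cancel₀ hω0 (by linear_combination h)
    · exact mul_left_cancel₀ (pow_ne_zero 2 hω0) (by linear_combination -h)
  have hscale : ∀ {x y : ℂ} {r r' : ℝ}, ‖x‖ = 1 → ‖y‖ = 1 → x ≠ y → 0 < r → 0 < r' →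
      (r : ℂ) * x ≠ r' * y := by
    intro x y r r' hx hy hxy hr hr' h
    have h1 := congrArg norm h
    rw [norm_mul, norm_mul, hx, hy, mul_one, mul_one, Complex.norm_real, Complex.norm_real,
      Real.norm_of_nonneg hr.le, Real.norm_of_nonneg hr'.le] at h1
    rw [h1] at h
    exact hxy (mul_left_cancel₀ (by exact_mod_cast hr'.ne') h)
  have hne : ∀ s t, expExtend α s ≠ expExtend β t := by
    intro s t
    rcases expExtend_cases α s with ⟨hs, hs'⟩ | ⟨r, hr, hr1, hs⟩ <;>
      rcases expExtend_cases β t with ⟨ht, ht'⟩ | ⟨r', hr', hr1', ht⟩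
    · rw [hs', ht']
      exact hαβ s hs t ht
    · have := hαr s hs r' ⟨hr'.le, hr1'⟩
      rw [hs']
      rcases ht with ht | ht
      · rw [ht, hβ0]
        exact this.1
      · rw [ht, hβ1]
        exact this.2
    · have := hβr t ht r ⟨hr.le, hr1⟩
      rw [ht']
      rcases hs with hs | hs
      · rw [hs, hα0]
        exact this.1.symm
      · rw [hs, hα1]
        exact this.2.symm
    · obtain ⟨h1, h2, h3, h4⟩ := hαβ'
      rcases hs with hs | hs <;> rcases ht with ht | ht <;> rw [hs, ht] <;> apply hscale <;>
        assumption
  have hα00 : ∀ s ∈ Icc (0 : ℝ) 1, α s ≠ 0 := fun s hs => by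
    simpa using (hαr s hs 0 (by simp)).1
  have hβ00 : ∀ s ∈ Icc (0 : ℝ) 1, β s ≠ 0 := fun s hs => by
    simpa using (hβr s hs 0 (by simp)).1
  obtain ⟨S₁, hS₁⟩ := exists_exp_le_norm_expExtend hα hα0' hα1' hα00
  obtain ⟨S₂, hS₂⟩ := exists_exp_le_norm_expExtend hβ hβ0' hβ1' hβ00
  let S := max 0 (max S₁ S₂)
  have hS0 : 0 ≤ S := le_max_left _ _
  have hSα := hS₁ S ((le_max_left _ _).trans (le_max_right _ _))
  have hSβ := hS₂ S ((le_max_right _ _).trans (le_max_right _ _))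
  obtain ⟨g, hgc, hg⟩ := exists_continuous_log
    (f := fun z : ℝ × ℝ => expExtend α z.1 - expExtend β z.2)
    (((continuous_expExtend hα).comp continuous_fst).sub
      ((continuous_expExtend hβ).comp continuous_snd)) fun z => sub_ne_zero.2 (hne _ _)
  have hαa : expExtend α (-S) = Real.exp (-S) * α 0 := expExtend_of_nonpos (by linarith)
  have hαb : expExtend α (S + 1) = Real.exp (-S) * α 1 := by
    rw [expExtend_of_one_le (by linarith)]
    ring_nf
  have hβa : expExtend β (-S) = Real.exp (-S) * β 0 := expExtend_of_nonpos (by linarith)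
  have hβb : expExtend β (S + 1) = Real.exp (-S) * β 1 := by
    rw [expExtend_of_one_le (by linarith)]
    ring_nf
  have hκ : (Real.exp (-S) : ℂ) ≠ 0 := by exact_mod_cast (Real.exp_pos _).ne'
  have hnorm : ∀ x : ℂ, ‖x‖ = 1 → ‖(Real.exp (-S) : ℂ) * x‖ = Real.exp (-S) := fun x hx => by
    rw [norm_mul, hx, mul_one, Complex.norm_real, Real.norm_of_nonneg (Real.exp_pos _).le]
  have hmem1 : -S ∈ Icc (-S) (S + 1) := ⟨le_rfl, by linarith⟩
  have hmem2 : S + 1 ∈ Icc (-S) (S + 1) := ⟨by linarith, le_rfl⟩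
  let ρ : ℝ → ℂ := fun t => (expExtend α (S + 1) - expExtend β t) /
    (expExtend α (-S) - expExtend β t)
  have hρ : ∀ t ∈ Icc (-S) (S + 1), ρ t ∈ Complex.slitPlane := fun t ht =>
    sub_div_sub_mem_slitPlane (by rw [hαb, hnorm _ hα1']; exact hSβ t ht)
      (by rw [hαa, hnorm _ hα0']; exact hSβ t ht) (hne _ _) (hne _ _)
  let σ : ℝ → ℂ := fun s => (expExtend β (S + 1) - expExtend α s) /
    (expExtend β (-S) - expExtend α s)
  have hσ : ∀ s ∈ Icc (-S) (S + 1), σ s ∈ Complex.slitPlane := fun s hs =>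
    sub_div_sub_mem_slitPlane (by rw [hβb, hnorm _ hβ1']; exact hSα s hs)
      (by rw [hβa, hnorm _ hβ0']; exact hSα s hs) (hne _ _).symm (hne _ _).symm
  have hρc : Continuous ρ := (continuous_const.sub (continuous_expExtend hβ)).div₀
    (continuous_const.sub (continuous_expExtend hβ)) fun t => sub_ne_zero.2 (hne _ _)
  have hσc : Continuous σ := (continuous_const.sub (continuous_expExtend hα)).div₀
    (continuous_const.sub (continuous_expExtend hα)) fun t => sub_ne_zero.2 (hne _ _).symm
  have e1 := eqOn_sub_of_exp_eq (isPreconnected_Icc (a := -S) (b := S + 1))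
    (g := fun t => g (S + 1, t) - g (-S, t)) (h := fun t => Complex.log (ρ t))
    (by fun_prop) (hρc.continuousOn.clog hρ) (fun t ht => by
      rw [Complex.exp_sub, hg, hg, Complex.exp_log (Complex.slitPlane_ne_zero (hρ t ht))])
    hmem2 hmem1
  have e2 := eqOn_sub_of_exp_eq (isPreconnected_Icc (a := -S) (b := S + 1))
    (g := fun s => g (s, S + 1) - g (s, -S)) (h := fun s => Complex.log (σ s))
    (by fun_prop) (hσc.continuousOn.clog hσ) (fun s hs => by
      rw [Complex.exp_sub, hg, hg, Complex.exp_log (Complex.slitPlane_ne_zero (hσ s hs)),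
        ← neg_sub (expExtend β _), ← neg_sub (expExtend β _), neg_div_neg_eq])
    hmem2 hmem1
  have e3 : (ρ (S + 1)).arg - (ρ (-S)).arg = (σ (S + 1)).arg - (σ (-S)).arg := by
    have h3 := congrArg Complex.im
      (show Complex.log (ρ (S + 1)) - Complex.log (ρ (-S))
        = Complex.log (σ (S + 1)) - Complex.log (σ (-S)) by linear_combination e2 - e1)
    simpa only [Complex.sub_im, Complex.log_im] using h3
  have hω1' : 1 - ω ≠ 0 := sub_ne_zero.2 hω1.symm
  have hω1'' : ω - 1 ≠ 0 := sub_ne_zero.2 hω1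
  have hω3' : 1 - ω ^ 3 ≠ 0 := sub_ne_zero.2 hω3.symm
  have hω3'' : ω ^ 3 - 1 ≠ 0 := sub_ne_zero.2 hω3
  have v1 : ρ (-S) = -ω := by
    simp only [ρ, hαa, hαb, hβa, ← mul_sub, mul_div_mul_left _ _ hκ, hα0, hα1, hβ0]
    field_simp
    ring
  have v3 : σ (S + 1) = -ω := by
    simp only [σ, hαb, hβa, hβb, ← mul_sub, mul_div_mul_left _ _ hκ, hα1, hβ0, hβ1]
    have : ω - ω ^ 2 ≠ 0 := by
      rw [show ω - ω ^ 2 = ω * (1 - ω) by ring]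
      exact mul_ne_zero hω0 hω1'
    field_simp
    ring
  have v4 : σ (-S) = 1 + ω + ω ^ 2 := by
    simp only [σ, hαa, hβa, hβb, ← mul_sub, mul_div_mul_left _ _ hκ, hα0, hβ0, hβ1]
    field_simp
    ring
  have v2 : ρ (S + 1) * (1 + 2 * ω.re : ℝ) = ω := by
    have hc : ((2 * ω.re : ℝ) : ℂ) = ω + (starRingEnd ℂ) ω := (Complex.add_conj ω).symm
    have hcc : ω * (starRingEnd ℂ) ω = 1 := by
      rw [Complex.mul_conj, Complex.normSq_eq_norm_sq, hω]
      simp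
    simp only [ρ, hαa, hαb, hβb, ← mul_sub, mul_div_mul_left _ _ hκ, hα0, hα1, hβ1]
    push_cast at hc ⊢
    rw [div_mul_eq_mul_div, div_eq_iff hω3', hc]
    linear_combination (ω - ω ^ 2) * hcc
  have i1 : (ρ (-S)).arg < 0 := by
    rw [Complex.arg_neg_iff, v1, Complex.neg_im]
    linarith
  have i3 : (σ (S + 1)).arg < 0 := by
    rw [Complex.arg_neg_iff, v3, Complex.neg_im]
    linarith
  have i4 : 0 ≤ (σ (-S)).arg := by
    rw [Complex.arg_nonneg_iff, v4]
    simp [pow_two]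
    nlinarith
  have i2 : 0 ≤ (ρ (S + 1)).arg := by
    rw [Complex.arg_nonneg_iff]
    have := congrArg Complex.im v2
    rw [Complex.im_mul_ofReal] at this
    by_contra! h
    nlinarith
  linarith

end Crossing

section Jordan

open Metric Real

theorem IsCompact.continuousOn_invFunOn {X Y : Type*} [TopologicalSpace X] [TopologicalSpace Y]
    [T2Space Y] [Nonempty X] {K : Set X} (hK : IsCompact K) {f : X → Y} (hf : ContinuousOn f K)
    (hinj : InjOn f K) : ContinuousOn (Function.invFunOn f K) (f '' K) := by
  rw [continuousOn_iff_isClosed]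
  intro t ht
  refine ⟨f '' (K ∩ t), ((hK.inter_right ht).image_of_continuousOn
    (hf.mono inter_subset_left)).isClosed, ?_⟩
  ext y
  constructor
  · rintro ⟨h1, x, hx, rfl⟩
    refine ⟨⟨x, ⟨hx, ?_⟩, rfl⟩, x, hx, rfl⟩
    rwa [mem_preimage, hinj.leftInvOn_invFunOn hx] at h1
  · rintro ⟨⟨x, ⟨hx, hxt⟩, rfl⟩, h2⟩
    refine ⟨?_, h2⟩
    rwa [mem_preimage, hinj.leftInvOn_invFunOn hx]

theorem isPreconnected_setOf_lt_norm {R : ℝ} (hR : 0 < R) :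
    IsPreconnected {z : ℂ | R < ‖z‖} := by
  have h : {z : ℂ | R < ‖z‖} = Complex.exp '' {w : ℂ | log R < w.re} := by
    ext z
    constructor
    · intro hz
      have hz : R < ‖z‖ := hz
      have hz0 : z ≠ 0 := norm_pos_iff.1 (hR.trans hz)
      refine ⟨Complex.log z, ?_, Complex.exp_log hz0⟩
      rw [Set.mem_ofPred_eq, Complex.log_re]
      exact log_lt_log hR hz
    · rintro ⟨w, hw, rfl⟩
      rw [Set.mem_ofPred_eq, Complex.norm_exp]
      exact (log_lt_iff_lt_exp hR).1 hw
  rw [h]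
  exact ((convex_halfSpace_re_gt _).isPreconnected).image _ Complex.continuous_exp.continuousOn

theorem isConnected_compl_of_not_isBounded {K : Set ℂ} (hK : IsCompact K)
    (h : ∀ p ∉ K, ¬ Bornology.IsBounded (connectedComponentIn Kᶜ p)) : IsConnected Kᶜ := by
  obtain ⟨R, hR0, hR⟩ := hK.isBounded.exists_pos_norm_le
  have hE : {z : ℂ | R < ‖z‖} ⊆ Kᶜ := fun z hz hzK => (hR z hzK).not_gt hz
  have h0 : ((R + 1 : ℝ) : ℂ) ∈ {z : ℂ | R < ‖z‖} := by
    rw [Set.mem_ofPred_eq, Complex.norm_real, norm_of_nonneg (by linarith)]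
    linarith
  refine ⟨⟨_, hE h0⟩, ?_⟩
  refine isPreconnected_of_forall ((R + 1 : ℝ) : ℂ) fun p hp => ?_
  refine ⟨connectedComponentIn Kᶜ p, connectedComponentIn_subset _ _, ?_,
    mem_connectedComponentIn hp, isPreconnected_connectedComponentIn⟩
  obtain ⟨q, hq, hqR⟩ : ∃ q ∈ connectedComponentIn Kᶜ p, R < ‖q‖ := by
    by_contra! hcon
    exact h p hp (isBounded_iff_forall_norm_le.2 ⟨R, hcon⟩)
  rw [connectedComponentIn_eq hq]
  exact (isPreconnected_setOf_lt_norm hR0).subset_connectedComponentIn hqR hE h0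

theorem HasLog.of_arc {σ : ℝ → ℂ} {a b : ℝ} (hab : a ≤ b) (hσ : ContinuousOn σ (Icc a b))
    (hinj : InjOn σ (Icc a b)) {f : ℂ → ℂ} (hf : ContinuousOn f (σ '' Icc a b))
    (h0 : ∀ z ∈ σ '' Icc a b, f z ≠ 0) : HasLog (σ '' Icc a b) f := by
  have h1 : HasLog (Icc a b) fun t => f (σ t) :=
    HasLog.of_Icc hab (hf.comp hσ (mapsTo_image _ _)) fun t ht => h0 _ (mem_image_of_mem _ ht)
  have h2 := h1.comp (isCompact_Icc.continuousOn_invFunOn hσ hinj) (fun z hz => by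
    obtain ⟨t, ht, rfl⟩ := hz
    rwa [hinj.leftInvOn_invFunOn ht])
  refine h2.congr fun z hz => ?_
  obtain ⟨t, ht, rfl⟩ := hz
  rw [hinj.leftInvOn_invFunOn ht]

theorem isConnected_compl_arc {σ : ℝ → ℂ} {a b : ℝ} (hab : a ≤ b)
    (hσ : ContinuousOn σ (Icc a b)) (hinj : InjOn σ (Icc a b)) : IsConnected (σ '' Icc a b)ᶜ := by
  have hK : IsCompact (σ '' Icc a b) := isCompact_Icc.image_of_continuousOn hσ
  refine isConnected_compl_of_not_isBounded hK fun p hp =>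
    not_isBounded_component_of_hasLog hK.isClosed hp ?_
  exact HasLog.of_arc hab hσ hinj (by fun_prop) fun z hz =>
    sub_ne_zero.2 fun h => hp (h ▸ hz)

theorem hasLog_compl_arc {σ : ℝ → ℂ} {a b : ℝ} (hab : a ≤ b)
    (hσ : ContinuousOn σ (Icc a b)) (hinj : InjOn σ (Icc a b)) :
    HasLog (σ '' Icc a b)ᶜ fun z => (z - σ a) / (z - σ b) := by
  have hK : IsCompact (σ '' Icc a b) := isCompact_Icc.image_of_continuousOn hσ
  refine HasLog.of_isCompact hK.isClosed.isOpen_compl (isConnected_compl_arc hab hσ hinj)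
    fun L hL hLc => ?_
  exact hasLog_div_of_isPreconnected hLc.isClosed (isPreconnected_Icc.image _ hσ)
    (subset_compl_comm.1 hL) (mem_image_of_mem _ (left_mem_Icc.2 hab))
    (mem_image_of_mem _ (right_mem_Icc.2 hab))

/-- The union of two arcs with only their end points in common separates the plane. -/
theorem not_isPreconnected_compl_union {A B : Set ℂ} (hA : IsClosed A) (hB : IsClosed B) {a b : ℂ}
    (hab : a ≠ b) (hAB : A ∩ B ⊆ {a, b}) (haA : a ∈ A) (haB : a ∈ B) (hbA : b ∈ A) (hbB : b ∈ B)
    (hne : (A ∪ B)ᶜ.Nonempty)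
    (hlA : HasLog Aᶜ fun z => (z - a) / (z - b)) (hlB : HasLog Bᶜ fun z => (z - a) / (z - b)) :
    ¬ IsPreconnected (A ∪ B)ᶜ := by
  classical
  intro hpc
  obtain ⟨g, hg, hgf⟩ := hlA
  obtain ⟨h, hh, hhf⟩ := hlB
  obtain ⟨z₀, hz₀⟩ := hne
  have hsA : (A ∪ B)ᶜ ⊆ Aᶜ := compl_subset_compl.2 subset_union_left
  have hsB : (A ∪ B)ᶜ ⊆ Bᶜ := compl_subset_compl.2 subset_union_right
  have hdiff : ∀ z ∈ (A ∪ B)ᶜ, g z - h z = g z₀ - h z₀ := fun z hz =>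
    eqOn_sub_of_exp_eq hpc (hg.mono hsA) (hh.mono hsB)
      (fun x hx => by rw [hgf x (hsA hx), hhf x (hsB hx)]) hz hz₀
  let G : ℂ → ℂ := fun z => if z ∈ A then h z + (g z₀ - h z₀) else g z
  have hG1 : ∀ z ∉ A, G z = g z := fun z hz => if_neg hz
  have hG2 : ∀ z ∉ B, G z = h z + (g z₀ - h z₀) := fun z hz => by
    by_cases hzA : z ∈ A
    · exact if_pos hzA
    · rw [hG1 z hzA, ← hdiff z (by simp [hz, hzA])]
      ring
  have hexp : Complex.exp (g z₀ - h z₀) = 1 := by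
    rw [Complex.exp_sub, hgf _ (hsA hz₀), hhf _ (hsB hz₀), div_self]
    refine div_ne_zero (sub_ne_zero.2 ?_) (sub_ne_zero.2 ?_)
    · rintro rfl
      exact hz₀ (Or.inl haA)
    · rintro rfl
      exact hz₀ (Or.inl hbA)
  have hcov : ∀ z, z ≠ a → z ≠ b → z ∉ A ∨ z ∉ B := fun z h1 h2 => by
    by_contra! hz
    rcases hAB hz with h | h
    exacts [h1 h, h2 h]
  have hGlog : HasLog {a, b}ᶜ fun z => (z - a) / (z - b) := by
    refine ⟨G, fun z hz => ?_, fun z hz => ?_⟩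
    · simp only [mem_compl_iff, mem_insert_iff, mem_singleton_iff, not_or] at hz
      refine ContinuousAt.continuousWithinAt ?_
      rcases hcov z hz.1 hz.2 with hzA | hzB
      · exact (hg.continuousAt (hA.isOpen_compl.mem_nhds hzA)).congr
          (eventually_of_mem (hA.isOpen_compl.mem_nhds hzA) fun w hw => (hG1 w hw).symm)
      · exact ((hh.continuousAt (hB.isOpen_compl.mem_nhds hzB)).add continuousAt_const).congr
          (eventually_of_mem (hB.isOpen_compl.mem_nhds hzB) fun w hw => (hG2 w hw).symm)
    · simp only [mem_compl_iff, mem_insert_iff, mem_singleton_iff, not_or] at hz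
      rcases hcov z hz.1 hz.2 with hzA | hzB
      · rw [hG1 z hzA, hgf z hzA]
      · rw [hG2 z hzB, Complex.exp_add, hexp, mul_one, hhf z hzB]
  have hab' : 0 < ‖a - b‖ := norm_pos_iff.2 (sub_ne_zero.2 hab)
  have hr : 0 < ‖a - b‖ / 2 := by positivity
  have hb0 : ∀ z ∈ sphere a (‖a - b‖ / 2), z ≠ a ∧ z ≠ b := by
    intro z hz
    rw [mem_sphere, dist_eq_norm] at hz
    constructor
    · rintro rfl
      rw [sub_self, norm_zero] at hz
      linarith
    · rintro rfl
      rw [norm_sub_rev] at hz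
      linarith
  refine not_hasLog_sphere a hr ?_
  have h1 : HasLog (sphere a (‖a - b‖ / 2)) fun z => 1 + (z - a) / (a - b) := by
    refine HasLog.of_slitPlane (by fun_prop) fun z hz => ?_
    refine Complex.mem_slitPlane_of_norm_lt_one ?_
    rw [mem_sphere, dist_eq_norm] at hz
    rw [norm_div, hz, div_div, div_lt_one (by positivity)]
    linarith
  have h2 := ((hGlog.mono fun z hz => by
    have := hb0 z hz
    simp [this.1, this.2]).mul h1).mul
    (HasLog.const (K := sphere a (‖a - b‖ / 2)) (sub_ne_zero.2 hab))
  refine h2.congr fun z hz => ?_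
  have h3 : z - b ≠ 0 := sub_ne_zero.2 (hb0 z hz).2
  have h4 : a - b ≠ 0 := sub_ne_zero.2 hab
  field_simp
  ring

end Jordan

section JordanCurves

open Metric Real

/-- `γ` parametrizes a Jordan curve by the unit circle. -/
def IsJordanCurve (γ : ℂ → ℂ) : Prop := ContinuousOn γ (sphere 0 1) ∧ InjOn γ (sphere 0 1)

theorem exp_ofReal_mul_I_mem_sphere (t : ℝ) : Complex.exp (t * Complex.I) ∈ sphere (0 : ℂ) 1 := by
  rw [mem_sphere_zero_iff_norm, Complex.norm_exp_ofReal_mul_I]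

theorem exp_arg_mul_I {z : ℂ} (hz : z ∈ sphere (0 : ℂ) 1) :
    Complex.exp (z.arg * Complex.I) = z := by
  have := Complex.norm_mul_exp_arg_mul_I z
  rwa [mem_sphere_zero_iff_norm.1 hz, Complex.ofReal_one, one_mul] at this

theorem continuous_exp_mul_I : Continuous fun t : ℝ => Complex.exp (t * Complex.I) := by
  fun_prop

namespace IsJordanCurve

variable {γ : ℂ → ℂ}

theorem isCompact_image (h : IsJordanCurve γ) : IsCompact (γ '' sphere 0 1) :=
  (isCompact_sphere _ _).image_of_continuousOn h.1

theorem isPreconnected_image (h : IsJordanCurve γ) : IsPreconnected (γ '' sphere 0 1) :=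
  (isPreconnected_sphere (by rw [Complex.rank_real_complex]; norm_num) _ _).image _ h.1

theorem comp_neg (h : IsJordanCurve γ) : IsJordanCurve fun z => γ (-z) := by
  refine ⟨h.1.comp continuous_neg.continuousOn fun z hz => by simpa using hz,
    fun z hz w hw hzw => ?_⟩
  exact neg_injective (h.2 (by simpa using hz) (by simpa using hw) hzw)

theorem continuousOn_arc (h : IsJordanCurve γ) (s : Set ℝ) :
    ContinuousOn (fun t : ℝ => γ (Complex.exp (t * Complex.I))) s :=
  h.1.comp continuous_exp_mul_I.continuousOn fun t _ => exp_ofReal_mul_I_mem_sphere t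

theorem injOn_arc (h : IsJordanCurve γ) :
    InjOn (fun t : ℝ => γ (Complex.exp (t * Complex.I))) (Icc (-(π / 2)) (π / 2)) := by
  intro t ht s hs hts
  have h1 := h.2 (exp_ofReal_mul_I_mem_sphere t) (exp_ofReal_mul_I_mem_sphere s) hts
  have h2 : Circle.exp t = Circle.exp s := Subtype.ext (by simpa using h1)
  exact Circle.exp_injOn_Icc (by linarith [pi_pos]) ht hs h2

theorem exists_isBounded (h : IsJordanCurve γ) :
    ∃ p ∉ γ '' sphere 0 1, Bornology.IsBounded (connectedComponentIn (γ '' sphere 0 1)ᶜ p) := by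
  by_contra! hcon
  have hconn := isConnected_compl_of_not_isBounded h.isCompact_image hcon
  have hle : -(π / 2) ≤ π / 2 := by linarith [pi_pos]
  let α : ℝ → ℂ := fun t => γ (Complex.exp (t * Complex.I))
  let β : ℝ → ℂ := fun t => γ (-Complex.exp (t * Complex.I))
  have hβ := h.comp_neg
  let A := α '' Icc (-(π / 2)) (π / 2)
  let B := β '' Icc (-(π / 2)) (π / 2)
  have hexp1 : Complex.exp ((-(π / 2) : ℝ) * Complex.I) = -Complex.I := by
    push_cast
    rw [neg_mul, Complex.exp_neg, Complex.exp_pi_div_two_mul_I, Complex.inv_I]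
  have hexp2 : Complex.exp ((π / 2 : ℝ) * Complex.I) = Complex.I := by
    push_cast
    exact Complex.exp_pi_div_two_mul_I
  have e1 : α (-(π / 2)) = γ (-Complex.I) := congrArg γ hexp1
  have e2 : α (π / 2) = γ Complex.I := congrArg γ hexp2
  have e3 : β (-(π / 2)) = γ Complex.I := congrArg γ (by rw [hexp1, neg_neg])
  have e4 : β (π / 2) = γ (-Complex.I) := congrArg γ (by rw [hexp2])
  have hI : Complex.I ∈ sphere (0 : ℂ) 1 := by simp
  have hI' : -Complex.I ∈ sphere (0 : ℂ) 1 := by simp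
  have hA : IsClosed A := (isCompact_Icc.image_of_continuousOn (h.continuousOn_arc _)).isClosed
  have hB : IsClosed B := (isCompact_Icc.image_of_continuousOn (hβ.continuousOn_arc _)).isClosed
  have hJ : A ∪ B = γ '' sphere 0 1 := by
    refine Subset.antisymm (union_subset ?_ ?_) ?_
    · rintro _ ⟨t, -, rfl⟩
      exact mem_image_of_mem _ (exp_ofReal_mul_I_mem_sphere t)
    · rintro _ ⟨t, -, rfl⟩
      exact mem_image_of_mem _ (by simp)
    · rintro _ ⟨v, hv, rfl⟩
      rcases le_total 0 v.re with h0 | h0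
      · refine Or.inl ⟨v.arg, ?_, congrArg γ (exp_arg_mul_I hv)⟩
        exact abs_le.1 (Complex.abs_arg_le_pi_div_two_iff.2 h0)
      · refine Or.inr ⟨(-v).arg, ?_, congrArg γ ?_⟩
        · exact abs_le.1 (Complex.abs_arg_le_pi_div_two_iff.2 (by simpa using h0))
        · rw [exp_arg_mul_I (by simpa using hv), neg_neg]
  have hre : ∀ t ∈ Icc (-(π / 2)) (π / 2), 0 ≤ (Complex.exp (t * Complex.I)).re := fun t ht => by
    rw [Complex.exp_ofReal_mul_I_re]
    exact cos_nonneg_of_mem_Icc ht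
  have hAB : A ∩ B ⊆ {γ Complex.I, γ (-Complex.I)} := by
    rintro _ ⟨⟨t, ht, rfl⟩, s, hs, hts⟩
    have h1 := h.2 (by simp)
      (exp_ofReal_mul_I_mem_sphere t) hts
    have h2 := hre t ht
    have h3 := hre s hs
    have h4 : (Complex.exp (t * Complex.I)).re = 0 := by
      have := congrArg Complex.re h1
      rw [Complex.neg_re] at this
      linarith
    rw [Complex.exp_ofReal_mul_I_re] at h4
    have h5 : sin t = 1 ∨ sin t = -1 := by
      have := sin_sq_add_cos_sq t
      rw [h4] at this
      exact sq_eq_one_iff.1 (by linarith)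
    have h6 : Complex.exp (t * Complex.I) = sin t * Complex.I := by
      rw [Complex.exp_mul_I, ← Complex.ofReal_cos, h4]
      simp
    rcases h5 with h5 | h5
    · left
      exact congrArg γ (by rw [h6, h5]; simp)
    · right
      exact congrArg γ (by rw [h6, h5]; simp)
  have hne : γ Complex.I ≠ γ (-Complex.I) := fun h0 => by
    have := congrArg Complex.im (h.2 hI hI' h0)
    norm_num at this
  have mA1 : γ Complex.I ∈ A := ⟨π / 2, right_mem_Icc.2 hle, e2⟩
  have mA2 : γ (-Complex.I) ∈ A := ⟨-(π / 2), left_mem_Icc.2 hle, e1⟩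
  have mB1 : γ Complex.I ∈ B := ⟨-(π / 2), left_mem_Icc.2 hle, e3⟩
  have mB2 : γ (-Complex.I) ∈ B := ⟨π / 2, right_mem_Icc.2 hle, e4⟩
  have lA := hasLog_compl_arc hle (h.continuousOn_arc _) h.injOn_arc
  have lB := hasLog_compl_arc hle (hβ.continuousOn_arc _) hβ.injOn_arc
  rw [← hJ] at hconn
  refine not_isPreconnected_compl_union hA hB hne hAB mA1 mB1 mA2 mB2 hconn.1 ?_ ?_ hconn.2
  · refine lA.inv.congr fun z _ => ?_
    rw [inv_div, ← e1, ← e2]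
  · refine lB.congr fun z _ => ?_
    rw [← e3, ← e4]

theorem hasLog_diff (h : IsJordanCurve γ) {v : ℂ} (hv : v ∈ sphere (0 : ℂ) 1) {f : ℂ → ℂ}
    (hf : ContinuousOn f (γ '' sphere 0 1)) (h0 : ∀ z ∈ γ '' sphere 0 1, f z ≠ 0) :
    HasLog (γ '' sphere 0 1 \ {γ v}) f := by
  have hv1 : ‖v‖ = 1 := by simpa using hv
  have hv0 : v ≠ 0 := fun h0 => by simp [h0] at hv1
  have hm : ∀ t : ℝ, -v * Complex.exp (t * Complex.I) ∈ sphere (0 : ℂ) 1 := fun t => by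
    rw [mem_sphere_zero_iff_norm, norm_mul, norm_neg, hv1, Complex.norm_exp_ofReal_mul_I, mul_one]
  have hc : Continuous fun t : ℝ => f (γ (-v * Complex.exp (t * Complex.I))) := by
    rw [← continuousOn_univ]
    refine hf.comp (h.1.comp (by fun_prop) fun t _ => hm t) fun t _ => mem_image_of_mem _ (hm t)
  obtain ⟨g, hg, hgf⟩ := exists_continuous_log hc fun t => h0 _ (mem_image_of_mem _ (hm t))
  let φ := Function.invFunOn γ (sphere 0 1)
  have hφ : ContinuousOn φ (γ '' sphere 0 1) := (isCompact_sphere _ _).continuousOn_invFunOn h.1 h.2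
  have hslit : ∀ z ∈ γ '' sphere 0 1 \ {γ v}, -(φ z / v) ∈ Complex.slitPlane := by
    rintro _ ⟨⟨w, hw, rfl⟩, hwv⟩
    have e : φ (γ w) = w := h.2.leftInvOn_invFunOn hw
    rw [e]
    by_contra hcon
    rw [Complex.mem_slitPlane_iff_not_le_zero, not_not] at hcon
    have h1 : ‖w / v‖ = 1 := by
      rw [norm_div, hv1, mem_sphere_zero_iff_norm.1 hw, div_one]
    obtain ⟨h2, h3⟩ := Complex.le_def.1 hcon
    have h2 : w / v = ‖w / v‖ := Complex.eq_coe_norm_of_nonneg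
      (Complex.le_def.2 ⟨by simpa using h2, by simpa [eq_comm] using h3⟩)
    rw [h1, Complex.ofReal_one, div_eq_one_iff_eq hv0] at h2
    exact hwv (by rw [h2]; rfl)
  refine ⟨fun z => g (-(φ z / v)).arg, ?_, ?_⟩
  · refine hg.comp_continuousOn fun z hz => ?_
    exact (Complex.continuousAt_arg (hslit z hz)).comp_continuousWithinAt (f := fun z => -(φ z / v))
      (((hφ.mono sdiff_subset).div_const v).neg z hz)
  · rintro _ ⟨⟨w, hw, rfl⟩, -⟩
    have e : φ (γ w) = w := h.2.leftInvOn_invFunOn hw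
    simp only []
    rw [e, hgf, exp_arg_mul_I]
    · congr 2
      field_simp
    · rw [mem_sphere_zero_iff_norm, norm_neg, norm_div, hv1, mem_sphere_zero_iff_norm.1 hw, div_one]

theorem frontier_component (h : IsJordanCurve γ) {p : ℂ} (hp : p ∉ γ '' sphere 0 1)
    (hb : Bornology.IsBounded (connectedComponentIn (γ '' sphere 0 1)ᶜ p)) :
    frontier (connectedComponentIn (γ '' sphere 0 1)ᶜ p) = γ '' sphere 0 1 := by
  have hsub := frontier_connectedComponentIn_subset h.isCompact_image.isClosed p
  refine hsub.antisymm ?_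
  rintro _ ⟨v, hv, rfl⟩
  by_contra hcon
  refine not_hasLog_frontier hb (mem_connectedComponentIn hp) ?_
  refine (h.hasLog_diff hv (f := fun z => z - p) (by fun_prop) fun z hz =>
    sub_ne_zero.2 fun e => hp (e ▸ hz)).mono fun z hz => ⟨hsub hz, ?_⟩
  rintro rfl
  exact hcon hz

theorem hasLog_component (h : IsJordanCurve γ) {p : ℂ} (hp : p ∉ γ '' sphere 0 1)
    (hb : Bornology.IsBounded (connectedComponentIn (γ '' sphere 0 1)ᶜ p)) {a : ℂ}
    (ha : a ∈ γ '' sphere 0 1) :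
    HasLog (connectedComponentIn (γ '' sphere 0 1)ᶜ p) fun z => z - a := by
  let J := γ '' sphere 0 1
  have hJ := h.isCompact_image
  obtain ⟨q, hq, hqmax⟩ := hJ.exists_isMaxOn ⟨a, ha⟩ continuous_norm.continuousOn
  have hqmax : ∀ z ∈ γ '' sphere 0 1, ‖z‖ ≤ ‖q‖ := hqmax
  have hq0 : 0 < ‖q‖ := by
    by_contra! hcon
    have hz : ∀ z ∈ sphere (0 : ℂ) 1, γ z = 0 := fun z hz =>
      norm_le_zero_iff.1 ((hqmax _ (mem_image_of_mem _ hz)).trans hcon)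
    have h1 : (1 : ℂ) ∈ sphere (0 : ℂ) 1 := by simp
    have h2 : (-1 : ℂ) ∈ sphere (0 : ℂ) 1 := by simp
    have := congrArg Complex.re (h.2 h1 h2 ((hz _ h1).trans (hz _ h2).symm))
    norm_num at this
  let ray : ℝ → ℂ := fun t => t * q
  have hray : Continuous ray := by fun_prop
  have hnray : ∀ t : ℝ, 0 ≤ t → ‖ray t‖ = t * ‖q‖ := fun t ht => by
    rw [norm_mul, Complex.norm_real, norm_of_nonneg ht]
  have hrayJ : ∀ t : ℝ, 1 < t → ray t ∉ J := fun t ht hm => by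
    have := hqmax _ hm
    rw [hnray t (by linarith)] at this
    nlinarith
  have hrayb : ∀ s : ℝ, ¬ Bornology.IsBounded (ray '' Ici s) := fun s hs => by
    obtain ⟨R, hR0, hR⟩ := hs.exists_pos_norm_le
    have h1 := hR _ (mem_image_of_mem ray (show max s (max 0 (R / ‖q‖ + 1)) ∈ Ici s from
      mem_Ici.2 (le_max_left _ _)))
    rw [hnray _ ((le_max_left _ _).trans (le_max_right _ _))] at h1
    have h2 : (R / ‖q‖ + 1) * ‖q‖ ≤ max s (max 0 (R / ‖q‖ + 1)) * ‖q‖ :=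
      mul_le_mul_of_nonneg_right ((le_max_right _ _).trans (le_max_right _ _)) hq0.le
    have h3 : (R / ‖q‖ + 1) * ‖q‖ = R + ‖q‖ := by
      field_simp
    linarith
  refine HasLog.of_isCompact hJ.isClosed.isOpen_compl.connectedComponentIn
    (isConnected_connectedComponentIn_iff.2 hp) fun L hL hLc => ?_
  refine hasLog_sub_of_unbounded (C := J ∪ ray '' Ici 1) hLc ?_ ?_
    (fun hbd => hrayb 1 (hbd.subset subset_union_right)) (Or.inl ha)
  · exact h.isPreconnected_image.union q hq ⟨1, by simp, by simp [ray]⟩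
      (isPreconnected_Ici.image _ hray.continuousOn)
  · rintro z hz hzL
    have hzU := hL hzL
    rcases hz with hz | ⟨t, ht, rfl⟩
    · exact connectedComponentIn_subset _ _ hzU hz
    · rcases (show (1 : ℝ) ≤ t from ht).eq_or_lt with rfl | ht
      · refine connectedComponentIn_subset _ _ hzU ?_
        simpa [ray] using hq
      · refine hrayb t (hb.subset ?_)
        rw [connectedComponentIn_eq hzU]
        refine (isPreconnected_Ici.image _ hray.continuousOn).subset_connectedComponentIn
          ⟨t, self_mem_Ici, rfl⟩ ?_
        rintro _ ⟨s, hs, rfl⟩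
        exact hrayJ s (ht.trans_le hs)

end IsJordanCurve

end JordanCurves

section HarmonicCritical

open Metric Real

theorem exists_path_of_superlevel {U : Set ℂ} (hU : IsOpen U) (hb : Bornology.IsBounded U)
    {v : ℂ → ℝ} (hv : Continuous v) (hs : ∀ z ∈ U, HarmAt v z) {c : ℝ}
    (hp : IsPreconnected (frontier U ∩ {z | c < v z})) {x y : ℂ} (hx : x ∈ U) (hy : y ∈ U)
    (hcx : c < v x) (hcy : c < v y) :
    ∃ α : ℝ → ℂ, Continuous α ∧ α 0 = x ∧ α 1 = y ∧ ∀ s, c < v (α s) := by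
  let O : Set ℂ := {z | c < v z}
  have hO : IsOpen O := isOpen_lt continuous_const hv
  have hmeet : ∀ x ∈ U, x ∈ O → (connectedComponentIn O x ∩ frontier U).Nonempty := by
    intro x hx hxO
    by_contra hcon
    rw [not_nonempty_iff_eq_empty] at hcon
    have hxW := mem_connectedComponentIn hxO
    have hWO : IsOpen (connectedComponentIn O x) := hO.connectedComponentIn
    have hWU : connectedComponentIn O x ⊆ U := by
      refine isPreconnected_connectedComponentIn.subset_of_closure_inter_subset hU ⟨x, hxW, hx⟩ ?_
      rintro z ⟨hz1, hz2⟩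
      by_contra hzU
      have : z ∈ connectedComponentIn O x ∩ frontier U := ⟨hz2, by
        rw [hU.frontier_eq]
        exact ⟨hz1, hzU⟩⟩
      rw [hcon] at this
      exact this
    have hfr : ∀ z ∈ frontier (connectedComponentIn O x), v z ≤ c := by
      intro z hz
      have h1 := frontier_connectedComponentIn_subset (K := Oᶜ) hO.isClosed_compl x
      rw [compl_compl] at h1
      exact not_lt.1 (h1 hz)
    have := le_of_subM hWO (hb.subset hWU) hv.continuousOn (fun z hz => (hs z (hWU hz)).subM) hfr x
      (subset_closure hxW)
    exact (not_lt.2 this) hxO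
  obtain ⟨x', hx', hxf⟩ := hmeet x hx hcx
  obtain ⟨y', hy', hyf⟩ := hmeet y hy hcy
  have hyx : y ∈ connectedComponentIn O x := by
    have h1 := hp.subset_connectedComponentIn (F := O)
      (⟨hxf, connectedComponentIn_subset _ _ hx'⟩ : x' ∈ frontier U ∩ {z | c < v z})
      inter_subset_right (⟨hyf, connectedComponentIn_subset _ _ hy'⟩ :
        y' ∈ frontier U ∩ {z | c < v z})
    rw [connectedComponentIn_eq hx', connectedComponentIn_eq h1, ← connectedComponentIn_eq hy']
    exact mem_connectedComponentIn hcy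
  have hpc : IsPathConnected (connectedComponentIn O x) :=
    hO.connectedComponentIn.isConnected_iff_isPathConnected.1
      (isConnected_connectedComponentIn_iff.2 hcx)
  obtain ⟨γ, hγ⟩ := hpc.joinedIn x (mem_connectedComponentIn hcx) y hyx
  refine ⟨γ.extend, γ.continuous_extend, γ.extend_zero, γ.extend_one, fun s => ?_⟩
  have h1 : γ.extend s ∈ range γ := by
    rw [← γ.extend_range]
    exact mem_range_self s
  obtain ⟨t, ht⟩ := h1
  rw [← ht]
  have h2 : γ t ∈ O := connectedComponentIn_subset _ _ (hγ t)
  exact h2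

theorem AnalyticAt.eventually_eq_of_re_eq {F : ℂ → ℂ} {z : ℂ} (hF : AnalyticAt ℂ F z) {c : ℝ}
    (h : ∀ᶠ w in 𝓝 z, (F w).re = c) : ∀ᶠ w in 𝓝 z, F w = F z := by
  refine hF.eventually_constant_or_nhds_le_map_nhds.resolve_right fun hle => ?_
  have h1 : {w : ℂ | w.re = c} ∈ 𝓝 (F z) := hle h
  obtain ⟨ε, hε, hb⟩ := Metric.mem_nhds_iff.1 h1
  have h2 : (F z).re = c := hb (mem_ball_self hε)
  have h3 : (F z + (ε / 2 : ℝ)).re = c := hb (by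
    rw [mem_ball, dist_eq_norm, add_sub_cancel_left, Complex.norm_real,
      norm_of_nonneg (by positivity)]
    linarith)
  rw [Complex.add_re, Complex.ofReal_re, h2] at h3
  linarith

theorem eqOn_const_of_harmAt {U : Set ℂ} (hUc : IsPreconnected U) {h : ℂ → ℝ}
    (hh : ∀ z ∈ U, HarmAt h z) {c : ℝ} {z₀ : ℂ} (hz₀ : z₀ ∈ U) (hc : ∀ᶠ w in 𝓝 z₀, h w = c) :
    ∀ z ∈ U, h z = c := by
  let V : Set ℂ := {z | ∀ᶠ w in 𝓝 z, h w = c}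
  have hV : IsOpen V := isOpen_iff_mem_nhds.2 fun z hz => eventually_eventually_nhds.2 hz
  have hsub : U ⊆ V := by
    refine hUc.subset_of_closure_inter_subset hV ⟨z₀, hz₀, hc⟩ ?_
    rintro z ⟨hz, hzU⟩
    obtain ⟨r, hr, F, hF, hFe⟩ := hh z hzU
    obtain ⟨w, hwb, hwV⟩ := mem_closure_iff.1 hz _ isOpen_ball (mem_ball_self hr)
    have han : AnalyticOnNhd ℂ F (ball z r) := fun x hx => hF.analyticAt (isOpen_ball.mem_nhds hx)
    have h1 : ∀ᶠ x in 𝓝 w, (F x).re = c := by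
      filter_upwards [hwV, isOpen_ball.mem_nhds hwb] with x hx hxb
      rw [← hFe x hxb, hx]
    have h2 := AnalyticAt.eventually_eq_of_re_eq (han w hwb) h1
    have h3 := han.eqOn_of_preconnected_of_eventuallyEq (g := fun _ => F w)
      (fun x _ => analyticAt_const) (convex_ball z r).isPreconnected hwb h2
    filter_upwards [isOpen_ball.mem_nhds (mem_ball_self hr)] with x hx
    rw [hFe x hx, h3 hx]
    exact h1.self_of_nhds
  exact fun z hz => (hsub hz).self_of_nhds

/-- At a critical point of a nonconstant holomorphic function, its real part alternates in sign
along equally spaced directions. -/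
theorem exists_saddle_directions {F : ℂ → ℂ} {z₀ : ℂ} (hF : AnalyticAt ℂ F z₀)
    (hd : deriv F z₀ = 0) (hnc : ¬ ∀ᶠ w in 𝓝 z₀, F w = F z₀) {N : Set ℂ} (hN : N ∈ 𝓝 z₀) :
    ∃ d ω : ℂ, d ≠ 0 ∧ ‖ω‖ = 1 ∧ 0 < ω.im ∧ 0 ≤ ω.re ∧ ∀ j : ℕ, ∀ r ∈ Ioc (0 : ℝ) 1,
      z₀ + r * d * ω ^ j ∈ N ∧
        0 < (-1) ^ j * ((F (z₀ + r * d * ω ^ j)).re - (F z₀).re) := by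
  have hf : AnalyticAt ℂ (fun w => F w - F z₀) z₀ := hF.sub analyticAt_const
  obtain ⟨k, g, hg, hg0, hfg⟩ := hf.exists_eventuallyEq_pow_smul_nonzero_iff.2 fun h =>
    hnc (h.mono fun w hw => sub_eq_zero.1 hw)
  have hk0 : k ≠ 0 := by
    rintro rfl
    have := hfg.self_of_nhds
    simp at this
    exact hg0 this.symm
  have hk1 : k ≠ 1 := by
    rintro rfl
    have h1 : HasDerivAt (fun w => (w - z₀) ^ 1 • g w) (g z₀) z₀ := by
      have := ((hasDerivAt_id z₀).sub_const z₀).mul hg.differentiableAt.hasDerivAt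
      simp only [id_eq, sub_self, zero_mul, add_zero, one_mul] at this
      refine this.congr_of_eventuallyEq (Eventually.of_forall fun w => ?_)
      simp
    have h2 : HasDerivAt (fun w => F w - F z₀) (g z₀) z₀ := h1.congr_of_eventuallyEq hfg
    have h3 : HasDerivAt F (g z₀) z₀ := by simpa using h2.add_const (F z₀)
    exact hg0 (h3.deriv ▸ hd)
  have hk : 2 ≤ k := by omega
  have hkr : (2 : ℝ) ≤ k := by exact_mod_cast hk
  have hkc : (k : ℂ) ≠ 0 := by exact_mod_cast hk0
  let β : ℝ := (g z₀).arg
  let e : ℂ := Complex.exp (-(β * Complex.I))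
  have he0 : 0 < (e * g z₀).re := by
    have h1 : e * g z₀ = ‖g z₀‖ := by
      conv_lhs => rw [← Complex.norm_mul_exp_arg_mul_I (g z₀)]
      simp only [e]
      rw [mul_left_comm, ← Complex.exp_add]
      simp [β]
    rw [h1, Complex.ofReal_re]
    exact norm_pos_iff.2 hg0
  have hpos : ∀ᶠ w in 𝓝 z₀, 0 < (e * g w).re :=
    ((Complex.continuous_re.continuousAt.comp
      (continuousAt_const.mul hg.continuousAt)).eventually (lt_mem_nhds he0))
  obtain ⟨ε, hε, hball⟩ := Metric.eventually_nhds_iff_ball.1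
    ((hpos.and hfg).and (show ∀ᶠ w in 𝓝 z₀, w ∈ N from hN))
  let ω : ℂ := Complex.exp ((π / k : ℝ) * Complex.I)
  let d : ℂ := (ε / 2 : ℝ) * Complex.exp ((-β / k : ℝ) * Complex.I)
  have hω1 : ‖ω‖ = 1 := Complex.norm_exp_ofReal_mul_I _
  have hdn : ‖d‖ = ε / 2 := by
    simp only [d]
    rw [norm_mul, Complex.norm_exp_ofReal_mul_I, mul_one, Complex.norm_real,
      norm_of_nonneg (by positivity)]
  have hωk : ω ^ k = -1 := by
    simp only [ω]
    rw [← Complex.exp_nat_mul, ← Complex.exp_pi_mul_I]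
    congr 1
    push_cast
    field_simp
  have hdk : d ^ k = ((ε / 2) ^ k : ℝ) * e := by
    simp only [d, e]
    rw [mul_pow, ← Complex.exp_nat_mul]
    congr 1
    · push_cast
      rfl
    · congr 1
      push_cast
      field_simp
  have hπk : π / k ≤ π / 2 := by
    gcongr
  have hπk0 : 0 < π / k := by positivity
  refine ⟨d, ω, ?_, hω1, ?_, ?_, ?_⟩
  · rw [← norm_pos_iff, hdn]
    positivity
  · simp only [ω]
    rw [Complex.exp_ofReal_mul_I_im]
    exact sin_pos_of_pos_of_lt_pi hπk0 (by linarith [pi_pos])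
  · simp only [ω]
    rw [Complex.exp_ofReal_mul_I_re]
    exact cos_nonneg_of_mem_Icc ⟨by linarith, hπk⟩
  · intro j r hr
    have hmem : z₀ + r * d * ω ^ j ∈ ball z₀ ε := by
      rw [mem_ball, dist_eq_norm, add_sub_cancel_left, norm_mul, norm_mul, norm_pow, hω1, one_pow,
        mul_one, hdn, Complex.norm_real, norm_of_nonneg hr.1.le]
      nlinarith [hr.1, hr.2]
    obtain ⟨⟨h1, h2⟩, h3⟩ := hball _ hmem
    refine ⟨h3, ?_⟩
    have h4 : F (z₀ + r * d * ω ^ j) - F z₀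
        = ((-1) ^ j * (r ^ k * (ε / 2) ^ k) : ℝ) * (e * g (z₀ + r * d * ω ^ j)) := by
      rw [h2, add_sub_cancel_left, smul_eq_mul, mul_pow, mul_pow, ← pow_mul, mul_comm j k, pow_mul,
        hωk, hdk]
      push_cast
      ring
    rw [← Complex.sub_re, h4, Complex.re_ofReal_mul]
    have h5 : ((-1 : ℝ)) ^ j * (-1) ^ j = 1 := by
      rw [← mul_pow]
      simp
    have h6 : 0 < (r ^ k * (ε / 2) ^ k) * (e * g (z₀ + r * d * ω ^ j)).re :=
      mul_pos (mul_pos (pow_pos hr.1 _) (by positivity)) h1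
    calc 0 < ((-1 : ℝ) ^ j * (-1) ^ j) *
          ((r ^ k * (ε / 2) ^ k) * (e * g (z₀ + r * d * ω ^ j)).re) := by rwa [h5, one_mul]
      _ = _ := by ring

/-- A harmonic function whose boundary values have connected super- and sublevel sets has no
critical points. -/
theorem deriv_ne_zero_of_isPreconnected_levels {U : Set ℂ} (hU : IsOpen U) (hUc : IsPreconnected U)
    (hb : Bornology.IsBounded U) {h : ℂ → ℝ} (hc : ContinuousOn h (closure U))
    (hh : ∀ z ∈ U, HarmAt h z) (hp : ∀ c, IsPreconnected (frontier U ∩ {z | c < h z}))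
    (hm : ∀ c, IsPreconnected (frontier U ∩ {z | h z < c})) {x y : ℂ} (hx : x ∈ frontier U)
    (hy : y ∈ frontier U) (hxy : h x ≠ h y) {z₀ : ℂ} (hz₀ : z₀ ∈ U) {F : ℂ → ℂ}
    (hF : AnalyticAt ℂ F z₀) (hFh : ∀ᶠ w in 𝓝 z₀, h w = (F w).re) : deriv F z₀ ≠ 0 := by
  intro hd
  have hnc : ¬ ∀ᶠ w in 𝓝 z₀, F w = F z₀ := by
    intro hcon
    have h1 := eqOn_const_of_harmAt hUc hh (c := (F z₀).re) hz₀ (by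
      filter_upwards [hcon, hFh] with w h1 h2
      rw [h2, h1])
    have h2 : EqOn h (fun _ => (F z₀).re) (closure U) :=
      EqOn.of_subset_closure h1 hc continuousOn_const subset_closure Subset.rfl
    exact hxy ((h2 (frontier_subset_closure hx)).trans (h2 (frontier_subset_closure hy)).symm)
  obtain ⟨H, hH⟩ := ContinuousMap.exists_restrict_eq (isClosed_closure (s := U))
    ⟨(closure U).domRestrict h, continuousOn_iff_continuous_domRestrict.1 hc⟩
  have hHh : ∀ z ∈ closure U, H z = h z := fun z hz => congrArg (fun f => f ⟨z, hz⟩) hH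
  have hHU : ∀ z ∈ U, H z = h z := fun z hz => hHh z (subset_closure hz)
  have hHarm : ∀ z ∈ U, HarmAt H z := fun z hz =>
    (hh z hz).congr (eventually_of_mem (hU.mem_nhds hz) hHU)
  obtain ⟨d, ω, hd0, hω, him, hre, hdir⟩ := exists_saddle_directions hF hd hnc
    (Filter.inter_mem (hU.mem_nhds hz₀) hFh)
  have hF0 : (F z₀).re = H z₀ := by rw [hHU z₀ hz₀, hFh.self_of_nhds]
  have hdir' : ∀ j : ℕ, ∀ r ∈ Ioc (0 : ℝ) 1, z₀ + r * d * ω ^ j ∈ U ∧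
      0 < (-1) ^ j * (H (z₀ + r * d * ω ^ j) - H z₀) := by
    intro j r hr
    obtain ⟨⟨h1, h2⟩, h3⟩ := hdir j r hr
    have h2 : h (z₀ + r * d * ω ^ j) = (F (z₀ + r * d * ω ^ j)).re := h2
    refine ⟨h1, ?_⟩
    rwa [hHU _ h1, h2, ← hF0]
  have hone : (1 : ℝ) ∈ Ioc (0 : ℝ) 1 := by simp
  have heven : ∀ j : ℕ, Even j → ∀ r ∈ Icc (0 : ℝ) 1, H z₀ ≤ H (z₀ + r * d * ω ^ j) := by
    intro j hj r hr
    rcases hr.1.eq_or_lt with rfl | h0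
    · simp
    · have := (hdir' j r ⟨h0, hr.2⟩).2
      rw [hj.neg_one_pow] at this
      linarith
  have hodd : ∀ j : ℕ, Odd j → ∀ r ∈ Icc (0 : ℝ) 1, H (z₀ + r * d * ω ^ j) ≤ H z₀ := by
    intro j hj r hr
    rcases hr.1.eq_or_lt with rfl | h0
    · simp
    · have := (hdir' j r ⟨h0, hr.2⟩).2
      rw [hj.neg_one_pow] at this
      linarith
  have hpos : ∀ j : ℕ, Even j → H z₀ < H (z₀ + (1 : ℝ) * d * ω ^ j) := fun j hj => by
    have := (hdir' j 1 hone).2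
    rw [hj.neg_one_pow] at this
    linarith
  have hneg : ∀ j : ℕ, Odd j → H (z₀ + (1 : ℝ) * d * ω ^ j) < H z₀ := fun j hj => by
    have := (hdir' j 1 hone).2
    rw [hj.neg_one_pow] at this
    linarith
  have hfr : ∀ z ∈ frontier U, H z = h z := fun z hz => hHh z (frontier_subset_closure hz)
  obtain ⟨α, hα, hα0, hα1, hαc⟩ := exists_path_of_superlevel hU hb H.continuous hHarm (c := H z₀)
    (by
      convert hp (H z₀) using 1
      ext z
      exact and_congr_right fun hz => by simp only [Set.mem_ofPred_eq, hfr z hz])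
    (hdir' 0 1 hone).1 (hdir' 2 1 hone).1 (hpos 0 (by decide)) (hpos 2 (by decide))
  obtain ⟨β, hβ, hβ0, hβ1, hβc⟩ := exists_path_of_superlevel hU hb (v := fun z => -1 * H z)
    (by fun_prop) (fun z hz => (hHarm z hz).const_mul (-1)) (c := -1 * H z₀)
    (by
      convert hm (H z₀) using 1
      ext z
      exact and_congr_right fun hz => by simp [hfr z hz])
    (hdir' 1 1 hone).1 (hdir' 3 1 hone).1 (by linarith [hneg 1 (by decide)])
    (by linarith [hneg 3 (by decide)])
  have hmk : ∀ {x w : ℂ} {r : ℝ}, (x - z₀) / d = r * w → x = z₀ + r * d * w := by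
    intro x w r hx
    rw [div_eq_iff hd0] at hx
    linear_combination hx
  have hquot : ∀ {x w : ℂ}, x = z₀ + (1 : ℝ) * d * w → (x - z₀) / d = w := by
    rintro x w rfl
    rw [add_sub_cancel_left, Complex.ofReal_one, one_mul, mul_div_cancel_left₀ _ hd0]
  obtain ⟨s, -, t, -, hst⟩ := exists_crossing hω him hre (α := fun s => (α s - z₀) / d)
    (β := fun s => (β s - z₀) / d) (by fun_prop) (by fun_prop)
    ((hquot hα0).trans (pow_zero _)) (hquot hα1) ((hquot hβ0).trans (pow_one _)) (hquot hβ1)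
    (fun s _ r hr => ⟨fun e => by
        have h1 := hodd 1 (by decide) r hr
        rw [pow_one, ← hmk e] at h1
        exact (hαc s).not_ge h1,
      fun e => by
        have h1 := hodd 3 (by decide) r hr
        rw [← hmk e] at h1
        exact (hαc s).not_ge h1⟩)
    (fun s _ r hr => ⟨fun e => by
        have h1 := heven 0 (by decide) r hr
        rw [pow_zero, ← hmk e] at h1
        linarith [hβc s],
      fun e => by
        have h1 := heven 2 (by decide) r hr
        rw [← hmk e] at h1
        linarith [hβc s]⟩)
  have h1 : α s = β t := by
    have := congrArg (fun x => x * d) hst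
    simp only [div_mul_cancel₀ _ hd0] at this
    exact sub_left_injective this
  have h2 := hαc s
  rw [h1] at h2
  linarith [hβc t]

end HarmonicCritical

section ProperLocalHomeo

open Metric

/-- A proper local homeomorphism from a bounded domain to the unit disc is bijective. -/
theorem bijOn_ball_of_isLocalHomeomorphOn {U : Set ℂ} (hU : IsOpen U) (hUc : IsConnected U)
    (hb : Bornology.IsBounded U) {u : ℂ → ℂ} (hu : ContinuousOn u (closure U))
    (hloc : IsLocalHomeomorphOn u U) (hUb : MapsTo u U (ball 0 1))
    (hfr : MapsTo u (frontier U) (sphere 0 1)) : BijOn u U (ball 0 1) := by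
  have hcpt : IsCompact (closure U) := hb.isCompact_closure
  have hcs : CompactSpace (closure U) := isCompact_iff_compactSpace.1 hcpt
  let p : closure U → ℂ := fun z => u z
  have hp : Continuous p := continuousOn_iff_continuous_domRestrict.1 hu
  let j : U → closure U := inclusion subset_closure
  have hj : IsOpenEmbedding j :=
    .of_continuous_injective_isOpenMap (continuous_inclusion subset_closure)
      (inclusion_injective subset_closure) (hU.isOpenMap_inclusion subset_closure)
  have hmem : ∀ z : closure U, p z ∈ ball (0 : ℂ) 1 → (z : ℂ) ∈ U := by
    intro z hz
    by_contra hcon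
    have h1 := hfr (show (z : ℂ) ∈ frontier U from hU.frontier_eq ▸ ⟨z.2, hcon⟩)
    exact (ne_of_mem_of_not_mem hz (sphere_disjoint_ball.notMem_of_mem_left h1)) rfl
  have hploc : IsLocalHomeomorphOn p (p ⁻¹' ball 0 1) := by
    have h1 : IsLocalHomeomorphOn (p ∘ j) univ :=
      hloc.comp (f := ((↑) : U → ℂ)) hU.isOpenEmbedding_subtypeVal.isLocalHomeomorph.isLocalHomeomorphOn
        fun z _ => z.2
    refine (h1.of_comp_right hj.isLocalHomeomorph.isLocalHomeomorphOn).mono fun z hz => ?_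
    exact ⟨⟨z, hmem z hz⟩, mem_univ _, rfl⟩
  have hcov : IsCoveringMapOn p (ball 0 1) := IsCoveringMapOn.of_isLocalHomeomorphOn hp hploc
  obtain ⟨e₀, he₀⟩ := hUc.nonempty
  have hcon : ContractibleSpace (ball (0 : ℂ) 1) :=
    (convex_ball (0 : ℂ) 1).contractibleSpace ⟨_, hUb he₀⟩
  have hlpc : LocallyPathConnectedSpace (ball (0 : ℂ) 1) := isOpen_ball.locallyPathConnectedSpace
  obtain ⟨F, ⟨hF0, hF⟩, -⟩ := hcov.existsUnique_continuousMap_lifts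
    (⟨Subtype.val, continuous_subtype_val⟩ : C(ball (0 : ℂ) 1, ℂ)) (a₀ := ⟨u e₀, hUb he₀⟩)
    (e₀ := ⟨e₀, subset_closure he₀⟩) rfl (fun a => a.2)
  have hF : ∀ a, u (F a) = a := fun a => congrFun hF a
  have hFU : ∀ a, (F a : ℂ) ∈ U := fun a => hmem _ (by
    have : p (F a) = a := hF a
    rw [this]
    exact a.2)
  let V : Set ℂ := {z | ∃ h : z ∈ U, (F ⟨u z, hUb h⟩ : ℂ) = z}
  have hK : Continuous fun z : U => (F ⟨u z, hUb z.2⟩ : ℂ) := by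
    have : Continuous fun z : U => (⟨u z, hUb z.2⟩ : ball (0 : ℂ) 1) :=
      Continuous.subtype_mk (continuousOn_iff_continuous_domRestrict.1 (hu.mono subset_closure)) _
    fun_prop
  have hV : V = ((↑) : U → ℂ) '' {z : U | (F ⟨u z, hUb z.2⟩ : ℂ) = z} := by
    ext z
    constructor
    · rintro ⟨h, hz⟩
      exact ⟨⟨z, h⟩, hz, rfl⟩
    · rintro ⟨z, hz, rfl⟩
      exact ⟨z.2, hz⟩
  have hVo : IsOpen V := by
    rw [hV]
    refine hU.isOpenMap_subtype_val _ (isOpen_iff_mem_nhds.2 fun z hz => ?_)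
    obtain ⟨e, hze, hue⟩ := hloc z z.2
    have hz : (F ⟨u z, hUb z.2⟩ : ℂ) = z := hz
    have h1 : ∀ᶠ w : U in 𝓝 z, (F ⟨u w, hUb w.2⟩ : ℂ) ∈ e.source :=
      hK.continuousAt.eventually (e.open_source.mem_nhds (by
        have h0 : (F ⟨u z, hUb z.2⟩ : ℂ) ∈ e.source := hz.symm ▸ hze
        exact h0))
    have h2 : ∀ᶠ w : U in 𝓝 z, (w : ℂ) ∈ e.source :=
      continuous_subtype_val.continuousAt.eventually (e.open_source.mem_nhds hze)
    filter_upwards [h1, h2] with w hw1 hw2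
    refine e.injOn hw1 hw2 ?_
    rw [← hue, hF]
  have hUV : U ⊆ V := by
    refine hUc.isPreconnected.subset_of_closure_inter_subset hVo
      ⟨e₀, he₀, he₀, by rw [hF0]⟩ ?_
    rintro z ⟨hz, hzU⟩
    have hcl : IsClosed {z : U | (F ⟨u z, hUb z.2⟩ : ℂ) = z} :=
      isClosed_eq hK continuous_subtype_val
    rw [hV] at hz
    have h3 : (⟨z, hzU⟩ : U) ∈ closure {z : U | (F ⟨u z, hUb z.2⟩ : ℂ) = z} := by
      rw [closure_subtype]
      exact hz
    rw [hcl.closure_eq] at h3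
    exact ⟨hzU, h3⟩
  refine ⟨hUb, fun z hz w hw hzw => ?_, fun a ha => ⟨F ⟨a, ha⟩, hFU _, hF _⟩⟩
  obtain ⟨hz', h1⟩ := hUV hz
  obtain ⟨hw', h2⟩ := hUV hw
  rw [← h1, ← h2]
  congr 2
  exact Subtype.ext hzw

end ProperLocalHomeo

section DiscParametrization

open Metric

theorem isPreconnected_sphere_inter_lt_re {w : ℂ} (hw : w ≠ 0) (c : ℝ) :
    IsPreconnected (sphere (0 : ℂ) 1 ∩ {v | c < (w * v).re}) := by
  have hre : ∀ t : ℝ, (w * Complex.exp ((t - w.arg : ℝ) * Complex.I)).re = ‖w‖ * Real.cos t := by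
    intro t
    have h1 : w * Complex.exp ((t - w.arg : ℝ) * Complex.I) =
        ‖w‖ * Complex.exp (t * Complex.I) := by
      have h2 : w * Complex.exp ((t - w.arg : ℝ) * Complex.I) = (‖w‖ * Complex.exp (w.arg * Complex.I))
          * Complex.exp ((t - w.arg : ℝ) * Complex.I) := by rw [Complex.norm_mul_exp_arg_mul_I]
      rw [h2, mul_assoc, ← Complex.exp_add]
      push_cast
      congr 2
      ring
    rw [h1, Complex.re_ofReal_mul, Complex.exp_ofReal_mul_I_re]
  have hS : sphere (0 : ℂ) 1 ∩ {v | c < (w * v).re} =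
      (fun t : ℝ => Complex.exp ((t - w.arg : ℝ) * Complex.I)) ''
        (Icc (-Real.pi) Real.pi ∩ {t | c < ‖w‖ * Real.cos t}) := by
    ext v
    constructor
    · rintro ⟨hv, hcv⟩
      have hE : Complex.exp (((w * v).arg - w.arg : ℝ) * Complex.I) = v := by
        have h1 := Complex.norm_mul_exp_arg_mul_I (w * v)
        have h2 := Complex.norm_mul_exp_arg_mul_I w
        rw [norm_mul, mem_sphere_zero_iff_norm.1 hv, mul_one] at h1
        have h3 : (‖w‖ : ℂ) ≠ 0 := by simpa using hw
        rw [Complex.ofReal_sub, sub_mul, Complex.exp_sub, div_eq_iff (Complex.exp_ne_zero _)]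
        refine mul_left_cancel₀ h3 (h1.trans ?_)
        conv_lhs => rw [← h2]
        ring
      refine ⟨(w * v).arg, ⟨⟨(Complex.neg_pi_lt_arg _).le, Complex.arg_le_pi _⟩, ?_⟩, hE⟩
      rw [mem_ofPred_eq, ← hre, hE]
      exact hcv
    · rintro ⟨t, ⟨-, ht⟩, rfl⟩
      refine ⟨exp_ofReal_mul_I_mem_sphere _, ?_⟩
      rw [mem_ofPred_eq, hre]
      exact ht
  rw [hS]
  refine IsPreconnected.image ?_ _ (by fun_prop)
  refine OrdConnected.isPreconnected (ordConnected_of_Ioo ?_)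
  rintro x ⟨hx, hcx⟩ y ⟨hy, hcy⟩ - z hz
  refine ⟨⟨hx.1.trans hz.1.le, hz.2.le.trans hy.2⟩, ?_⟩
  have hcos : ∀ s ∈ Icc (-Real.pi) Real.pi, |z| ≤ |s| → ‖w‖ * Real.cos s ≤ ‖w‖ * Real.cos z := by
    intro s hs hzs
    refine mul_le_mul_of_nonneg_left ?_ (norm_nonneg _)
    rw [← Real.cos_abs s, ← Real.cos_abs z]
    exact Real.cos_le_cos_of_nonneg_of_le_pi (abs_nonneg _) (abs_le.2 hs) hzs
  rcases le_total 0 z with h0 | h0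
  · refine lt_of_lt_of_le hcy (hcos y hy ?_)
    rw [abs_of_nonneg h0, abs_of_nonneg (h0.trans hz.2.le)]
    exact hz.2.le
  · refine lt_of_lt_of_le hcx (hcos x hx ?_)
    rw [abs_of_nonpos h0, abs_of_nonpos (hz.1.le.trans h0)]
    exact neg_le_neg hz.1.le

/-- A planar map with harmonic components, all of whose directional components have nonvanishing
gradient at a point, is a local homeomorphism there. -/
theorem exists_openPartialHomeomorph_of_re {u F G : ℂ → ℂ} {z : ℂ} (hF : AnalyticAt ℂ F z)
    (hG : AnalyticAt ℂ G z) (hu : ∀ᶠ x in 𝓝 z, u x = (F x).re + (G x).re * Complex.I)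
    (hd : ∀ w : ℂ, w ≠ 0 → w.re * deriv F z - w.im * deriv G z ≠ 0) :
    ∃ e : OpenPartialHomeomorph ℂ ℂ, z ∈ e.source ∧ EqOn u e e.source := by
  have hF' := (hF.hasStrictDerivAt.hasStrictFDerivAt.restrictScalars ℝ)
  have hG' := (hG.hasStrictDerivAt.hasStrictFDerivAt.restrictScalars ℝ)
  obtain ⟨L, hL, h2⟩ : ∃ L : ℂ →L[ℝ] ℂ,
      (∀ v, L v = ((v * deriv F z).re : ℂ) + (v * deriv G z).re * Complex.I) ∧
        HasStrictFDerivAt u L z := by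
    have h1 := (Complex.equivRealProdCLM.symm : (ℝ × ℝ) →L[ℝ] ℂ).hasStrictFDerivAt.comp z
      ((Complex.reCLM.hasStrictFDerivAt.comp z hF').prodMk
        (Complex.reCLM.hasStrictFDerivAt.comp z hG'))
    refine ⟨_, fun v => ?_, h1.congr_of_eventuallyEq (hu.mono fun x hx => ?_)⟩
    · simp [Complex.equivRealProdCLM_symm_apply]
    · rw [hx]
      simp [Complex.equivRealProdCLM_symm_apply]
  have hinj : Function.Injective (L : ℂ →ₗ[ℝ] ℂ) := by
    rw [← LinearMap.ker_eq_bot, LinearMap.ker_eq_bot']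
    intro v hv
    have h3 : ((v * deriv F z).re : ℂ) + (v * deriv G z).re * Complex.I = 0 :=
      (hL v).symm.trans hv
    have h4 : (v * deriv F z).re = 0 := by simpa using congrArg Complex.re h3
    have h5 : (v * deriv G z).re = 0 := by simpa using congrArg Complex.im h3
    by_contra hv0
    have h6 : v * ((v * deriv G z).im * deriv F z - (v * deriv F z).im * deriv G z) = 0 := by
      have e1 : v * deriv F z = (v * deriv F z).im * Complex.I := by
        apply Complex.ext <;> simp [h4]
      have e2 : v * deriv G z = (v * deriv G z).im * Complex.I := by
        apply Complex.ext <;> simp [h5]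
      linear_combination ((v * deriv G z).im : ℂ) * e1 - ((v * deriv F z).im : ℂ) * e2
    have h7 := (mul_eq_zero.1 h6).resolve_left hv0
    by_cases hw : (⟨(v * deriv G z).im, (v * deriv F z).im⟩ : ℂ) = 0
    · have h8 : v * deriv F z = 0 :=
        Complex.ext h4 (congrArg Complex.im hw :)
      have h9 : v * deriv G z = 0 := Complex.ext h5 (congrArg Complex.re hw :)
      have h10 := (mul_eq_zero.1 h8).resolve_left hv0
      refine hd 1 one_ne_zero ?_
      simp [h10]
    · exact hd _ hw h7
  let e : ℂ ≃L[ℝ] ℂ := (LinearEquiv.ofInjectiveEndo (L : ℂ →ₗ[ℝ] ℂ) hinj).toContinuousLinearEquiv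
  have he : (e : ℂ →L[ℝ] ℂ) = L := by
    ext x
    rfl
  rw [← he] at h2
  exact ⟨h2.toOpenPartialHomeomorph u, h2.mem_toOpenPartialHomeomorph_source, fun x _ => rfl⟩

theorem HarmAt.exists_analyticAt {u : ℂ → ℝ} {z : ℂ} (hu : HarmAt u z) :
    ∃ F : ℂ → ℂ, AnalyticAt ℂ F z ∧ ∀ᶠ x in 𝓝 z, u x = (F x).re := by
  obtain ⟨r, hr, F, hF, h⟩ := hu
  exact ⟨F, hF.analyticAt (ball_mem_nhds z hr),
    Filter.eventually_of_mem (ball_mem_nhds z hr) h⟩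

namespace IsJordanCurve

/-- A bounded complementary component of a Jordan curve is a disc, with a parametrization extending
that of the curve. -/
theorem exists_disc_parametrization {γ : ℂ → ℂ} (h : IsJordanCurve γ) {p : ℂ}
    (hp : p ∉ γ '' sphere 0 1)
    (hb : Bornology.IsBounded (connectedComponentIn (γ '' sphere 0 1)ᶜ p)) :
    ∃ Φ : ℂ → ℂ, ContinuousOn Φ (closedBall 0 1) ∧ InjOn Φ (closedBall 0 1) ∧
      EqOn Φ γ (sphere 0 1) ∧ Φ '' ball 0 1 = connectedComponentIn (γ '' sphere 0 1)ᶜ p := by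
  set J := γ '' sphere 0 1 with hJ
  set U := connectedComponentIn Jᶜ p with hUdef
  have hU : IsOpen U := h.isCompact_image.isClosed.isOpen_compl.connectedComponentIn
  have hUc : IsConnected U := ⟨⟨p, mem_connectedComponentIn hp⟩, isPreconnected_connectedComponentIn⟩
  have hfr : frontier U = J := h.frontier_component hp hb
  let φ := Function.invFunOn γ (sphere (0 : ℂ) 1)
  have hφ : ContinuousOn φ J :=
    (isCompact_sphere (0 : ℂ) 1).continuousOn_invFunOn h.1 h.2
  have hφγ : ∀ v ∈ sphere (0 : ℂ) 1, φ (γ v) = v := fun v hv => h.2.leftInvOn_invFunOn hv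
  have hlog : ∀ a ∈ frontier U, HasLog U fun z => z - a := fun a ha =>
    h.hasLog_component hp hb (by rwa [hfr] at ha)
  obtain ⟨u₁, hu₁, hh₁, hf₁⟩ := exists_harmonic hU hb hlog (f := fun z => (φ z).re)
    (hfr ▸ Complex.continuous_re.comp_continuousOn hφ)
  obtain ⟨u₂, hu₂, hh₂, hf₂⟩ := exists_harmonic hU hb hlog (f := fun z => (φ z).im)
    (hfr ▸ Complex.continuous_im.comp_continuousOn hφ)
  have hlin : ∀ w : ℂ, ∀ z ∈ U, HarmAt (fun x => w.re * u₁ x + -w.im * u₂ x) z := fun w z hz =>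
    ((hh₁ z hz).const_mul _).add ((hh₂ z hz).const_mul _)
  have hlinc : ∀ w : ℂ, ContinuousOn (fun x => w.re * u₁ x + -w.im * u₂ x) (closure U) := fun w =>
    (continuousOn_const.mul hu₁).add (continuousOn_const.mul hu₂)
  have hlinf : ∀ w : ℂ, ∀ v ∈ sphere (0 : ℂ) 1,
      w.re * u₁ (γ v) + -w.im * u₂ (γ v) = (w * v).re := fun w v hv => by
    have hv' : γ v ∈ frontier U := hfr ▸ mem_image_of_mem γ hv
    rw [hf₁ _ hv', hf₂ _ hv', hφγ v hv, Complex.mul_re]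
    ring
  let u : ℂ → ℂ := fun z => u₁ z + u₂ z * Complex.I
  have hu : ContinuousOn u (closure U) := by
    have e1 := Complex.continuous_ofReal.comp_continuousOn hu₁
    have e2 := Complex.continuous_ofReal.comp_continuousOn hu₂
    exact e1.add (e2.mul continuousOn_const)
  have huγ : ∀ v ∈ sphere (0 : ℂ) 1, u (γ v) = v := fun v hv => by
    have hv' : γ v ∈ frontier U := hfr ▸ mem_image_of_mem γ hv
    simp only [u]
    rw [hf₁ _ hv', hf₂ _ hv', hφγ v hv, Complex.re_add_im]
  have hgt : ∀ w : ℂ, w ≠ 0 → ∀ c,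
      IsPreconnected (frontier U ∩ {z | c < w.re * u₁ z + -w.im * u₂ z}) := fun w hw c => by
    have e : frontier U ∩ {z | c < w.re * u₁ z + -w.im * u₂ z} =
        γ '' (sphere (0 : ℂ) 1 ∩ {v | c < (w * v).re}) := by
      rw [hfr]
      ext z
      constructor
      · rintro ⟨⟨v, hv, rfl⟩, hz⟩
        refine ⟨v, ⟨hv, ?_⟩, rfl⟩
        rw [mem_ofPred_eq, hlinf w v hv] at hz
        exact hz
      · rintro ⟨v, ⟨hv, hz⟩, rfl⟩
        refine ⟨⟨v, hv, rfl⟩, ?_⟩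
        rw [mem_ofPred_eq, hlinf w v hv]
        exact hz
    rw [e]
    exact (isPreconnected_sphere_inter_lt_re hw c).image _ (h.1.mono inter_subset_left)
  have hlt : ∀ w : ℂ, w ≠ 0 → ∀ c,
      IsPreconnected (frontier U ∩ {z | w.re * u₁ z + -w.im * u₂ z < c}) := fun w hw c => by
    convert hgt (-w) (neg_ne_zero.2 hw) (-c) using 4 with z
    rw [Complex.neg_re, Complex.neg_im]
    constructor <;> intro h <;> linarith
  have hloc : IsLocalHomeomorphOn u U := by
    refine IsLocalHomeomorphOn.mk _ _ fun z hz => ?_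
    obtain ⟨F, hF, hFu⟩ := (hh₁ z hz).exists_analyticAt
    obtain ⟨G, hG, hGu⟩ := (hh₂ z hz).exists_analyticAt
    refine exists_openPartialHomeomorph_of_re hF hG ?_ fun w hw => ?_
    · filter_upwards [hFu, hGu] with x h1 h2
      simp only [u, h1, h2]
    · have hw0 : ‖w‖ ≠ 0 := norm_ne_zero_iff.2 hw
      let v : ℂ := (starRingEnd ℂ) w / ‖w‖
      have hv : v ∈ sphere (0 : ℂ) 1 := by
        simp [v, hw0]
      have hwv : w * v = ‖w‖ := by
        have : (‖w‖ : ℂ) ≠ 0 := by exact_mod_cast hw0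
        simp only [v]
        rw [← mul_div_assoc, Complex.mul_conj, Complex.normSq_eq_norm_sq, div_eq_iff this]
        push_cast
        ring
      have hnv : -v ∈ sphere (0 : ℂ) 1 := by simpa using hv
      have key := deriv_ne_zero_of_isPreconnected_levels (F := fun x => w.re * F x + -w.im * G x)
        hU hUc.isPreconnected hb (hlinc w) (hlin w) (hgt w hw) (hlt w hw)
        (x := γ v) (y := γ (-v)) (hfr ▸ mem_image_of_mem γ hv) (hfr ▸ mem_image_of_mem γ hnv)
        (by
          rw [hlinf w v hv, hlinf w _ hnv, mul_neg, hwv, Complex.neg_re, Complex.ofReal_re]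
          intro hcon
          exact hw0 (by linarith)) hz (by fun_prop)
        (by
          filter_upwards [hFu, hGu] with x h1 h2
          rw [h1, h2, Complex.add_re, Complex.re_ofReal_mul, ← Complex.ofReal_neg,
            Complex.re_ofReal_mul])
      have hd : deriv (fun x => w.re * F x + -w.im * G x) z =
          w.re * deriv F z - w.im * deriv G z := by
        refine (((hF.differentiableAt.hasDerivAt.const_mul (w.re : ℂ)).fun_add
          (hG.differentiableAt.hasDerivAt.const_mul (-w.im : ℂ))).deriv).trans ?_
        ring
      rwa [hd] at key
  have hnorm : ∀ z ∈ closure U, ‖u z‖ ≤ 1 := by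
    intro z hz
    by_contra! hcon
    let w : ℂ := (starRingEnd ℂ) (u z) / ‖u z‖
    have hz0 : (‖u z‖ : ℂ) ≠ 0 := by exact_mod_cast (zero_lt_one.trans hcon).ne'
    have hw : ‖w‖ = 1 := by
      simp only [w, norm_div, RCLike.norm_conj, Complex.norm_real, norm_norm]
      exact div_self (zero_lt_one.trans hcon).ne'
    have h1 : w.re * u₁ z + -w.im * u₂ z = ‖u z‖ := by
      have e1 : w.re * u₁ z + -w.im * u₂ z = (w * u z).re := by
        rw [Complex.mul_re]
        simp [u]
        ring
      rw [e1]
      have e2 : w * u z = ‖u z‖ := by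
        simp only [w]
        rw [div_mul_eq_mul_div, mul_comm, Complex.mul_conj, Complex.normSq_eq_norm_sq,
          div_eq_iff hz0]
        push_cast
        ring
      rw [e2, Complex.ofReal_re]
    have h2 := le_of_subM hU hb (hlinc w) (fun x hx => (hlin w x hx).subM) (a := 1)
      (fun x hx => by
        rw [hfr] at hx
        obtain ⟨v, hv, rfl⟩ := hx
        rw [hlinf w v hv]
        refine (Complex.re_le_norm _).trans ?_
        rw [norm_mul, hw, mem_sphere_zero_iff_norm.1 hv, mul_one]) z hz
    rw [h1] at h2
    exact h2.not_gt hcon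
  have hball : MapsTo u U (ball 0 1) := by
    have hop : IsOpen (u '' U) := by
      rw [isOpen_iff_mem_nhds]
      rintro _ ⟨z, hz, rfl⟩
      rw [← hloc.map_nhds_eq hz]
      exact image_mem_map (hU.mem_nhds hz)
    have h1 : u '' U ⊆ interior (closedBall 0 1) :=
      interior_maximal (image_subset_iff.2 fun z hz =>
        mem_closedBall_zero_iff.2 (hnorm z (subset_closure hz))) hop
    rw [interior_closedBall _ one_ne_zero] at h1
    exact image_subset_iff.1 h1
  have hfrs : MapsTo u (frontier U) (sphere 0 1) := by
    rw [hfr]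
    rintro _ ⟨v, hv, rfl⟩
    rw [huγ v hv]
    exact hv
  have hbij := bijOn_ball_of_isLocalHomeomorphOn hU hUc hb hu hloc hball hfrs
  have hclU : closure U = U ∪ J := by rw [← hfr, closure_eq_self_union_frontier]
  have hinj : InjOn u (closure U) := by
    have hdisj : Disjoint U J := disjoint_left.2 fun z hz => connectedComponentIn_subset _ _ hz
    rw [hclU, injOn_union hdisj]
    refine ⟨hbij.injOn, ?_, fun z hz x hx hzx => ?_⟩
    · rintro _ ⟨v, hv, rfl⟩ _ ⟨v', hv', rfl⟩ hvv
      rw [huγ v hv, huγ v' hv'] at hvv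
      rw [hvv]
    · exact sphere_disjoint_ball.notMem_of_mem_left (hfrs (hfr ▸ hx)) (hzx ▸ hball hz)
  have himg : u '' closure U = closedBall 0 1 := by
    rw [hclU, image_union, hbij.image_eq, ← ball_union_sphere]
    congr 1
    ext v
    constructor
    · rintro ⟨_, ⟨v', hv', rfl⟩, rfl⟩
      rwa [huγ v' hv']
    · exact fun hv => ⟨γ v, mem_image_of_mem γ hv, huγ v hv⟩
  have hΦu : ∀ z ∈ closure U, Function.invFunOn u (closure U) (u z) = z := fun z hz =>
    hinj.leftInvOn_invFunOn hz
  refine ⟨Function.invFunOn u (closure U), ?_, ?_, fun v hv => ?_, ?_⟩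
  · rw [← himg]
    exact hb.isCompact_closure.continuousOn_invFunOn hu hinj
  · rw [← himg]
    rintro _ ⟨z, hz, rfl⟩ _ ⟨x, hx, rfl⟩ hzx
    rw [hΦu z hz, hΦu x hx] at hzx
    rw [hzx]
  · rw [← hΦu (γ v) (hclU ▸ Or.inr (mem_image_of_mem γ hv)), huγ v hv]
  · rw [← hbij.image_eq]
    ext z
    constructor
    · rintro ⟨_, ⟨x, hx, rfl⟩, rfl⟩
      rwa [hΦu x (subset_closure hx)]
    · exact fun hz => ⟨u z, mem_image_of_mem u hz, hΦu z (subset_closure hz)⟩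

end IsJordanCurve

end DiscParametrization

section Schoenflies

open Metric

/-- The closed unit disc has self-homeomorphisms fixing the boundary and moving the centre to any
prescribed interior point. -/
theorem exists_disc_push {a : ℂ} (ha : a ∈ ball (0 : ℂ) 1) :
    ∃ P : ℂ → ℂ, Continuous P ∧ Function.Injective P ∧ EqOn P id (sphere 0 1) ∧
      P '' ball 0 1 = ball 0 1 ∧ P 0 = a := by
  have ha1 : ‖a‖ < 1 := mem_ball_zero_iff.1 ha
  have hlip : ∀ x y : ℂ, ‖(((1 - ‖x‖ : ℝ) : ℂ) - ((1 - ‖y‖ : ℝ) : ℂ)) * a‖ ≤ ‖a‖ * ‖x - y‖ := by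
    intro x y
    rw [norm_mul, mul_comm, ← Complex.ofReal_sub, Complex.norm_real, Real.norm_eq_abs]
    refine mul_le_mul_of_nonneg_left ?_ (norm_nonneg _)
    rw [sub_sub_sub_cancel_left, norm_sub_rev]
    exact abs_norm_sub_norm_le _ _
  refine ⟨fun x => x + ((1 - ‖x‖ : ℝ) : ℂ) * a, by fun_prop, fun x y hxy => ?_, fun x hx => ?_,
    ?_, by simp⟩
  · have h1 : y - x = (((1 - ‖x‖ : ℝ) : ℂ) - ((1 - ‖y‖ : ℝ) : ℂ)) * a := by
      have hxy : x + ((1 - ‖x‖ : ℝ) : ℂ) * a = y + ((1 - ‖y‖ : ℝ) : ℂ) * a := hxy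
      linear_combination -hxy
    have h2 := hlip x y
    rw [← h1, norm_sub_rev] at h2
    have h3 : ‖x - y‖ = 0 := by nlinarith [norm_nonneg (x - y)]
    exact sub_eq_zero.1 (norm_eq_zero.1 h3)
  · simp [mem_sphere_zero_iff_norm.1 hx]
  · apply Subset.antisymm
    · rintro _ ⟨x, hx, rfl⟩
      have hx1 : ‖x‖ < 1 := mem_ball_zero_iff.1 hx
      rw [mem_ball_zero_iff]
      refine (norm_add_le _ _).trans_lt ?_
      rw [norm_mul, Complex.norm_real, Real.norm_of_nonneg (by linarith)]
      nlinarith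
    · intro y hy
      have hy1 : ‖y‖ < 1 := mem_ball_zero_iff.1 hy
      have hf : ContractingWith ‖a‖₊ fun x : ℂ => y - ((1 - ‖x‖ : ℝ) : ℂ) * a := by
        refine ⟨by exact_mod_cast ha1, LipschitzWith.of_dist_le_mul fun x x' => ?_⟩
        rw [dist_eq_norm, dist_eq_norm, sub_sub_sub_cancel_left, ← sub_mul, norm_sub_rev x x']
        exact hlip x' x
      have hx := hf.fixedPoint_isFixedPt
      set x := ContractingWith.fixedPoint _ hf
      have hx : y - ((1 - ‖x‖ : ℝ) : ℂ) * a = x := hx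
      refine ⟨x, mem_ball_zero_iff.2 ?_, ?_⟩
      · by_contra! hx1
        have h2 : ‖x‖ ≤ ‖y‖ + ‖((1 - ‖x‖ : ℝ) : ℂ) * a‖ := by
          conv_lhs => rw [← hx]
          exact norm_sub_le _ _
        rw [norm_mul, Complex.norm_real, Real.norm_of_nonpos (by linarith)] at h2
        nlinarith
      · linear_combination -hx

namespace IsJordanCurve

theorem connectedComponentIn_eq_of_isBounded {γ : ℂ → ℂ} (h : IsJordanCurve γ) {p q : ℂ}
    (hp : p ∉ γ '' sphere 0 1) (hq : q ∉ γ '' sphere 0 1)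
    (hbp : Bornology.IsBounded (connectedComponentIn (γ '' sphere 0 1)ᶜ p))
    (hbq : Bornology.IsBounded (connectedComponentIn (γ '' sphere 0 1)ᶜ q)) :
    connectedComponentIn (γ '' sphere 0 1)ᶜ p = connectedComponentIn (γ '' sphere 0 1)ᶜ q := by
  by_contra hne
  have hpq : p ∉ connectedComponentIn (γ '' sphere 0 1)ᶜ q := fun hcon =>
    hne (connectedComponentIn_eq hcon).symm
  obtain ⟨Φ, hΦ, -, hΦγ, himg⟩ := h.exists_disc_parametrization hq hbq
  have h0 : ∀ z ∈ closedBall (0 : ℂ) 1, Φ z - p ≠ 0 := by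
    intro z hz hzp
    rw [sub_eq_zero] at hzp
    rw [← ball_union_sphere] at hz
    rcases hz with hz | hz
    · exact hpq (himg ▸ ⟨z, hz, hzp⟩)
    · exact hp ⟨z, hz, (hΦγ hz).symm.trans hzp⟩
  have hlog := HasLog.of_closedBall (hΦ.sub continuousOn_const) h0
  have hφ := (isCompact_sphere (0 : ℂ) 1).continuousOn_invFunOn h.1 h.2
  have hmem : MapsTo (Function.invFunOn γ (sphere 0 1)) (γ '' sphere 0 1) (sphere 0 1) := by
    rintro _ ⟨v, hv, rfl⟩
    rwa [h.2.leftInvOn_invFunOn hv]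
  have h1 := (hlog.mono sphere_subset_closedBall).comp hφ hmem
  refine not_hasLog_frontier hbp (mem_connectedComponentIn hp) ?_
  rw [h.frontier_component hp hbp]
  refine h1.congr ?_
  rintro _ ⟨v, hv, rfl⟩
  simp only [h.2.leftInvOn_invFunOn hv, Pi.sub_apply, hΦγ hv]

/-- The inversion of the exterior of a Jordan curve is a bounded complementary component of the
inverted curve. -/
theorem inversion {γ : ℂ → ℂ} (h : IsJordanCurve γ) {p : ℂ} (hp : p ∉ γ '' sphere 0 1)
    (hb : Bornology.IsBounded (connectedComponentIn (γ '' sphere 0 1)ᶜ p)) :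
    IsJordanCurve (fun v => (γ v - p)⁻¹) ∧ (0 : ℂ) ∉ (fun v => (γ v - p)⁻¹) '' sphere 0 1 ∧
    Bornology.IsBounded (connectedComponentIn ((fun v => (γ v - p)⁻¹) '' sphere 0 1)ᶜ 0) ∧
    connectedComponentIn ((fun v => (γ v - p)⁻¹) '' sphere 0 1)ᶜ 0 =
      {x | x = 0 ∨ p + x⁻¹ ∉ closure (connectedComponentIn (γ '' sphere 0 1)ᶜ p)} := by
  have hfr := h.frontier_component hp hb
  set J := γ '' sphere 0 1 with hJ
  set U := connectedComponentIn Jᶜ p with hUdef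
  have hU : IsOpen U := h.isCompact_image.isClosed.isOpen_compl.connectedComponentIn
  have hpU : p ∈ U := mem_connectedComponentIn hp
  have hγp : ∀ v ∈ sphere (0 : ℂ) 1, γ v - p ≠ 0 := fun v hv hv0 =>
    hp ⟨v, hv, sub_eq_zero.1 hv0⟩
  have hγ' : IsJordanCurve fun v => (γ v - p)⁻¹ :=
    ⟨(h.1.sub continuousOn_const).inv₀ hγp, fun v hv w hw hvw =>
      h.2 hv hw (sub_left_injective (inv_injective hvw))⟩
  have hclU : closure U = U ∪ J := by rw [← hfr, closure_eq_self_union_frontier]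
  set J' := (fun v => (γ v - p)⁻¹) '' sphere 0 1 with hJ'
  set B : Set ℂ := {x | x = 0 ∨ p + x⁻¹ ∉ closure U} with hBdef
  have h0J' : (0 : ℂ) ∉ J' := by
    rintro ⟨v, hv, hv0⟩
    exact hγp v hv (inv_eq_zero.1 hv0)
  have hc : ContinuousOn (fun x : ℂ => p + x⁻¹) {0}ᶜ :=
    continuousOn_const.add (continuousOn_id.inv₀ fun x hx => hx)
  have hBb : Bornology.IsBounded B := by
    obtain ⟨r, hr, hrU⟩ := Metric.isOpen_iff.1 hU p hpU
    refine isBounded_closedBall.subset (t := closedBall (0 : ℂ) r⁻¹) ?_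
    rintro x (rfl | hx)
    · simp [hr.le]
    · by_cases hx0 : x = 0
      · simp [hx0, hr.le]
      rw [mem_closedBall_zero_iff]
      have h1 : r ≤ ‖x⁻¹‖ := by
        by_contra! hcon
        exact hx (subset_closure (hrU (by simpa [mem_ball, dist_eq_norm] using hcon)))
      rw [norm_inv] at h1
      exact (le_inv_comm₀ hr (norm_pos_iff.2 hx0)).1 h1
  have hBo : IsOpen B := by
    have hopen := hc.isOpen_inter_preimage isOpen_compl_singleton
      (isClosed_closure (s := U)).isOpen_compl
    rw [isOpen_iff_mem_nhds]
    intro x hx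
    by_cases hx0 : x = 0
    · obtain ⟨R, hR, hUR⟩ := hb.closure.subset_closedBall_lt 0 p
      refine mem_of_superset (ball_mem_nhds x (inv_pos.2 hR)) fun y hy => ?_
      by_cases hy0 : y = 0
      · exact Or.inl hy0
      refine Or.inr fun hcon => ?_
      have h1 := hUR hcon
      rw [mem_closedBall, dist_eq_norm, add_sub_cancel_left, norm_inv] at h1
      rw [hx0, mem_ball_zero_iff] at hy
      exact hy.not_ge (inv_le_of_inv_le₀ (norm_pos_iff.2 hy0) h1)
    · exact mem_of_superset (hopen.mem_nhds ⟨hx0, hx.resolve_left hx0⟩) fun y hy => Or.inr hy.2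
  let A : Set ℂ := {0}ᶜ ∩ (fun x : ℂ => p + x⁻¹) ⁻¹' U
  have hAo : IsOpen A := hc.isOpen_inter_preimage isOpen_compl_singleton hU
  have hAB : Disjoint B A := by
    refine disjoint_left.2 ?_
    rintro x (hx | hx) ⟨hx0, hxU⟩
    · exact hx0 hx
    · exact hx (subset_closure hxU)
  have hcov : J'ᶜ ⊆ B ∪ A := by
    intro x hx
    by_cases hx0 : x = 0
    · exact Or.inl (Or.inl hx0)
    by_cases hxU : p + x⁻¹ ∈ closure U
    · rw [hclU] at hxU
      rcases hxU with hxU | ⟨v, hv, hxv⟩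
      · exact Or.inr ⟨hx0, hxU⟩
      · exact absurd ⟨v, hv, by simp [hxv]⟩ hx
    · exact Or.inl (Or.inr hxU)
  have hBJ : ∀ x ∈ B, x ∉ J' := by
    rintro x hx ⟨v, hv, rfl⟩
    rcases hx with hx | hx
    · exact h0J' ⟨v, hv, hx⟩
    · refine hx (hclU ▸ Or.inr ⟨v, hv, ?_⟩)
      simp
  have hcomp : ∀ x ∈ B, connectedComponentIn J'ᶜ x ⊆ B := fun x hx =>
    isPreconnected_connectedComponentIn.subset_left_of_subset_union hBo hAo hAB
      ((connectedComponentIn_subset _ _).trans hcov) ⟨x, mem_connectedComponentIn (hBJ x hx), hx⟩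
  have h0B : (0 : ℂ) ∈ B := Or.inl rfl
  refine ⟨hγ', h0J', hBb.subset (hcomp 0 h0B), (hcomp 0 h0B).antisymm fun x hx => ?_⟩
  rw [hγ'.connectedComponentIn_eq_of_isBounded h0J' (hBJ x hx) (hBb.subset (hcomp 0 h0B))
    (hBb.subset (hcomp x hx))]
  exact mem_connectedComponentIn (hBJ x hx)

/-- The Jordan–Schoenflies theorem. -/
theorem exists_homeomorph {γ : ℂ → ℂ} (h : IsJordanCurve γ) :
    ∃ e : ℂ ≃ₜ ℂ, ∀ v ∈ sphere (0 : ℂ) 1, e v = γ v := by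
  obtain ⟨p, hp, hb⟩ := h.exists_isBounded
  obtain ⟨Φ, hΦ, hΦi, hΦγ, hΦU⟩ := h.exists_disc_parametrization hp hb
  obtain ⟨hγ', h0, hb', hU'⟩ := h.inversion hp hb
  obtain ⟨Φ', hΦ', hΦi', hΦγ', hΦU'⟩ := hγ'.exists_disc_parametrization h0 hb'
  have hfr := h.frontier_component hp hb
  have hfr' := hγ'.frontier_component h0 hb'
  rw [hU'] at hΦU'
  set U := connectedComponentIn (γ '' sphere 0 1)ᶜ p with hUdef
  have hpU : p ∈ U := mem_connectedComponentIn hp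
  have hclU : closure U = U ∪ γ '' sphere 0 1 := by rw [← hfr, closure_eq_self_union_frontier]
  have hΦcl : Φ '' closedBall 0 1 = closure U := by
    rw [← ball_union_sphere, image_union, hΦU, hclU, hΦγ.image_eq]
  obtain ⟨a, ha, ha0⟩ : (0 : ℂ) ∈ image Φ' (ball 0 1) := hΦU' ▸ Or.inl rfl
  obtain ⟨P, hP, hPi, hPs, hPb, hP0⟩ := exists_disc_push ha
  have hPsm : MapsTo P (sphere 0 1) (sphere 0 1) := fun v hv => by rwa [hPs hv]
  have hPm : MapsTo P (closedBall 0 1) (closedBall 0 1) := by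
    rw [← ball_union_sphere]
    exact MapsTo.union_union (mapsTo_iff_image_subset.2 hPb.subset) hPsm
  let Ψ : ℂ → ℂ := Φ' ∘ P
  have hΨ : ContinuousOn Ψ (closedBall 0 1) := hΦ'.comp hP.continuousOn hPm
  have hΨi : InjOn Ψ (closedBall 0 1) := hΦi'.comp hPi.injOn hPm
  have hΨγ : ∀ v ∈ sphere (0 : ℂ) 1, Ψ v = (γ v - p)⁻¹ := fun v hv => by
    have := hΦγ' (hPsm hv)
    simpa only [Ψ, Function.comp_apply, hPs hv, id] using this
  have hΨB : Ψ '' ball 0 1 = {x | x = 0 ∨ p + x⁻¹ ∉ closure U} := by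
    rw [image_comp, hPb, hΦU']
  have hΨ0 : Ψ 0 = 0 := by simp only [Ψ, Function.comp_apply, hP0, ha0]
  have h0mem : (0 : ℂ) ∈ closedBall (0 : ℂ) 1 := mem_closedBall_self zero_le_one
  let σ : ℂ → ℂ := fun z => ((starRingEnd ℂ) z)⁻¹
  have hσσ : ∀ z, σ (σ z) = z := fun z => by simp [σ]
  have hσn : ∀ z, ‖σ z‖ = ‖z‖⁻¹ := fun z => by simp [σ]
  have hσ0 : ∀ z, z ≠ 0 → σ z ≠ 0 := fun z hz => by simpa [σ] using hz
  have hσ1 : ∀ z, ‖z‖ = 1 → σ z = z := fun z hz => by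
    have h1 : z * (starRingEnd ℂ) z = 1 := by
      rw [Complex.mul_conj, Complex.normSq_eq_norm_sq, hz]
      simp
    exact (eq_inv_of_mul_eq_one_left h1).symm
  have hσm : MapsTo σ {z | 1 ≤ ‖z‖} (closedBall 0 1) := fun z hz => by
    rw [mem_closedBall_zero_iff, hσn]
    exact inv_le_one_of_one_le₀ hz
  have hσc : ContinuousOn σ {z | 1 ≤ ‖z‖} := by
    refine Complex.continuous_conj.continuousOn.inv₀ fun z hz hz0 => ?_
    have hz : 1 ≤ ‖z‖ := hz
    rw [(map_eq_zero _).1 hz0, norm_zero] at hz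
    linarith
  have hne : ∀ z : ℂ, 1 ≤ ‖z‖ → z ≠ 0 := fun z hz hz0 => by
    rw [hz0, norm_zero] at hz
    linarith
  have hΨne : ∀ z, 1 ≤ ‖z‖ → Ψ (σ z) ≠ 0 := fun z hz hz0 =>
    hσ0 z (hne z hz) (hΨi (hσm hz) h0mem (hz0.trans hΨ0.symm))
  let H : ℂ → ℂ := fun z => if ‖z‖ ≤ 1 then Φ z else p + (Ψ (σ z))⁻¹
  have hHin : ∀ z, ‖z‖ ≤ 1 → H z = Φ z := fun z hz => if_pos hz
  have hHout : ∀ z, 1 < ‖z‖ → H z = p + (Ψ (σ z))⁻¹ := fun z hz => if_neg hz.not_ge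
  have hH : Continuous H := by
    refine continuous_if_le continuous_norm continuous_const ?_ ?_ fun z hz => ?_
    · exact hΦ.mono fun z hz => mem_closedBall_zero_iff.2 hz
    · exact continuousOn_const.add ((hΨ.comp hσc hσm).inv₀ hΨne)
    · have hz' : z ∈ sphere (0 : ℂ) 1 := mem_sphere_zero_iff_norm.2 hz
      rw [hσ1 z hz, hΨγ z hz', hΦγ hz', inv_inv]
      ring
  have hHclU : ∀ z, ‖z‖ ≤ 1 → H z ∈ closure U := fun z hz => by
    rw [hHin z hz, ← hΦcl]
    exact mem_image_of_mem Φ (mem_closedBall_zero_iff.2 hz)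
  have hHclU' : ∀ z, 1 < ‖z‖ → H z ∉ closure U := fun z hz => by
    rw [hHout z hz]
    have h1 : Ψ (σ z) ∈ Ψ '' ball 0 1 := mem_image_of_mem Ψ (by
      rw [mem_ball_zero_iff, hσn]
      exact inv_lt_one_of_one_lt₀ hz)
    rw [hΨB] at h1
    exact h1.resolve_left (hΨne z hz.le)
  have hinj : Function.Injective H := by
    intro z w hzw
    rcases le_or_gt ‖z‖ 1 with hz | hz <;> rcases le_or_gt ‖w‖ 1 with hw | hw
    · rw [hHin z hz, hHin w hw] at hzw
      exact hΦi (mem_closedBall_zero_iff.2 hz) (mem_closedBall_zero_iff.2 hw) hzw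
    · exact absurd (hzw ▸ hHclU z hz) (hHclU' w hw)
    · exact absurd (hzw ▸ hHclU w hw) (hHclU' z hz)
    · rw [hHout z hz, hHout w hw] at hzw
      have h1 := hΨi (hσm hz.le) (hσm hw.le) (inv_injective (add_left_cancel hzw))
      rw [← hσσ z, h1, hσσ]
  have hsurj : Function.Surjective H := by
    intro y
    by_cases hy : y ∈ closure U
    · rw [← hΦcl] at hy
      obtain ⟨z, hz, rfl⟩ := hy
      exact ⟨z, hHin z (mem_closedBall_zero_iff.1 hz)⟩
    · have hyp : y - p ≠ 0 := fun hyp => hy (subset_closure (sub_eq_zero.1 hyp ▸ hpU))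
      have h1 : (y - p)⁻¹ ∈ Ψ '' ball 0 1 := by
        rw [hΨB]
        right
        rwa [inv_inv, add_sub_cancel]
      obtain ⟨s, hs, hsy⟩ := h1
      have hs0 : s ≠ 0 := fun hs0 => by
        rw [hs0, hΨ0] at hsy
        exact inv_ne_zero hyp hsy.symm
      refine ⟨σ s, ?_⟩
      rw [hHout, hσσ, hsy, inv_inv, add_sub_cancel]
      rw [hσn]
      exact (one_lt_inv₀ (norm_pos_iff.2 hs0)).2 (mem_ball_zero_iff.1 hs)
  have htend : Tendsto H (cocompact ℂ) (cocompact ℂ) := by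
    rw [← cobounded_eq_cocompact]
    have hev : ∀ᶠ z : ℂ in Bornology.cobounded ℂ, 1 < ‖z‖ :=
      tendsto_norm_cobounded_atTop.eventually_gt_atTop 1
    have h1 : Tendsto σ (Bornology.cobounded ℂ) (𝓝 0) := by
      rw [tendsto_zero_iff_norm_tendsto_zero]
      simp only [hσn]
      exact tendsto_inv_atTop_zero.comp tendsto_norm_cobounded_atTop
    have h2 : Tendsto (fun z => Ψ (σ z)) (Bornology.cobounded ℂ) (𝓝[≠] 0) := by
      refine tendsto_nhdsWithin_iff.2 ⟨?_, hev.mono fun z hz => hΨne z hz.le⟩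
      have h3 := (hΨ.continuousAt (closedBall_mem_nhds 0 one_pos)).tendsto.comp h1
      rwa [hΨ0] at h3
    have h4 := (tendsto_const_add_cobounded p).comp (tendsto_inv₀_nhdsNE_zero.comp h2)
    exact h4.congr' (hev.mono fun z hz => (hHout z hz).symm)
  have hclosed : IsClosedMap H :=
    (isProperMap_iff_tendsto_cocompact.2 ⟨hH, htend⟩).isClosedMap
  refine ⟨(isHomeomorph_iff_continuous_isClosedMap_bijective.2
    ⟨hH, hclosed, hinj, hsurj⟩).homeomorph H, fun v hv => ?_⟩
  exact (hHin v (mem_sphere_zero_iff_norm.1 hv).le).trans (hΦγ hv)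

end IsJordanCurve

end Schoenflies

section PlaneModel

open Metric

theorem exists_homeomorph_extension (γ : C(↥unitCircle, EuclideanSpace ℝ (Fin 2)))
    (hγ : Function.Injective ⇑γ) :
    ∃ e : EuclideanSpace ℝ (Fin 2) ≃ₜ EuclideanSpace ℝ (Fin 2), ∀ v : ↥unitCircle, e v = γ v := by
  let E : ℂ ≃ₗᵢ[ℝ] EuclideanSpace ℝ (Fin 2) := Complex.orthonormalBasisOneI.repr
  have hE : ∀ z : sphere (0 : ℂ) 1, E z ∈ unitCircle := fun z =>
    (E.norm_map z).trans (mem_sphere_zero_iff_norm.1 z.2)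
  let g : sphere (0 : ℂ) 1 → ℂ := fun z => E.symm (γ ⟨E z, hE z⟩)
  have hg : Continuous g := E.symm.continuous.comp (γ.continuous.comp
    ((E.continuous.comp continuous_subtype_val).subtype_mk _))
  have hgi : Function.Injective g := fun z w hzw =>
    Subtype.ext (E.injective (Subtype.ext_iff.1 (hγ (E.symm.injective hzw))))
  let f : ℂ → ℂ := Function.extend Subtype.val g 0
  have hf : ∀ z : sphere (0 : ℂ) 1, f z = g z := fun z => Subtype.val_injective.extend_apply g 0 z
  have hfJ : IsJordanCurve f := by
    refine ⟨?_, fun z hz w hw hzw => ?_⟩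
    · rw [continuousOn_iff_continuous_domRestrict]
      exact hg.congr fun z => (hf z).symm
    · have h1 : g ⟨z, hz⟩ = g ⟨w, hw⟩ := ((hf ⟨z, hz⟩).symm.trans hzw).trans (hf ⟨w, hw⟩)
      exact Subtype.ext_iff.1 (hgi h1)
  obtain ⟨e, he⟩ := hfJ.exists_homeomorph
  refine ⟨(E.symm.toHomeomorph.trans e).trans E.toHomeomorph, fun v => ?_⟩
  have hv : E.symm v ∈ sphere (0 : ℂ) 1 :=
    mem_sphere_zero_iff_norm.2 ((E.symm.norm_map v).trans v.2)
  change E (e (E.symm v)) = γ v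
  rw [he _ hv, hf ⟨_, hv⟩]
  simp only [g, LinearIsometryEquiv.apply_symm_apply]

end PlaneModel

end

/-- **Borel Jordan–Schoenflies theorem.** There is a Borel measurable map
`H : Emb(S¹, ℝ²) → C(ℝ², ℝ²)` (where `Emb(S¹, ℝ²)` is the set of injective continuous maps
`S¹ → ℝ²` with the subspace topology of the compact-open topology, and both sides carry
their Borel σ-algebras) such that for every `γ`, `H γ` is a homeomorphism of `ℝ²` onto
itself which agrees with `γ` on `S¹`. -/
theorem borel_jordan_schoenflies :
    ∃ H : {γ : C(↥unitCircle, EuclideanSpace ℝ (Fin 2)) // Function.Injective ⇑γ} →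
        C(EuclideanSpace ℝ (Fin 2), EuclideanSpace ℝ (Fin 2)),
      @Measurable _ _ (borel _) (borel _) H ∧
      ∀ γ,
        (∃ e : EuclideanSpace ℝ (Fin 2) ≃ₜ EuclideanSpace ℝ (Fin 2), ∀ x, e x = H γ x) ∧
        ∀ v : ↥unitCircle, H γ (v : EuclideanSpace ℝ (Fin 2)) = γ.1 v :=
  exists_measurable_homeo_extension exists_homeomorph_extension
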